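/- Let R be a locally complete intersection ring (i.e., R_p is a complete intersection local ring for every prime p). Then the maps Φ and Ψ, defined by Φ(X) = (X ∩ PD(R), X ∩ MCM(R)) and Ψ(Y, Z) = res(Y ∪ Z), are mutually inverse bijections between the set of resolving subcategories of mod R and the set of pairs (Y, Z) where Y is a resolving subcategory of mod R contained in PD(R) and Z is a resolving subcategory of mod R contained in MCM(R). -/

import Mathlib

universe u

open CategoryTheory

namespace ResolvPaper

variable (R : Type u) [CommRing R]

/-- `IsSES f g` means `0 → A → B → C → 0` is a short exact sequence. -/
def IsSES {R : Type u} [CommRing R] {A B C : Type u} [AddCommGroup A] [Module R A]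
    [AddCommGroup B] [Module R B] [AddCommGroup C] [Module R C]
    (f : A →ₗ[R] B) (g : B →ₗ[R] C) : Prop :=
  Function.Injective f ∧ Function.Surjective g ∧ LinearMap.range f = LinearMap.ker g

/-- A resolving subcategory of `mod R`, viewed as a set of bundled modules
closed under isomorphism, containing the finitely generated projective modules, and closed
under direct summands, extensions and syzygies. -/
structure IsResolving (𝒳 : Set (ModuleCat.{u} R)) : Prop where
  fg : ∀ M ∈ 𝒳, Module.Finite R M
  iso_closed : ∀ M N : ModuleCat.{u} R, Nonempty (M ≃ₗ[R] N) → M ∈ 𝒳 → N ∈ 𝒳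
  proj_mem : ∀ M : ModuleCat.{u} R, Module.Finite R M → Module.Projective R M → M ∈ 𝒳
  summand_closed : ∀ M N : ModuleCat.{u} R, ModuleCat.of R (↥M × ↥N) ∈ 𝒳 → M ∈ 𝒳
  ext_closed : ∀ (A B C : ModuleCat.{u} R) (f : A →ₗ[R] B) (g : B →ₗ[R] C),
    IsSES f g → A ∈ 𝒳 → C ∈ 𝒳 → B ∈ 𝒳
  syzygy_closed : ∀ (K P M : ModuleCat.{u} R) (f : K →ₗ[R] P) (g : P →ₗ[R] M),
    IsSES f g → Module.Finite R K → Module.Finite R P → Module.Projective R P →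
    M ∈ 𝒳 → K ∈ 𝒳

/-- The resolving closure: the smallest resolving subcategory containing `S`. -/
def resClosure (S : Set (ModuleCat.{u} R)) : Set (ModuleCat.{u} R) :=
  ⋂₀ {𝒳 | IsResolving R 𝒳 ∧ S ⊆ 𝒳}

/-- An extension-closed subcategory of `mod R`: closed under isomorphism,
direct summands and extensions. -/
def IsExtClosed (𝒳 : Set (ModuleCat.{u} R)) : Prop :=
  (∀ M N : ModuleCat.{u} R, Nonempty (M ≃ₗ[R] N) → M ∈ 𝒳 → N ∈ 𝒳) ∧
  (∀ M N : ModuleCat.{u} R, ModuleCat.of R (↥M × ↥N) ∈ 𝒳 → M ∈ 𝒳) ∧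
  (∀ (A B C : ModuleCat.{u} R) (f : A →ₗ[R] B) (g : B →ₗ[R] C),
    IsSES f g → A ∈ 𝒳 → C ∈ 𝒳 → B ∈ 𝒳)

/-- The extension closure of a set of modules. -/
def extClosure (S : Set (ModuleCat.{u} R)) : Set (ModuleCat.{u} R) :=
  ⋂₀ {𝒳 | IsExtClosed R 𝒳 ∧ S ⊆ 𝒳}

/-- `add R`: direct summands of finite free modules. -/
def addR : Set (ModuleCat.{u} R) :=
  {M | ∃ (n : ℕ) (N : ModuleCat.{u} R), Nonempty ((↥M × ↥N) ≃ₗ[R] (Fin n → R))}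

/-- `pdLE n M` : the projective dimension of `M` is at most `n`. -/
def pdLE : ℕ → ModuleCat.{u} R → Prop
  | 0, M => Module.Projective R M
  | n+1, M => ∃ (K P : ModuleCat.{u} R) (f : K →ₗ[R] P) (g : P →ₗ[R] M),
      Module.Finite R P ∧ Module.Projective R P ∧ IsSES f g ∧ pdLE n K

/-- The projective dimension, an element of `WithBot ℕ∞`; the zero module
has projective dimension `⊥ = -∞`. -/
noncomputable def pdim (M : ModuleCat.{u} R) : WithBot ℕ∞ :=
  sInf {x : WithBot ℕ∞ | (x = ⊥ ∧ Subsingleton M) ∨ ∃ n : ℕ, x = (n : ℕ∞) ∧ pdLE R n M}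

/-- The depth of `M` with respect to the ideal `I`: the supremum of lengths of weakly
`M`-regular sequences contained in `I`.  The zero module has depth `∞`. -/
noncomputable def depthE (I : Ideal R) (M : Type u) [AddCommGroup M] [Module R M] : ℕ∞ :=
  sSup {x : ℕ∞ | ∃ rs : List R, (∀ r ∈ rs, r ∈ I) ∧
    RingTheory.Sequence.IsWeaklyRegular M rs ∧ x = rs.length}

/-- The grade of an ideal: the length of a maximal `R`-regular sequence in `I`. -/
noncomputable def gradeE (I : Ideal R) : ℕ∞ := depthE R I R

/-- A grade consistent function on `Spec R`. -/
def GradeConsistent (f : PrimeSpectrum R → ℕ) : Prop :=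
  (∀ p : PrimeSpectrum R, (f p : ℕ∞) ≤ gradeE R p.asIdeal) ∧
  (∀ p q : PrimeSpectrum R, p.asIdeal ≤ q.asIdeal → f p ≤ f q)

/-- The localization of a module at a prime, as a module over the local ring `R_p`. -/
noncomputable abbrev localizeM (p : PrimeSpectrum R) (M : ModuleCat.{u} R) :
    ModuleCat.{u} (Localization.AtPrime p.asIdeal) :=
  ModuleCat.of (Localization.AtPrime p.asIdeal) (LocalizedModule p.asIdeal.primeCompl M)

/-- `pd_{R_p} M_p`. -/
noncomputable def localPdim (p : PrimeSpectrum R) (M : ModuleCat.{u} R) : WithBot ℕ∞ :=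
  pdim (Localization.AtPrime p.asIdeal) (localizeM R p M)

/-- `depth_{R_p} M_p`. -/
noncomputable def localDepth (p : PrimeSpectrum R) (M : ModuleCat.{u} R) : ℕ∞ :=
  depthE (Localization.AtPrime p.asIdeal)
    (IsLocalRing.maximalIdeal (Localization.AtPrime p.asIdeal))
    (LocalizedModule p.asIdeal.primeCompl M)

/-- The height of a prime ideal. -/
noncomputable def heightE (p : PrimeSpectrum R) : ℕ∞ := Order.height p

/-- `PD(R)` : finitely generated modules of finite projective dimension. -/
def PDcat : Set (ModuleCat.{u} R) :=
  {M | Module.Finite R M ∧ ∃ n : ℕ, pdLE R n M}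

/-- `MCM(R)` : maximal Cohen-Macaulay modules. -/
def MCMcat : Set (ModuleCat.{u} R) :=
  {M | Module.Finite R M ∧ ∀ p : PrimeSpectrum R, heightE R p ≤ localDepth R p M}

/-- The nonfree locus of a module. -/
def NF (M : ModuleCat.{u} R) : Set (PrimeSpectrum R) :=
  {p | ¬ Module.Free (Localization.AtPrime p.asIdeal) (LocalizedModule p.asIdeal.primeCompl M)}

/-- The infinite projective dimension locus of a module. -/
def IPD (M : ModuleCat.{u} R) : Set (PrimeSpectrum R) :=
  {p | localPdim R p M = (⊤ : WithBot ℕ∞)}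

/-- The infinite projective dimension locus of a collection of modules. -/
def IPDcat (𝒳 : Set (ModuleCat.{u} R)) : Set (PrimeSpectrum R) :=
  ⋃ M ∈ 𝒳, IPD R M

/-- The modules in `mod R` whose infinite projective dimension locus lies in `W`. -/
def IPDinv (W : Set (PrimeSpectrum R)) : Set (ModuleCat.{u} R) :=
  {M | Module.Finite R M ∧ IPD R M ⊆ W}

/-- A specialization closed subset of `Spec R`. -/
def SpecClosed (W : Set (PrimeSpectrum R)) : Prop :=
  ∀ p ∈ W, ∀ q : PrimeSpectrum R, p.asIdeal ≤ q.asIdeal → q ∈ W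

/-- Membership in `add 𝒳_p`: direct summands of localizations of finite direct sums
of members of `𝒳`. -/
def memAddLocal (𝒳 : Set (ModuleCat.{u} R)) (p : PrimeSpectrum R)
    (N : ModuleCat.{u} (Localization.AtPrime p.asIdeal)) : Prop :=
  ∃ (n : ℕ) (X : Fin n → ModuleCat.{u} R), (∀ i, X i ∈ 𝒳) ∧
    ∃ (N' : ModuleCat.{u} (Localization.AtPrime p.asIdeal)),
      Nonempty ((↥N × ↥N') ≃ₗ[Localization.AtPrime p.asIdeal]
        ((i : Fin n) → LocalizedModule p.asIdeal.primeCompl (X i)))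

/-- `K` is an `n`-th syzygy of `M` computed from a minimal free resolution over the
local ring `S`. -/
def IsMinSyz (S : Type u) [CommRing S] [IsLocalRing S] :
    ℕ → ModuleCat.{u} S → ModuleCat.{u} S → Prop
  | 0, M, K => Nonempty (K ≃ₗ[S] M)
  | n+1, M, K => ∃ (F : ModuleCat.{u} S) (g : F →ₗ[S] M) (K' : ModuleCat.{u} S)
      (i : K' →ₗ[S] F),
      Module.Finite S F ∧ Module.Free S F ∧ Function.Surjective g ∧
      (LinearMap.ker g ≤ (IsLocalRing.maximalIdeal S) • (⊤ : Submodule S F)) ∧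
      Function.Injective i ∧ LinearMap.range i = LinearMap.ker g ∧
      IsMinSyz S n K' K

/-- `K` is an `n`-th syzygy of `M` in some projective resolution (over any ring). -/
def IsSyz : ℕ → ModuleCat.{u} R → ModuleCat.{u} R → Prop
  | 0, M, K => Nonempty (K ≃ₗ[R] M)
  | n+1, M, K => ∃ (F : ModuleCat.{u} R) (g : F →ₗ[R] M) (K' : ModuleCat.{u} R)
      (i : K' →ₗ[R] F),
      Module.Finite R F ∧ Module.Projective R F ∧ Function.Surjective g ∧
      Function.Injective i ∧ LinearMap.range i = LinearMap.ker g ∧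
      IsSyz n K' K

/-- `T` is (isomorphic to) the Auslander transpose of `M`, computed from a minimal
free presentation over the local ring `S`. -/
def IsTranspose (S : Type u) [CommRing S] [IsLocalRing S] (M T : ModuleCat.{u} S) : Prop :=
  ∃ (F1 F0 : ModuleCat.{u} S) (d : F1 →ₗ[S] F0) (e : F0 →ₗ[S] M),
    Module.Finite S F0 ∧ Module.Free S F0 ∧ Module.Finite S F1 ∧ Module.Free S F1 ∧
    Function.Surjective e ∧ LinearMap.range d = LinearMap.ker e ∧
    LinearMap.ker e ≤ (IsLocalRing.maximalIdeal S) • (⊤ : Submodule S F0) ∧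
    LinearMap.ker d ≤ (IsLocalRing.maximalIdeal S) • (⊤ : Submodule S F1) ∧
    Nonempty (T ≃ₗ[S] ((Module.Dual S F1) ⧸ LinearMap.range d.dualMap))

/-- `T` is (isomorphic to) `Tr Ω^n M` over the local ring `S`. -/
def IsTrOmega (S : Type u) [CommRing S] [IsLocalRing S] (n : ℕ) (M T : ModuleCat.{u} S) :
    Prop :=
  ∃ K : ModuleCat.{u} S, IsMinSyz S n M K ∧ IsTranspose S K T

/-- Resolving subcategory `𝒳` is dominant on `W ⊆ Spec R`. -/
def DominantOn (𝒳 : Set (ModuleCat.{u} R)) (W : Set (PrimeSpectrum R)) : Prop :=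
  ∀ p ∈ W, ∃ (n : ℕ) (K : ModuleCat.{u} (Localization.AtPrime p.asIdeal)),
    IsMinSyz (Localization.AtPrime p.asIdeal) n
      (ModuleCat.of (Localization.AtPrime p.asIdeal)
        (IsLocalRing.ResidueField (Localization.AtPrime p.asIdeal))) K ∧
    memAddLocal R 𝒳 p K

/-- Dominant resolving subcategory. -/
def Dominant (𝒳 : Set (ModuleCat.{u} R)) : Prop := DominantOn R 𝒳 Set.univ

/-- A (noetherian) local ring is Cohen-Macaulay if its depth equals its Krull dimension. -/
def IsCMLocalRing (S : Type u) [CommRing S] [IsLocalRing S] : Prop :=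
  IsNoetherianRing S ∧
    ((depthE S (IsLocalRing.maximalIdeal S) S : WithBot ℕ∞) = ringKrullDim S)

/-- A regular local ring: a noetherian local ring whose maximal ideal is generated by
`dim S` elements. -/
def IsRegLocalRing (S : Type u) [CommRing S] [IsLocalRing S] : Prop :=
  IsNoetherianRing S ∧ ∃ s : Finset S,
    Ideal.span (s : Set S) = IsLocalRing.maximalIdeal S ∧
    ringKrullDim S = (s.card : WithBot ℕ∞)

/-- The singular locus of `R`. -/
def SingLocus : Set (PrimeSpectrum R) :=
  {p | ¬ IsRegLocalRing (Localization.AtPrime p.asIdeal)}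

/-- A hypersurface local ring: the completion is a quotient of a regular local ring by
one element. -/
def IsHypersurfaceLocalRing (S : Type u) [CommRing S] [IsLocalRing S] : Prop :=
  ∃ (T : Type u) (_ : CommRing T) (_ : IsLocalRing T) (f : T),
    IsRegLocalRing T ∧
    Nonempty ((AdicCompletion (IsLocalRing.maximalIdeal S) S) ≃+* (T ⧸ Ideal.span {f}))

/-- A complete intersection local ring: the completion is a quotient of a regular local
ring by a regular sequence. -/
def IsCompleteIntersectionLocalRing (S : Type u) [CommRing S] [IsLocalRing S] : Prop :=
  ∃ (T : Type u) (_ : CommRing T) (_ : IsLocalRing T) (rs : List T),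
    IsRegLocalRing T ∧ RingTheory.Sequence.IsRegular T rs ∧
    Nonempty ((AdicCompletion (IsLocalRing.maximalIdeal S) S) ≃+*
      (T ⧸ Ideal.ofList rs))

/-- The subquotient `A / (A ⊓ B)` of two submodules, used for homology. -/
def subquot {S M : Type u} [CommRing S] [AddCommGroup M] [Module S M]
    (A B : Submodule S M) : Type u :=
  A ⧸ (B.comap A.subtype)

noncomputable instance {S M : Type u} [CommRing S] [AddCommGroup M] [Module S M]
    (A B : Submodule S M) : AddCommGroup (subquot A B) :=
  inferInstanceAs (AddCommGroup (A ⧸ (B.comap A.subtype)))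

noncomputable instance {S M : Type u} [CommRing S] [AddCommGroup M] [Module S M]
    (A B : Submodule S M) : Module S (subquot A B) :=
  inferInstanceAs (Module S (A ⧸ (B.comap A.subtype)))

/-- `E` is (isomorphic to) `Ext^{j+1}_S(M, S)`, computed from a finite free resolution. -/
def IsExtPos (S : Type u) [CommRing S] (j : ℕ) (M E : ModuleCat.{u} S) : Prop :=
  ∃ (F : ℕ → ModuleCat.{u} S) (d : ∀ i : ℕ, (F (i+1) : Type u) →ₗ[S] F i)
    (e : (F 0 : Type u) →ₗ[S] M),
    (∀ i, Module.Finite S (F i)) ∧ (∀ i, Module.Free S (F i)) ∧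
    Function.Surjective e ∧ LinearMap.range (d 0) = LinearMap.ker e ∧
    (∀ i, LinearMap.range (d (i+1)) = LinearMap.ker (d i)) ∧
    Nonempty (E ≃ₗ[S]
      subquot (LinearMap.ker ((d (j+1)).dualMap)) (LinearMap.range ((d j).dualMap)))

/-- `T` is (isomorphic to) `Tor_n^S(M, N)`, computed from a projective resolution of `M`. -/
def IsTor (S : Type u) [CommRing S] (n : ℕ) (M N T : ModuleCat.{u} S) : Prop :=
  ∃ (F : ℕ → ModuleCat.{u} S) (d : ∀ i : ℕ, (F (i+1) : Type u) →ₗ[S] F i)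
    (e : (F 0 : Type u) →ₗ[S] M),
    (∀ i, Module.Projective S (F i)) ∧
    Function.Surjective e ∧ LinearMap.range (d 0) = LinearMap.ker e ∧
    (∀ i, LinearMap.range (d (i+1)) = LinearMap.ker (d i)) ∧
    (match n with
      | 0 => Nonempty (T ≃ₗ[S] TensorProduct S M N)
      | (j+1) => Nonempty (T ≃ₗ[S]
          subquot (LinearMap.ker (LinearMap.rTensor (↥N) (d j)))
            (LinearMap.range (LinearMap.rTensor (↥N) (d (j+1))))))

/-- `idLE n M` : the injective dimension of `M` is at most `n`. -/
def idLE (S : Type u) [CommRing S] : ℕ → ModuleCat.{u} S → Prop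
  | 0, M => Module.Injective S M
  | n+1, M => ∃ (I C : ModuleCat.{u} S) (f : M →ₗ[S] I) (g : I →ₗ[S] C),
      IsSES f g ∧ Module.Injective S I ∧ idLE S n C

/-- `PD_0^n(R)` over a local ring: modules of projective dimension at most `n` that are
free on the punctured spectrum. -/
def PD0n [IsLocalRing R] (n : ℕ) : Set (ModuleCat.{u} R) :=
  {M | Module.Finite R M ∧ pdLE R n M ∧
    ∀ p : PrimeSpectrum R, p.asIdeal ≠ IsLocalRing.maximalIdeal R →
      Module.Free (Localization.AtPrime p.asIdeal) (LocalizedModule p.asIdeal.primeCompl M)}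

/-- `PD_0(R)` over a local ring: modules of finite projective dimension that are
free on the punctured spectrum. -/
def PD0 [IsLocalRing R] : Set (ModuleCat.{u} R) :=
  {M | Module.Finite R M ∧ (∃ n : ℕ, pdLE R n M) ∧
    ∀ p : PrimeSpectrum R, p.asIdeal ≠ IsLocalRing.maximalIdeal R →
      Module.Free (Localization.AtPrime p.asIdeal) (LocalizedModule p.asIdeal.primeCompl M)}

/-- The residue field of a local ring, as a bundled module. -/
noncomputable abbrev residueMod (S : Type u) [CommRing S] [IsLocalRing S] : ModuleCat.{u} S :=
  ModuleCat.of S (IsLocalRing.ResidueField S)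



end ResolvPaper
namespace ResolvPaper

/-! ## Basic facts on short exact sequences and Ext -/
section ext
variable {S : Type u} [CommRing S]
variable {A B C M N : Type u} [AddCommGroup A] [Module S A] [AddCommGroup B] [Module S B]
  [AddCommGroup C] [Module S C] [AddCommGroup M] [Module S M] [AddCommGroup N] [Module S N]

theorem IsSES.comp_zero {f : A →ₗ[S] B} {g : B →ₗ[S] C} (h : IsSES f g) : g ∘ₗ f = 0 := by
  ext a
  have : f a ∈ LinearMap.ker g := by rw [← h.2.2]; exact ⟨a, rfl⟩
  simpa using this

theorem IsSES.apply_zero {f : A →ₗ[S] B} {g : B →ₗ[S] C} (h : IsSES f g) (a : A) :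
    g (f a) = 0 := LinearMap.congr_fun h.comp_zero a

theorem IsSES.exists_of {f : A →ₗ[S] B} {g : B →ₗ[S] C} (h : IsSES f g) (b : B) (hb : g b = 0) :
    ∃ a, f a = b := by
  have : b ∈ LinearMap.range f := by rw [h.2.2]; simpa using hb
  exact this

theorem IsSES.mk' {f : A →ₗ[S] B} {g : B →ₗ[S] C} (hf : Function.Injective f)
    (hg : Function.Surjective g) (h0 : ∀ a, g (f a) = 0) (h1 : ∀ b, g b = 0 → ∃ a, f a = b) :
    IsSES f g := by
  refine ⟨hf, hg, le_antisymm ?_ ?_⟩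
  · rintro _ ⟨a, rfl⟩; exact h0 a
  · intro b hb; exact h1 b hb

theorem IsSES.ker (g : B →ₗ[S] C) (hg : Function.Surjective g) :
    IsSES (LinearMap.ker g).subtype g :=
  ⟨Subtype.val_injective, hg, by simp⟩

theorem IsSES.quot (U : Submodule S B) : IsSES U.subtype U.mkQ :=
  ⟨Subtype.val_injective, U.mkQ_surjective, by simp⟩

/-- short complex associated with an SES -/
def IsSES.sc {f : A →ₗ[S] B} {g : B →ₗ[S] C} (h : IsSES f g) :
    ShortComplex (ModuleCat.{u} S) :=
  ShortComplex.mk (ModuleCat.ofHom f) (ModuleCat.ofHom g)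
    (by rw [← ModuleCat.ofHom_comp, h.comp_zero]; rfl)

theorem IsSES.shortExact {f : A →ₗ[S] B} {g : B →ₗ[S] C} (h : IsSES f g) : h.sc.ShortExact := by
  apply ModuleCat.shortComplex_shortExact
  · rw [LinearMap.exact_iff]; exact h.2.2.symm
  · exact h.1
  · exact h.2.1

/-- Ext modules, unbundled. -/
abbrev XT (S : Type u) [CommRing S] (M N : Type u) [AddCommGroup M] [Module S M]
    [AddCommGroup N] [Module S N] (n : ℕ) : Type u :=
  Abelian.Ext (ModuleCat.of S M) (ModuleCat.of S N) n

/-- contravariant functoriality -/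
noncomputable def XT.pre (f : A →ₗ[S] B) (N : Type u) [AddCommGroup N] [Module S N] (n : ℕ) :
    XT S B N n →ₗ[S] XT S A N n :=
  Abelian.Ext.precompOfLinear (Abelian.Ext.mk₀ (ModuleCat.ofHom f)) S _ (zero_add n)

/-- covariant functoriality -/
noncomputable def XT.post (M : Type u) [AddCommGroup M] [Module S M] (f : A →ₗ[S] B) (n : ℕ) :
    XT S M A n →ₗ[S] XT S M B n :=
  Abelian.Ext.postcompOfLinear (Abelian.Ext.mk₀ (ModuleCat.ofHom f)) S _ (add_zero n)

theorem XT.pre_apply (f : A →ₗ[S] B) (n : ℕ) (e : XT S B N n) :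
    XT.pre f N n e = (Abelian.Ext.mk₀ (ModuleCat.ofHom f)).comp e (zero_add n) := rfl

theorem XT.pre_comp (f : A →ₗ[S] B) (g : B →ₗ[S] C) (n : ℕ) (e : XT S C N n) :
    XT.pre (g ∘ₗ f) N n e = XT.pre f N n (XT.pre g N n e) := by
  rw [XT.pre_apply, XT.pre_apply, XT.pre_apply, Abelian.Ext.mk₀_comp_mk₀_assoc]
  rfl

theorem XT.pre_id (n : ℕ) (e : XT S A N n) :
    XT.pre LinearMap.id N n e = e := by
  rw [XT.pre_apply]
  exact Abelian.Ext.mk₀_id_comp e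

theorem XT.pre_smul (r : S) (f : A →ₗ[S] B) (n : ℕ) (e : XT S B N n) :
    XT.pre (r • f) N n e = r • XT.pre f N n e := by
  rw [XT.pre_apply, XT.pre_apply, ← Abelian.Ext.smul_comp, ← Abelian.Ext.mk₀_smul]
  rfl

theorem XT.pre_add (f g : A →ₗ[S] B) (n : ℕ) (e : XT S B N n) :
    XT.pre (f + g) N n e = XT.pre f N n e + XT.pre g N n e := by
  rw [XT.pre_apply, XT.pre_apply, XT.pre_apply, ← Abelian.Ext.add_comp, ← Abelian.Ext.mk₀_add]
  rfl

theorem XT.pre_zero (n : ℕ) (e : XT S B N n) :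
    XT.pre (0 : A →ₗ[S] B) N n e = 0 := by
  have := XT.pre_smul (0 : S) (0 : A →ₗ[S] B) n e
  simpa using this

/-- connecting map -/
noncomputable def IsSES.del {f : A →ₗ[S] B} {g : B →ₗ[S] C} (h : IsSES f g) (N : Type u)
    [AddCommGroup N] [Module S N] (n : ℕ) : XT S A N n →ₗ[S] XT S C N (n+1) :=
  Abelian.Ext.precompOfLinear h.shortExact.extClass S _ (by omega)

theorem IsSES.ex1 {f : A →ₗ[S] B} {g : B →ₗ[S] C} (h : IsSES f g) {n : ℕ} (e : XT S A N n)
    (he : h.del N n e = 0) : ∃ e', XT.pre f N n e' = e :=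
  Abelian.Ext.contravariant_sequence_exact₁ h.shortExact _ e (by omega) he

theorem IsSES.ex2 {f : A →ₗ[S] B} {g : B →ₗ[S] C} (h : IsSES f g) {n : ℕ} (e : XT S B N n)
    (he : XT.pre f N n e = 0) : ∃ e', XT.pre g N n e' = e :=
  Abelian.Ext.contravariant_sequence_exact₂ h.shortExact _ e he

theorem IsSES.ex3 {f : A →ₗ[S] B} {g : B →ₗ[S] C} (h : IsSES f g) {n : ℕ} (e : XT S C N (n+1))
    (he : XT.pre g N (n+1) e = 0) : ∃ e', h.del N n e' = e :=
  Abelian.Ext.contravariant_sequence_exact₃ h.shortExact _ e he (by omega)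

theorem IsSES.del_pre {f : A →ₗ[S] B} {g : B →ₗ[S] C} (h : IsSES f g) {n : ℕ} (e : XT S B N n) :
    h.del N n (XT.pre f N n e) = 0 := by
  have key : ∀ (T : ShortComplex (ModuleCat.{u} S)) (hT : T.ShortExact) (Y : ModuleCat.{u} S)
      (e : Abelian.Ext T.X₂ Y n),
      hT.extClass.comp ((Abelian.Ext.mk₀ T.f).comp e (zero_add n)) (show 1 + n = n + 1 by omega)
        = 0 := by
    intro T hT Y e
    rw [← Abelian.Ext.comp_assoc _ _ _ (by omega : 1 + 0 = 1) (by omega) (by omega),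
      hT.extClass_comp, Abelian.Ext.zero_comp]
  exact key h.sc h.shortExact (ModuleCat.of S N) e

theorem IsSES.coex1 {f : A →ₗ[S] B} {g : B →ₗ[S] C} (h : IsSES f g) {n : ℕ}
    (hB : ∀ e : XT S M B n, e = 0) (hA : ∀ e : XT S M A (n+1), e = 0) (e : XT S M C n) : e = 0 := by
  obtain ⟨x, hx⟩ := Abelian.Ext.covariant_sequence_exact₃ (ModuleCat.of S M) h.shortExact e rfl
    (hA _)
  rw [← hx, hB x]; exact Abelian.Ext.zero_comp ..

theorem IsSES.coex2 {f : A →ₗ[S] B} {g : B →ₗ[S] C} (h : IsSES f g) {n : ℕ}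
    (hA : ∀ e : XT S M A n, e = 0) (hC : ∀ e : XT S M C n, e = 0) (e : XT S M B n) : e = 0 := by
  obtain ⟨x, hx⟩ := Abelian.Ext.covariant_sequence_exact₂ (ModuleCat.of S M) h.shortExact e
    (hC _)
  rw [← hx, hA x]; exact Abelian.Ext.zero_comp ..

/-- covariant, shift: from vanishing for `C` in degree n and B in degree n+1. -/
theorem IsSES.coex3 {f : A →ₗ[S] B} {g : B →ₗ[S] C} (h : IsSES f g) {n : ℕ}
    (hB : ∀ e : XT S M B (n+1), e = 0) (hC : ∀ e : XT S M C n, e = 0) (e : XT S M A (n+1)) :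
    e = 0 := by
  obtain ⟨x, hx⟩ := Abelian.Ext.covariant_sequence_exact₁ (ModuleCat.of S M) h.shortExact e
    (hB _) rfl
  rw [← hx, hC x]; exact Abelian.Ext.zero_comp ..

theorem XT.proj_zero (P : Type u) [AddCommGroup P] [Module S P] [Module.Projective S P] {n : ℕ}
    (e : XT S P N (n+1)) : e = 0 := by
  have : Projective (ModuleCat.of S P) := (IsProjective.iff_projective P).1 inferInstance
  exact Abelian.Ext.eq_zero_of_projective e

/-- Degree zero. -/
noncomputable def XT.zeroEquiv (M N : Type u) [AddCommGroup M] [Module S M]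
    [AddCommGroup N] [Module S N] : XT S M N 0 ≃ₗ[S] (M →ₗ[S] N) :=
  Abelian.Ext.linearEquiv₀.trans ModuleCat.homLinearEquiv

theorem XT.zeroEquiv_symm (h : M →ₗ[S] N) :
    (XT.zeroEquiv M N).symm h = Abelian.Ext.mk₀ (ModuleCat.ofHom h) := rfl

theorem XT.zeroEquiv_pre (f : A →ₗ[S] B) (e : XT S B N 0) :
    XT.zeroEquiv A N (XT.pre f N 0 e) = (XT.zeroEquiv B N e) ∘ₗ f := by
  obtain ⟨h, rfl⟩ := (XT.zeroEquiv B N).symm.surjective e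
  rw [LinearEquiv.apply_symm_apply, ← LinearEquiv.eq_symm_apply, XT.zeroEquiv_symm,
    XT.zeroEquiv_symm, XT.pre_apply, Abelian.Ext.mk₀_comp_mk₀]
  rfl

theorem XT.zeroEquiv_post (f : A →ₗ[S] B) (e : XT S M A 0) :
    XT.zeroEquiv M B (XT.post M f 0 e) = f ∘ₗ (XT.zeroEquiv M A e) := by
  obtain ⟨h, rfl⟩ := (XT.zeroEquiv M A).symm.surjective e
  rw [LinearEquiv.apply_symm_apply, ← LinearEquiv.eq_symm_apply, XT.zeroEquiv_symm,
    XT.zeroEquiv_symm]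
  change (Abelian.Ext.mk₀ _).comp (Abelian.Ext.mk₀ _) (add_zero 0) = _
  rw [Abelian.Ext.mk₀_comp_mk₀]
  rfl

theorem XT.post_comp (f : A →ₗ[S] B) (g : B →ₗ[S] C) (n : ℕ) (e : XT S M A n) :
    XT.post M (g ∘ₗ f) n e = XT.post M g n (XT.post M f n e) := by
  change Abelian.Ext.comp _ (Abelian.Ext.mk₀ _) (add_zero n) =
    Abelian.Ext.comp (Abelian.Ext.comp _ (Abelian.Ext.mk₀ _) (add_zero n))
      (Abelian.Ext.mk₀ _) (add_zero n)
  rw [Abelian.Ext.comp_assoc _ _ _ (by omega : n + 0 = n) (by omega : 0 + 0 = 0) (by omega),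
    Abelian.Ext.mk₀_comp_mk₀]
  rfl

theorem XT.post_id (n : ℕ) (e : XT S M A n) :
    XT.post M LinearMap.id n e = e := by
  exact Abelian.Ext.comp_mk₀_id e

/-! ### torsion vanishing -/

/-- `TV W M N n`: `Ext^n(M,N)` is `W`-torsion. -/
def TV (W : Submonoid S) (M N : Type u) [AddCommGroup M] [Module S M]
    [AddCommGroup N] [Module S N] (n : ℕ) : Prop :=
  ∀ e : XT S M N n, ∃ s ∈ W, s • e = 0

/-- `EV M N n`: `Ext^n(M,N) = 0`. -/
def EV (S : Type u) [CommRing S] (M N : Type u) [AddCommGroup M] [Module S M]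
    [AddCommGroup N] [Module S N] (n : ℕ) : Prop :=
  ∀ e : XT S M N n, e = 0

theorem TV_bot {n : ℕ} : TV (⊥ : Submonoid S) M N n ↔ EV S M N n := by
  refine forall_congr' fun e => ?_
  simp [Submonoid.mem_bot]

theorem EV.tv {n : ℕ} (h : EV S M N n) (W : Submonoid S) : TV W M N n :=
  fun e => ⟨1, W.one_mem, by rw [h e, smul_zero]⟩

theorem TV.mono {n : ℕ} {W W' : Submonoid S} (h : TV W M N n) (hW : W ≤ W') : TV W' M N n :=
  fun e => let ⟨s, hs, h⟩ := h e; ⟨s, hW hs, h⟩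

variable {W : Submonoid S} {f : A →ₗ[S] B} {g : B →ₗ[S] C} {n : ℕ}

theorem IsSES.tv_mid (h : IsSES f g) (hA : TV W A N n) (hC : TV W C N n) : TV W B N n := by
  intro e
  obtain ⟨s, hs, h1⟩ := hA (XT.pre f N n e)
  rw [← map_smul] at h1
  obtain ⟨e', he'⟩ := h.ex2 _ h1
  obtain ⟨t, ht, h2⟩ := hC e'
  refine ⟨t * s, W.mul_mem ht hs, ?_⟩
  rw [mul_smul, ← he', ← map_smul, h2, map_zero]

theorem IsSES.tv_left (h : IsSES f g) (hB : TV W B N n) (hC : TV W C N (n+1)) : TV W A N n := by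
  intro e
  obtain ⟨s, hs, h1⟩ := hC (h.del N n e)
  rw [← map_smul] at h1
  obtain ⟨e', he'⟩ := h.ex1 _ h1
  obtain ⟨t, ht, h2⟩ := hB e'
  refine ⟨t * s, W.mul_mem ht hs, ?_⟩
  rw [mul_smul, ← he', ← map_smul, h2, map_zero]

theorem IsSES.tv_right (h : IsSES f g) (hA : TV W A N n) (hB : TV W B N (n+1)) :
    TV W C N (n+1) := by
  intro e
  obtain ⟨s, hs, h1⟩ := hB (XT.pre g N (n+1) e)
  rw [← map_smul] at h1
  obtain ⟨e', he'⟩ := h.ex3 _ h1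
  obtain ⟨t, ht, h2⟩ := hA e'
  refine ⟨t * s, W.mul_mem ht hs, ?_⟩
  rw [mul_smul, ← he', ← map_smul, h2, map_zero]

theorem IsSES.ev_mid (h : IsSES f g) (hA : EV S A N n) (hC : EV S C N n) : EV S B N n :=
  TV_bot.1 (h.tv_mid (TV_bot.2 hA) (TV_bot.2 hC))
theorem IsSES.ev_left (h : IsSES f g) (hB : EV S B N n) (hC : EV S C N (n+1)) : EV S A N n :=
  TV_bot.1 (h.tv_left (TV_bot.2 hB) (TV_bot.2 hC))
theorem IsSES.ev_right (h : IsSES f g) (hA : EV S A N n) (hB : EV S B N (n+1)) : EV S C N (n+1) :=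
  TV_bot.1 (h.tv_right (TV_bot.2 hA) (TV_bot.2 hB))

theorem EV.proj (P : Type u) [AddCommGroup P] [Module S P] [Module.Projective S P] (hn : 1 ≤ n) :
    EV S P N n := by
  obtain ⟨k, rfl⟩ : ∃ k, n = k+1 := ⟨n-1, by omega⟩
  exact fun e => XT.proj_zero P e

/-- dimension shift -/
theorem IsSES.tv_shift (h : IsSES f g) [Module.Projective S B] (hn : 1 ≤ n) :
    TV W A N n ↔ TV W C N (n+1) :=
  ⟨fun hA => h.tv_right hA ((EV.proj B (by omega)).tv W),
    fun hC => h.tv_left ((EV.proj B hn).tv W) hC⟩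

theorem IsSES.ev_shift (h : IsSES f g) [Module.Projective S B] (hn : 1 ≤ n) :
    EV S A N n ↔ EV S C N (n+1) := by
  rw [← TV_bot, ← TV_bot, h.tv_shift hn]

theorem IsSES.tv_one (h : IsSES f g) [Module.Projective S B] :
    TV W C N 1 ↔ ∀ k : A →ₗ[S] N, ∃ s ∈ W, ∃ l : B →ₗ[S] N, l ∘ₗ f = s • k := by
  constructor
  · intro H k
    obtain ⟨s, hs, h1⟩ := H (h.del N 0 ((XT.zeroEquiv A N).symm k))
    rw [← map_smul] at h1
    obtain ⟨e', he'⟩ := h.ex1 _ h1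
    refine ⟨s, hs, XT.zeroEquiv B N e', ?_⟩
    rw [← XT.zeroEquiv_pre, he', map_smul, LinearEquiv.apply_symm_apply]
  · intro H e
    obtain ⟨e', rfl⟩ := h.ex3 e (XT.proj_zero B _)
    obtain ⟨s, hs, l, hl⟩ := H (XT.zeroEquiv A N e')
    refine ⟨s, hs, ?_⟩
    have : s • e' = XT.pre f N 0 ((XT.zeroEquiv B N).symm l) := by
      apply (XT.zeroEquiv A N).injective
      rw [XT.zeroEquiv_pre, LinearEquiv.apply_symm_apply, hl, map_smul]
    rw [← map_smul, this, h.del_pre]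

theorem IsSES.ev_one (h : IsSES f g) [Module.Projective S B] :
    EV S C N 1 ↔ ∀ k : A →ₗ[S] N, ∃ l : B →ₗ[S] N, l ∘ₗ f = k := by
  rw [← TV_bot, h.tv_one]
  simp [Submonoid.mem_bot]

/-- Extension property with arbitrary middle term. -/
theorem IsSES.ev_ext (h : IsSES f g) (hC : EV S C N 1) (k : A →ₗ[S] N) :
    ∃ l : B →ₗ[S] N, l ∘ₗ f = k := by
  obtain ⟨e', he'⟩ := h.ex1 ((XT.zeroEquiv A N).symm k) (hC _)
  exact ⟨XT.zeroEquiv B N e', by rw [← XT.zeroEquiv_pre, he', LinearEquiv.apply_symm_apply]⟩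

theorem TV.retract {M' : Type u} [AddCommGroup M'] [Module S M'] (i : M →ₗ[S] M')
    (p : M' →ₗ[S] M) (hpi : p ∘ₗ i = LinearMap.id) (h : TV W M' N n) : TV W M N n := by
  intro e
  obtain ⟨s, hs, h1⟩ := h (XT.pre p N n e)
  refine ⟨s, hs, ?_⟩
  rw [← XT.pre_id n e, ← hpi, XT.pre_comp, ← map_smul, h1, map_zero]

theorem EV.retract {M' : Type u} [AddCommGroup M'] [Module S M'] (i : M →ₗ[S] M')
    (p : M' →ₗ[S] M) (hpi : p ∘ₗ i = LinearMap.id) (h : EV S M' N n) : EV S M N n :=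
  TV_bot.1 (TV.retract i p hpi (TV_bot.2 h))

theorem TV.iso {M' : Type u} [AddCommGroup M'] [Module S M'] (i : M ≃ₗ[S] M')
    (h : TV W M' N n) : TV W M N n :=
  TV.retract i.toLinearMap i.symm.toLinearMap (by ext; simp) h

theorem EV.iso {M' : Type u} [AddCommGroup M'] [Module S M'] (i : M ≃ₗ[S] M')
    (h : EV S M' N n) : EV S M N n :=
  EV.retract i.toLinearMap i.symm.toLinearMap (by ext; simp) h

theorem EV.coretract {N' : Type u} [AddCommGroup N'] [Module S N'] (i : N →ₗ[S] N')
    (p : N' →ₗ[S] N) (hpi : p ∘ₗ i = LinearMap.id) (h : EV S M N' n) : EV S M N n := by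
  intro e
  rw [← XT.post_id n e, ← hpi, XT.post_comp, h (XT.post M i n e), map_zero]

theorem EV.subsingleton [Subsingleton M] : EV S M N n := by
  intro e
  rw [← XT.pre_id n e, show (LinearMap.id : M →ₗ[S] M) = 0 from Subsingleton.elim _ _, XT.pre_zero]

theorem EV.prod (hA : EV S A N n) (hB : EV S B N n) : EV S (A × B) N n :=
  (show IsSES (LinearMap.inl S A B) (LinearMap.snd S A B) from
    ⟨LinearMap.inl_injective, LinearMap.snd_surjective, LinearMap.range_inl S A B⟩).ev_mid hA hB

theorem EV.coprod (hA : EV S M A n) (hB : EV S M B n) : EV S M (A × B) n :=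
  (show IsSES (LinearMap.inl S A B) (LinearMap.snd S A B) from
    ⟨LinearMap.inl_injective, LinearMap.snd_surjective, LinearMap.range_inl S A B⟩).coex2 hA hB

/-- `y` acts by `pre (y • id)` -/
theorem XT.smul_eq_pre (r : S) (e : XT S A N n) :
    r • e = XT.pre (r • LinearMap.id) N n e := by
  rw [XT.pre_smul, XT.pre_id]

/-- if `r • id` factors through `P` with Ext vanishing -/
theorem XT.smul_zero_of_factor (r : S) (a : A →ₗ[S] B) (b : B →ₗ[S] A)
    (hab : b ∘ₗ a = r • LinearMap.id) (hB : EV S B N n) (e : XT S A N n) : r • e = 0 := by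
  rw [XT.smul_eq_pre, ← hab, XT.pre_comp, hB (XT.pre b N n e), map_zero]

theorem finite_XT [IsNoetherianRing S] [Module.Finite S M] [Module.Finite S N] :
    Module.Finite S (XT S M N n) :=
  ModuleCat.finite_ext S (ModuleCat.of S M) (ModuleCat.of S N) n

theorem EV.cofree (h : EV S M S n) (k : ℕ) : EV S M (Fin k → S) n := by
  induction k with
  | zero =>
    intro e
    rw [← XT.post_id n e, show (LinearMap.id : (Fin 0 → S) →ₗ[S] _) = 0 from Subsingleton.elim _ _]
    have : XT.post M (0 : (Fin 0 → S) →ₗ[S] (Fin 0 → S)) n e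
      = (0 : S) • XT.post M (0 : (Fin 0 → S) →ₗ[S] (Fin 0 → S)) n e := by
      rw [zero_smul]
      change Abelian.Ext.comp _ (Abelian.Ext.mk₀ (ModuleCat.ofHom 0)) (add_zero n) = _
      rw [show ModuleCat.ofHom (0 : (Fin 0 → S) →ₗ[S] (Fin 0 → S)) = 0 from rfl,
        Abelian.Ext.mk₀_zero, Abelian.Ext.comp_zero]
    rw [this, zero_smul]
  | succ k ih =>
    have := EV.coprod h ih
    exact EV.coretract (Fin.consLinearEquiv S (fun _ => S)).symm.toLinearMap
      (Fin.consLinearEquiv S (fun _ => S)).toLinearMap (by ext; simp) this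

theorem EV.coproj (h : EV S M S n) (P : Type u) [AddCommGroup P] [Module S P]
    [Module.Finite S P] [Module.Projective S P] : EV S M P n := by
  obtain ⟨k, f, hf⟩ := Module.Finite.exists_fin' S P
  obtain ⟨g, hg⟩ := Module.projective_lifting_property f LinearMap.id hf
  exact EV.coretract g f hg (h.cofree k)

end ext
end ResolvPaper
namespace ResolvPaper

/-! ## Constructions with short exact sequences -/
section constr
variable {S : Type u} [CommRing S]
variable {A B C D K P M N : Type u} [AddCommGroup A] [Module S A] [AddCommGroup B] [Module S B]
  [AddCommGroup C] [Module S C] [AddCommGroup M] [Module S M] [AddCommGroup N] [Module S N]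
  [AddCommGroup D] [Module S D] [AddCommGroup K] [Module S K] [AddCommGroup P] [Module S P]
  {A' B' C' : Type u} [AddCommGroup A'] [Module S A'] [AddCommGroup B'] [Module S B']
  [AddCommGroup C'] [Module S C']

theorem IsSES.prod_inl_snd : IsSES (LinearMap.inl S A B) (LinearMap.snd S A B) :=
  ⟨LinearMap.inl_injective, LinearMap.snd_surjective, LinearMap.range_inl S A B⟩

theorem IsSES.prodMap {f : A →ₗ[S] B} {g : B →ₗ[S] C} (h : IsSES f g)
    {f' : A' →ₗ[S] B'} {g' : B' →ₗ[S] C'} (h' : IsSES f' g') :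
    IsSES (f.prodMap f') (g.prodMap g') := by
  refine IsSES.mk' ?_ ?_ ?_ ?_
  · exact h.1.prodMap h'.1
  · exact h.2.1.prodMap h'.2.1
  · rintro ⟨a, b⟩; simp [h.apply_zero, h'.apply_zero]
  · rintro ⟨a, b⟩ hab
    simp only [LinearMap.prodMap_apply, Prod.mk_eq_zero] at hab
    obtain ⟨x, hx⟩ := h.exists_of a hab.1
    obtain ⟨y, hy⟩ := h'.exists_of b hab.2
    exact ⟨(x, y), by simp [hx, hy]⟩

theorem IsSES.finite_mid {f : A →ₗ[S] B} {g : B →ₗ[S] C} (h : IsSES f g) [Module.Finite S A]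
    [Module.Finite S C] : Module.Finite S B :=
  Module.Finite.of_exact (LinearMap.exact_iff.2 h.2.2.symm) h.2.1

theorem IsSES.finite_right {f : A →ₗ[S] B} {g : B →ₗ[S] C} (h : IsSES f g) [Module.Finite S B] :
    Module.Finite S C := Module.Finite.of_surjective g h.2.1

theorem IsSES.finite_left [IsNoetherianRing S] {f : A →ₗ[S] B} {g : B →ₗ[S] C} (h : IsSES f g)
    [Module.Finite S B] : Module.Finite S A := Module.Finite.of_injective f h.1

theorem IsSES.comp_equiv_left {f : A →ₗ[S] B} {g : B →ₗ[S] C} (h : IsSES f g) (e : A' ≃ₗ[S] A) :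
    IsSES (f ∘ₗ e.toLinearMap) g := by
  refine IsSES.mk' (h.1.comp e.injective) h.2.1 (fun a => h.apply_zero _) fun b hb => ?_
  obtain ⟨a, ha⟩ := h.exists_of b hb
  exact ⟨e.symm a, by simp [ha]⟩

theorem IsSES.comp_equiv_right {f : A →ₗ[S] B} {g : B →ₗ[S] C} (h : IsSES f g) (e : C ≃ₗ[S] C') :
    IsSES f (e.toLinearMap ∘ₗ g) := by
  refine IsSES.mk' h.1 (e.surjective.comp h.2.1) (fun a => by simp [h.apply_zero]) fun b hb => ?_
  exact h.exists_of b (by simpa using hb)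

theorem IsSES.equiv_mid {f : A →ₗ[S] B} {g : B →ₗ[S] C} (h : IsSES f g) (e : B ≃ₗ[S] B') :
    IsSES (e.toLinearMap ∘ₗ f) (g ∘ₗ e.symm.toLinearMap) := by
  refine IsSES.mk' (e.injective.comp h.1) (h.2.1.comp e.symm.surjective)
    (fun a => by simp [h.apply_zero]) fun b hb => ?_
  obtain ⟨a, ha⟩ := h.exists_of _ hb
  exact ⟨a, by simp [ha]⟩

/-- lift through the kernel -/
theorem IsSES.lift {f : A →ₗ[S] B} {g : B →ₗ[S] C} (h : IsSES f g) (k : M →ₗ[S] B)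
    (hk : ∀ m, g (k m) = 0) : ∃ l : M →ₗ[S] A, f ∘ₗ l = k := by
  have e := LinearEquiv.ofInjective f h.1
  have hk' : ∀ m, k m ∈ LinearMap.range f := fun m => by rw [h.2.2]; exact hk m
  refine ⟨(LinearEquiv.ofInjective f h.1).symm.toLinearMap ∘ₗ k.codRestrict _ hk', ?_⟩
  ext m
  have := LinearEquiv.apply_symm_apply (LinearEquiv.ofInjective f h.1) ⟨k m, hk' m⟩
  exact congrArg Subtype.val this

/-- descend through the cokernel -/
theorem IsSES.desc {f : A →ₗ[S] B} {g : B →ₗ[S] C} (h : IsSES f g) (k : B →ₗ[S] M)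
    (hk : ∀ a, k (f a) = 0) : ∃ l : C →ₗ[S] M, l ∘ₗ g = k := by
  have hle : LinearMap.ker g ≤ LinearMap.ker k := by
    rw [← h.2.2]; rintro _ ⟨a, rfl⟩; exact hk a
  refine ⟨(LinearMap.ker g).liftQ k hle ∘ₗ (g.quotKerEquivOfSurjective h.2.1).symm.toLinearMap, ?_⟩
  ext b
  have : (g.quotKerEquivOfSurjective h.2.1).symm (g b) = (LinearMap.ker g).mkQ b := by
    rw [LinearEquiv.symm_apply_eq]; rfl
  simp [this]

/-- A split SES (from a retraction). -/
theorem IsSES.equiv_of_retraction {f : A →ₗ[S] B} {g : B →ₗ[S] C} (h : IsSES f g)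
    (r : B →ₗ[S] A) (hr : r ∘ₗ f = LinearMap.id) :
    ∃ e : B ≃ₗ[S] A × C, (∀ a, e (f a) = (a, 0)) ∧ (∀ b, (e b).2 = g b) := by
  have hr' : ∀ a, r (f a) = a := LinearMap.congr_fun hr
  refine ⟨LinearEquiv.ofBijective (r.prod g) ⟨?_, ?_⟩, ?_, ?_⟩
  · rw [injective_iff_map_eq_zero]
    intro b hb
    replace hb : r b = 0 ∧ g b = 0 := ⟨congrArg Prod.fst hb, congrArg Prod.snd hb⟩
    obtain ⟨a, rfl⟩ := h.exists_of b hb.2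
    rw [hr'] at hb; rw [hb.1, map_zero]
  · rintro ⟨a, c⟩
    obtain ⟨b, rfl⟩ := h.2.1 c
    refine ⟨b + f (a - r b), ?_⟩
    simp [hr', h.apply_zero]
  · intro a; exact Prod.ext (hr' a) (h.apply_zero a)
  · intro b; rfl

theorem IsSES.retraction_of_section {f : A →ₗ[S] B} {g : B →ₗ[S] C} (h : IsSES f g)
    (s : C →ₗ[S] B) (hs : g ∘ₗ s = LinearMap.id) : ∃ r : B →ₗ[S] A, r ∘ₗ f = LinearMap.id := by
  have hs' : ∀ c, g (s c) = c := LinearMap.congr_fun hs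
  obtain ⟨r, hr⟩ := h.lift (LinearMap.id - s ∘ₗ g) (fun b => by simp [hs'])
  refine ⟨r, ?_⟩
  ext a
  apply h.1
  have := LinearMap.congr_fun hr (f a)
  simpa [h.apply_zero] using this

theorem IsSES.section_of_proj {f : A →ₗ[S] B} {g : B →ₗ[S] C} (h : IsSES f g)
    [Module.Projective S C] : ∃ s : C →ₗ[S] B, g ∘ₗ s = LinearMap.id :=
  Module.projective_lifting_property g LinearMap.id h.2.1

theorem IsSES.section_of_retraction {f : A →ₗ[S] B} {g : B →ₗ[S] C} (h : IsSES f g)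
    (r : B →ₗ[S] A) (hr : r ∘ₗ f = LinearMap.id) : ∃ s : C →ₗ[S] B, g ∘ₗ s = LinearMap.id := by
  have hr' : ∀ a, r (f a) = a := LinearMap.congr_fun hr
  obtain ⟨s, hs⟩ := h.desc (LinearMap.id - f ∘ₗ r) (fun b => by simp [hr'])
  refine ⟨s, ?_⟩
  ext c
  obtain ⟨b, rfl⟩ := h.2.1 c
  have := LinearMap.congr_fun hs b
  simp only [LinearMap.comp_apply] at this
  simp [this, h.apply_zero]

theorem IsSES.equiv_of_proj {f : A →ₗ[S] B} {g : B →ₗ[S] C} (h : IsSES f g)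
    [Module.Projective S C] : ∃ e : B ≃ₗ[S] A × C, (∀ a, e (f a) = (a, 0)) ∧
      (∀ b, (e b).2 = g b) := by
  obtain ⟨s, hs⟩ := h.section_of_proj
  obtain ⟨r, hr⟩ := h.retraction_of_section s hs
  exact h.equiv_of_retraction r hr

theorem IsSES.retraction_of_ev {f : A →ₗ[S] B} {g : B →ₗ[S] C} (h : IsSES f g)
    (hC : EV S C A 1) : ∃ r : B →ₗ[S] A, r ∘ₗ f = LinearMap.id :=
  h.ev_ext hC LinearMap.id

/-- projectivity of the kernel -/
theorem IsSES.proj_left {f : A →ₗ[S] B} {g : B →ₗ[S] C} (h : IsSES f g)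
    [Module.Projective S B] [Module.Projective S C] : Module.Projective S A := by
  obtain ⟨s, hs⟩ := h.section_of_proj
  obtain ⟨r, hr⟩ := h.retraction_of_section s hs
  exact Module.Projective.of_split f r hr

theorem IsSES.proj_mid {f : A →ₗ[S] B} {g : B →ₗ[S] C} (h : IsSES f g)
    [Module.Projective S A] [Module.Projective S C] : Module.Projective S B := by
  obtain ⟨e, -⟩ := h.equiv_of_proj
  exact Module.Projective.of_equiv e.symm

/-- Double pullback. -/
theorem IsSES.pullback {f : A →ₗ[S] B} {g : B →ₗ[S] C} (h : IsSES f g)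
    {f' : A' →ₗ[S] B'} {g' : B' →ₗ[S] C} (h' : IsSES f' g') :
    ∃ (E : ModuleCat.{u} S) (i : A →ₗ[S] E) (p : E →ₗ[S] B') (i' : A' →ₗ[S] E) (p' : E →ₗ[S] B),
      IsSES i p ∧ IsSES i' p' ∧ p' ∘ₗ i = f ∧ p ∘ₗ i' = f' ∧ g ∘ₗ p' = g' ∘ₗ p := by
  let U : Submodule S (B × B') :=
    LinearMap.ker (g ∘ₗ LinearMap.fst S B B' - g' ∘ₗ LinearMap.snd S B B')
  have hU : ∀ x : B × B', x ∈ U ↔ g x.1 = g' x.2 := by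
    intro x; simp [U, sub_eq_zero]
  let i : A →ₗ[S] U := (LinearMap.inl S B B' ∘ₗ f).codRestrict U
    (fun a => by rw [hU]; simp [h.apply_zero])
  let i' : A' →ₗ[S] U := (LinearMap.inr S B B' ∘ₗ f').codRestrict U
    (fun a => by rw [hU]; simp [h'.apply_zero])
  refine ⟨ModuleCat.of S U, i, LinearMap.snd S B B' ∘ₗ U.subtype, i',
    LinearMap.fst S B B' ∘ₗ U.subtype, ?_, ?_, rfl, rfl, ?_⟩
  · refine IsSES.mk' ?_ ?_ ?_ ?_
    · intro a b hab
      exact h.1 (congrArg (fun x : U => x.1.1) hab)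
    · intro b
      obtain ⟨c, hc⟩ := h.2.1 (g' b)
      exact ⟨⟨(c, b), (hU _).2 hc⟩, rfl⟩
    · intro a; rfl
    · rintro ⟨⟨b, b'⟩, hb⟩ (h0 : b' = 0)
      subst h0
      rw [hU] at hb
      obtain ⟨a, ha⟩ := h.exists_of b (by simpa using hb)
      exact ⟨a, Subtype.ext (Prod.ext ha rfl)⟩
  · refine IsSES.mk' ?_ ?_ ?_ ?_
    · intro a b hab
      exact h'.1 (congrArg (fun x : U => x.1.2) hab)
    · intro b
      obtain ⟨c, hc⟩ := h'.2.1 (g b)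
      exact ⟨⟨(b, c), (hU _).2 hc.symm⟩, rfl⟩
    · intro a; rfl
    · rintro ⟨⟨b, b'⟩, hb⟩ (h0 : b = 0)
      subst h0
      rw [hU] at hb
      obtain ⟨a, ha⟩ := h'.exists_of b' (by simpa using hb.symm)
      exact ⟨a, Subtype.ext (Prod.ext rfl ha)⟩
  · ext ⟨x, hx⟩; exact (hU x).1 hx

/-- Double pushout. -/
theorem IsSES.pushout {f : A →ₗ[S] B} {g : B →ₗ[S] C} (h : IsSES f g)
    {f' : A →ₗ[S] B'} {g' : B' →ₗ[S] C'} (h' : IsSES f' g') :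
    ∃ (E : ModuleCat.{u} S) (i : B →ₗ[S] E) (p : E →ₗ[S] C') (i' : B' →ₗ[S] E) (p' : E →ₗ[S] C),
      IsSES i p ∧ IsSES i' p' ∧ p' ∘ₗ i = g ∧ p ∘ₗ i' = g' ∧ i ∘ₗ f = i' ∘ₗ f' := by
  let U : Submodule S (B × B') := LinearMap.range (f.prod (-f'))
  let p : (B × B') ⧸ U →ₗ[S] C' := U.liftQ (g' ∘ₗ LinearMap.snd S B B')
    (by rintro _ ⟨a, rfl⟩; simp [h'.apply_zero])
  let p' : (B × B') ⧸ U →ₗ[S] C := U.liftQ (g ∘ₗ LinearMap.fst S B B')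
    (by rintro _ ⟨a, rfl⟩; simp [h.apply_zero])
  have e0 : ∀ x : B × B', U.mkQ x = 0 ↔ ∃ a, (f a, -f' a) = x := by
    intro x
    rw [Submodule.mkQ_apply, Submodule.Quotient.mk_eq_zero]
    rfl
  refine ⟨ModuleCat.of S ((B × B') ⧸ U), U.mkQ ∘ₗ LinearMap.inl S B B', p,
    U.mkQ ∘ₗ LinearMap.inr S B B', p', ?_, ?_, ?_, ?_, ?_⟩
  · refine IsSES.mk' ?_ ?_ ?_ ?_
    · rw [injective_iff_map_eq_zero]
      intro b hb
      obtain ⟨a, ha⟩ := (e0 _).1 hb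
      have h1 := congrArg Prod.fst ha
      have h2 := congrArg Prod.snd ha
      simp only [LinearMap.inl_apply, neg_eq_zero] at h1 h2
      rw [← map_zero f'] at h2
      rw [← h1, h'.1 h2, map_zero]
    · intro c
      obtain ⟨b, rfl⟩ := h'.2.1 c
      exact ⟨U.mkQ (0, b), by simp [p]⟩
    · intro b; simp [p]
    · intro x hx
      obtain ⟨⟨b, b'⟩, rfl⟩ := U.mkQ_surjective x
      have hx' : g' b' = 0 := by simpa [p] using hx
      obtain ⟨a, rfl⟩ := h'.exists_of b' hx'
      refine ⟨b + f a, ?_⟩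
      rw [← sub_eq_zero, LinearMap.comp_apply]
      erw [← map_sub]
      exact (e0 _).2 ⟨a, by simp⟩
  · refine IsSES.mk' ?_ ?_ ?_ ?_
    · rw [injective_iff_map_eq_zero]
      intro b hb
      obtain ⟨a, ha⟩ := (e0 _).1 hb
      have h1 := congrArg Prod.fst ha
      have h2 := congrArg Prod.snd ha
      simp only [LinearMap.inr_apply] at h1 h2
      rw [← map_zero f] at h1
      rw [← h2, h.1 h1, map_zero, neg_zero]
    · intro c
      obtain ⟨b, rfl⟩ := h.2.1 c
      exact ⟨U.mkQ (b, 0), by simp [p']⟩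
    · intro b; simp [p']
    · intro x hx
      obtain ⟨⟨b, b'⟩, rfl⟩ := U.mkQ_surjective x
      have hx' : g b = 0 := by simpa [p'] using hx
      obtain ⟨a, rfl⟩ := h.exists_of b hx'
      refine ⟨b' + f' a, ?_⟩
      rw [← sub_eq_zero, LinearMap.comp_apply]
      erw [← map_sub]
      exact (e0 _).2 ⟨-a, by simp⟩
  · ext b; simp [p']
  · ext b; simp [p]
  · ext a
    rw [← sub_eq_zero]
    simp only [LinearMap.comp_apply]
    erw [← map_sub]
    exact (e0 _).2 ⟨a, by simp⟩

/-- composing surjections -/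
theorem IsSES.lemZ {f : A →ₗ[S] B} {g : B →ₗ[S] C} (h : IsSES f g)
    {i : K →ₗ[S] P} {p : P →ₗ[S] B} (h' : IsSES i p) :
    ∃ (K2 : ModuleCat.{u} S) (i2 : K2 →ₗ[S] P) (j : K →ₗ[S] K2) (q : K2 →ₗ[S] A),
      IsSES i2 (g ∘ₗ p) ∧ IsSES j q := by
  have hs : IsSES (LinearMap.ker (g ∘ₗ p)).subtype (g ∘ₗ p) :=
    IsSES.ker _ (h.2.1.comp h'.2.1)
  obtain ⟨q, hq⟩ := h.lift (p ∘ₗ (LinearMap.ker (g ∘ₗ p)).subtype) (fun m => m.2)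
  obtain ⟨j, hj⟩ := hs.lift i (fun k => by simp [h'.apply_zero])
  have hq' : ∀ x : LinearMap.ker (g ∘ₗ p), f (q x) = p x.1 := LinearMap.congr_fun hq
  have hj' : ∀ k, (j k).1 = i k := LinearMap.congr_fun hj
  refine ⟨ModuleCat.of S (LinearMap.ker (g ∘ₗ p)), (LinearMap.ker (g ∘ₗ p)).subtype, j, q, hs, ?_⟩
  refine IsSES.mk' ?_ ?_ ?_ ?_
  · intro a b hab
    apply h'.1
    rw [← hj', ← hj', hab]
  · intro a
    obtain ⟨x, hx⟩ := h'.2.1 (f a)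
    refine ⟨⟨x, ?_⟩, h.1 ?_⟩
    · simp [hx, h.apply_zero]
    · rw [hq', hx]
  · intro k
    apply h.1
    rw [hq', hj', h'.apply_zero, map_zero]
  · intro x hx
    obtain ⟨k, hk⟩ := h'.exists_of x.1 (by rw [← hq', hx, map_zero])
    exact ⟨k, Subtype.ext (by rw [hj', hk])⟩

/-- composing injections -/
theorem IsSES.lemZ' {f : A →ₗ[S] B} {g : B →ₗ[S] C} (h : IsSES f g)
    {i : B →ₗ[S] P} {p : P →ₗ[S] K} (h' : IsSES i p) :
    ∃ (K2 : ModuleCat.{u} S) (p2 : P →ₗ[S] K2) (j : C →ₗ[S] K2) (q : K2 →ₗ[S] K),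
      IsSES (i ∘ₗ f) p2 ∧ IsSES j q ∧ j ∘ₗ g = p2 ∘ₗ i := by
  have hs : IsSES (i ∘ₗ f) (LinearMap.range (i ∘ₗ f)).mkQ :=
    ⟨h'.1.comp h.1, Submodule.mkQ_surjective _, by simp⟩
  obtain ⟨q, hq⟩ := hs.desc p (fun a => h'.apply_zero _)
  obtain ⟨j, hj⟩ := h.desc ((LinearMap.range (i ∘ₗ f)).mkQ ∘ₗ i) (fun k => hs.apply_zero k)
  have hq' : ∀ x, q ((LinearMap.range (i ∘ₗ f)).mkQ x) = p x := LinearMap.congr_fun hq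
  have hj' : ∀ b, j (g b) = (LinearMap.range (i ∘ₗ f)).mkQ (i b) := LinearMap.congr_fun hj
  refine ⟨ModuleCat.of S (P ⧸ LinearMap.range (i ∘ₗ f)), (LinearMap.range (i ∘ₗ f)).mkQ, j, q, hs,
    ?_, hj⟩
  refine IsSES.mk' ?_ ?_ ?_ ?_
  · rw [injective_iff_map_eq_zero]
    intro c hc
    obtain ⟨b, rfl⟩ := h.2.1 c
    rw [hj'] at hc
    obtain ⟨a, ha⟩ := hs.exists_of _ hc
    rw [← h'.1 ha, h.apply_zero]
  · intro k
    obtain ⟨x, rfl⟩ := h'.2.1 k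
    exact ⟨_, hq' x⟩
  · intro c
    obtain ⟨b, rfl⟩ := h.2.1 c
    rw [hj', hq', h'.apply_zero]
  · intro x hx
    obtain ⟨y, rfl⟩ := hs.2.1 x
    rw [hq'] at hx
    obtain ⟨b, rfl⟩ := h'.exists_of y hx
    exact ⟨g b, hj' b⟩

theorem exists_fp (S : Type u) [CommRing S] (M : Type u) [AddCommGroup M] [Module S M]
    [Module.Finite S M] :
    ∃ (P : ModuleCat.{u} S) (g : P →ₗ[S] M), Function.Surjective g ∧ Module.Finite S P ∧
      Module.Projective S P := by
  obtain ⟨k, f, hf⟩ := Module.Finite.exists_fin' S M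
  exact ⟨ModuleCat.of S (Fin k → S), f, hf,
    (inferInstance : Module.Finite S (Fin k → S)), (inferInstance : Module.Projective S (Fin k → S))⟩

/-- Existence of a f.g. projective presentation. -/
theorem exists_syz (S : Type u) [CommRing S] [IsNoetherianRing S] (M : Type u) [AddCommGroup M]
    [Module S M] [Module.Finite S M] :
    ∃ (K P : ModuleCat.{u} S) (f : K →ₗ[S] P) (g : P →ₗ[S] M), IsSES f g ∧ Module.Finite S P ∧
      Module.Projective S P ∧ Module.Finite S K := by
  obtain ⟨P, g, hg, h1, h2⟩ := exists_fp S M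
  exact ⟨ModuleCat.of S (LinearMap.ker g), P, _, g, IsSES.ker g hg, h1, h2,
    (IsSES.ker g hg).finite_left⟩

/-- horseshoe -/
theorem IsSES.horseshoe {f : A →ₗ[S] B} {g : B →ₗ[S] C} (h : IsSES f g)
    {Q L : Type u} [AddCommGroup Q] [Module S Q] [AddCommGroup L] [Module S L]
    [Module.Projective S Q]
    {i : K →ₗ[S] P} {p : P →ₗ[S] A} (h1 : IsSES i p)
    {j : L →ₗ[S] Q} {q : Q →ₗ[S] C} (h2 : IsSES j q) :
    ∃ (E : ModuleCat.{u} S) (k : E →ₗ[S] P × Q) (r : P × Q →ₗ[S] B) (a : K →ₗ[S] E)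
      (b : E →ₗ[S] L), IsSES k r ∧ IsSES a b := by
  obtain ⟨q', hq'⟩ := Module.projective_lifting_property g q h.2.1
  have hq : ∀ x, g (q' x) = q x := LinearMap.congr_fun hq'
  let r : P × Q →ₗ[S] B := (f ∘ₗ p).coprod q'
  have hr : ∀ x, g (r x) = q x.2 := by
    intro x; simp [r, h.apply_zero, hq]
  have hrs : Function.Surjective r := by
    intro b
    obtain ⟨y, hy⟩ := h2.2.1 (g b)
    obtain ⟨a, ha⟩ := h.exists_of (b - q' y) (by simp [hq, hy])
    obtain ⟨x, rfl⟩ := h1.2.1 a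
    exact ⟨(x, y), by simp [r, ha]⟩
  have hk := IsSES.ker r hrs
  obtain ⟨a, ha'⟩ := hk.lift (LinearMap.inl S P Q ∘ₗ i) (fun x => by simp [r, h1.apply_zero])
  obtain ⟨b, hb'⟩ := h2.lift (LinearMap.snd S P Q ∘ₗ (LinearMap.ker r).subtype) (fun x => by
    have := hr x.1
    rw [show r x.1 = 0 from x.2, map_zero] at this
    exact this.symm)
  have ha : ∀ x, (a x).1 = (i x, 0) := LinearMap.congr_fun ha'
  have hb : ∀ x, j (b x) = x.1.2 := LinearMap.congr_fun hb'
  refine ⟨ModuleCat.of S (LinearMap.ker r), _, r, a, b, hk, ?_⟩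
  refine IsSES.mk' ?_ ?_ ?_ ?_
  · intro x y hxy
    apply h1.1
    have := congrArg (fun z : LinearMap.ker r => z.1.1) hxy
    simpa [ha] using this
  · intro l
    obtain ⟨a, haa⟩ := h.exists_of (q' (j l)) (by rw [hq, h2.apply_zero])
    obtain ⟨x, rfl⟩ := h1.2.1 a
    refine ⟨⟨(-x, j l), by simp [r, haa]⟩, h2.1 ?_⟩
    rw [hb]
  · intro x
    apply h2.1
    rw [hb, ha, map_zero]
  · rintro ⟨⟨x, y⟩, hx⟩ h0
    have hy : y = 0 := by have := hb ⟨(x, y), hx⟩; rw [h0, map_zero] at this; exact this.symm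
    subst hy
    have : f (p x) = 0 := by simpa [r] using hx
    have : p x = 0 := h.1 (by rw [this, map_zero])
    obtain ⟨z, rfl⟩ := h1.exists_of x this
    exact ⟨z, Subtype.ext (ha z)⟩

end constr

/-! ## Resolving subcategories: unbundled API -/
namespace IsResolving
variable {S : Type u} [CommRing S] {𝒳 : Set (ModuleCat.{u} S)} (hX : IsResolving S 𝒳)
variable {A B C K P M N : Type u} [AddCommGroup A] [Module S A] [AddCommGroup B] [Module S B]
  [AddCommGroup C] [Module S C] [AddCommGroup M] [Module S M] [AddCommGroup N] [Module S N]
  [AddCommGroup K] [Module S K] [AddCommGroup P] [Module S P]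
include hX

theorem fin (h : ModuleCat.of S M ∈ 𝒳) : Module.Finite S M := hX.fg _ h
theorem iso (e : M ≃ₗ[S] N) (h : ModuleCat.of S M ∈ 𝒳) : ModuleCat.of S N ∈ 𝒳 :=
  hX.iso_closed _ _ ⟨e⟩ h
theorem proj [Module.Finite S P] [Module.Projective S P] : ModuleCat.of S P ∈ 𝒳 :=
  hX.proj_mem (ModuleCat.of S P) ‹_› ‹_›
theorem ext {f : A →ₗ[S] B} {g : B →ₗ[S] C} (h : IsSES f g) (hA : ModuleCat.of S A ∈ 𝒳)
    (hC : ModuleCat.of S C ∈ 𝒳) : ModuleCat.of S B ∈ 𝒳 :=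
  hX.ext_closed (ModuleCat.of S A) (ModuleCat.of S B) (ModuleCat.of S C) f g h hA hC
theorem prod (hA : ModuleCat.of S A ∈ 𝒳) (hB : ModuleCat.of S B ∈ 𝒳) :
    ModuleCat.of S (A × B) ∈ 𝒳 := hX.ext IsSES.prod_inl_snd hA hB
theorem fst (h : ModuleCat.of S (A × B) ∈ 𝒳) : ModuleCat.of S A ∈ 𝒳 :=
  hX.summand_closed (ModuleCat.of S A) (ModuleCat.of S B) h
theorem snd (h : ModuleCat.of S (A × B) ∈ 𝒳) : ModuleCat.of S B ∈ 𝒳 :=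
  hX.fst (hX.iso (LinearEquiv.prodComm S A B) h)
theorem retract (i : A →ₗ[S] B) (p : B →ₗ[S] A) (h : p ∘ₗ i = LinearMap.id)
    (hB : ModuleCat.of S B ∈ 𝒳) : ModuleCat.of S A ∈ 𝒳 := by
  have hs : Function.Surjective p := fun a => ⟨i a, LinearMap.congr_fun h a⟩
  obtain ⟨r, hr⟩ := (IsSES.ker p hs).retraction_of_section i h
  obtain ⟨e, -⟩ := (IsSES.ker p hs).equiv_of_retraction r hr
  exact hX.snd (hX.iso e hB)
theorem syz [IsNoetherianRing S] {f : K →ₗ[S] P} {g : P →ₗ[S] M} (h : IsSES f g)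
    [Module.Finite S P] [Module.Projective S P] (hM : ModuleCat.of S M ∈ 𝒳) :
    ModuleCat.of S K ∈ 𝒳 :=
  hX.syzygy_closed (ModuleCat.of S K) (ModuleCat.of S P) (ModuleCat.of S M) f g h
    h.finite_left ‹_› ‹_› hM

/-- kernels of epimorphisms -/
theorem ker [IsNoetherianRing S] {f : A →ₗ[S] B} {g : B →ₗ[S] C} (h : IsSES f g)
    (hB : ModuleCat.of S B ∈ 𝒳)
    (hC : ModuleCat.of S C ∈ 𝒳) : ModuleCat.of S A ∈ 𝒳 := by
  have := hX.fin hC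
  obtain ⟨K, P, i, p, hs, _, _, _⟩ := exists_syz S C
  obtain ⟨E, a, b, c, d, h1, h2, -⟩ := h.pullback hs
  have hE : E ∈ 𝒳 := hX.ext h2 (hX.syz hs hC) hB
  obtain ⟨e, -⟩ := h1.equiv_of_proj
  exact hX.fst (hX.iso e hE)

/-- Schanuel -/
theorem syz_indep {f : K →ₗ[S] P} {g : P →ₗ[S] M} (h : IsSES f g)
    [Module.Finite S P] [Module.Projective S P] {K' P' : Type u} [AddCommGroup K'] [Module S K']
    [AddCommGroup P'] [Module S P'] {f' : K' →ₗ[S] P'} {g' : P' →ₗ[S] M} (h' : IsSES f' g')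
    [Module.Finite S P'] [Module.Projective S P'] (hK : ModuleCat.of S K ∈ 𝒳) :
    ModuleCat.of S K' ∈ 𝒳 := by
  obtain ⟨E, a, b, c, d, h1, h2, -⟩ := h.pullback h'
  have hE : E ∈ 𝒳 := hX.ext h1 hK hX.proj
  obtain ⟨e, -⟩ := h2.equiv_of_proj
  exact hX.fst (hX.iso e hE)

end IsResolving
end ResolvPaper
namespace ResolvPaper

/-! ## Totally Gorenstein modules: `Ext^{>0}(M,S)=0`, and finite projective dimension -/
section GG
variable {S : Type u} [CommRing S]
variable {A B C K P M N : Type u} [AddCommGroup A] [Module S A] [AddCommGroup B] [Module S B]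
  [AddCommGroup C] [Module S C] [AddCommGroup M] [Module S M] [AddCommGroup N] [Module S N]
  [AddCommGroup K] [Module S K] [AddCommGroup P] [Module S P]

/-- finitely generated modules with `Ext^i(M,S)=0` for `i ≥ 1`. -/
def GG (S : Type u) [CommRing S] (M : Type u) [AddCommGroup M] [Module S M] : Prop :=
  Module.Finite S M ∧ ∀ i, 1 ≤ i → EV S M S i

/-- the corresponding set of bundled modules -/
def GGcat (S : Type u) [CommRing S] : Set (ModuleCat.{u} S) := {M | GG S M}

theorem GG.proj (P : Type u) [AddCommGroup P] [Module S P] [Module.Finite S P]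
    [Module.Projective S P] : GG S P :=
  ⟨inferInstance, fun _ hi => EV.proj P hi⟩

theorem GG.mid {f : A →ₗ[S] B} {g : B →ₗ[S] C} (h : IsSES f g) (hA : GG S A) (hC : GG S C) :
    GG S B := by
  have := hA.1
  have := hC.1
  exact ⟨h.finite_mid, fun i hi => h.ev_mid (hA.2 i hi) (hC.2 i hi)⟩

theorem GG.left [IsNoetherianRing S] {f : A →ₗ[S] B} {g : B →ₗ[S] C} (h : IsSES f g)
    (hB : GG S B) (hC : GG S C) : GG S A := by
  have := hB.1
  exact ⟨h.finite_left, fun i hi => h.ev_left (hB.2 i hi) (hC.2 (i+1) (by omega))⟩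

theorem GG.retract (i : A →ₗ[S] B) (p : B →ₗ[S] A) (h : p ∘ₗ i = LinearMap.id) (hB : GG S B) :
    GG S A := by
  have := hB.1
  exact ⟨Module.Finite.of_surjective p (fun a => ⟨i a, LinearMap.congr_fun h a⟩),
    fun j hj => EV.retract i p h (hB.2 j hj)⟩

theorem GG.iso (e : A ≃ₗ[S] B) (hA : GG S A) : GG S B :=
  GG.retract e.symm.toLinearMap e.toLinearMap (by ext; simp) hA

theorem GG.coproj (hM : GG S M) (P : Type u) [AddCommGroup P] [Module S P] [Module.Finite S P]
    [Module.Projective S P] {i : ℕ} (hi : 1 ≤ i) : EV S M P i := (hM.2 i hi).coproj P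

theorem GGcat.resolving (S : Type u) [CommRing S] [IsNoetherianRing S] : IsResolving S (GGcat S) where
  fg M hM := hM.1
  iso_closed M N := fun ⟨e⟩ hM => GG.iso e hM
  proj_mem M _ _ := GG.proj M
  summand_closed M N h := GG.retract (LinearMap.inl S M N) (LinearMap.fst S M N) (by ext; simp) h
  ext_closed A B C f g h hA hC := GG.mid h hA hC
  syzygy_closed K P M f g h _ _ _ hM := GG.left h (GG.proj P) hM

theorem pdLE_ev {n : ℕ} {M : ModuleCat.{u} S} (h : pdLE S n M) (N : Type u) [AddCommGroup N]
    [Module S N] {i : ℕ} (hi : n < i) : EV S M N i := by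
  induction n generalizing M i with
  | zero =>
    have : Module.Projective S M := h
    exact EV.proj M hi
  | succ n ih =>
    obtain ⟨K, P, f, g, _, _, hs, hK⟩ := h
    obtain ⟨j, rfl⟩ : ∃ j, i = j + 1 := ⟨i-1, by omega⟩
    exact (hs.ev_shift (by omega)).1 (ih hK (by omega))

theorem pdLE_of_ev [IsNoetherianRing S] {n : ℕ} {M : ModuleCat.{u} S} (hf : Module.Finite S M)
    (h : ∀ (N : ModuleCat.{u} S), Module.Finite S N → ∀ i, n < i → EV S M N i) : pdLE S n M := by
  induction n generalizing M with
  | zero =>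
    obtain ⟨K, P, f, g, hs, _, _, _⟩ := exists_syz S M
    obtain ⟨r, hr⟩ := hs.retraction_of_ev (h K ‹_› 1 (by omega))
    obtain ⟨s, hs'⟩ := hs.section_of_retraction r hr
    exact Module.Projective.of_split s g hs'
  | succ n ih =>
    obtain ⟨K, P, f, g, hs, h1, h2, h3⟩ := exists_syz S M
    exact ⟨K, P, f, g, h1, h2, hs, ih h3 fun N hN i hi =>
      (hs.ev_shift (by omega)).2 (h N hN _ (by omega))⟩

theorem mem_PDcat_iff [IsNoetherianRing S] (M : ModuleCat.{u} S) : M ∈ PDcat S ↔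
    Module.Finite S M ∧ ∃ n, ∀ (N : ModuleCat.{u} S), Module.Finite S N → ∀ i, n < i → EV S M N i :=
  ⟨fun ⟨h, n, hn⟩ => ⟨h, n, fun N _ _ hi => pdLE_ev hn N hi⟩,
    fun ⟨h, n, hn⟩ => ⟨h, n, pdLE_of_ev h hn⟩⟩

theorem PDcat.resolving (S : Type u) [CommRing S] [IsNoetherianRing S] : IsResolving S (PDcat S) where
  fg M hM := hM.1
  iso_closed M N := fun ⟨e⟩ hM => by
    rw [mem_PDcat_iff] at *
    obtain ⟨h, n, hn⟩ := hM
    exact ⟨Module.Finite.equiv e, n, fun L hL i hi => (hn L hL i hi).iso e.symm⟩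
  proj_mem M h1 h2 := ⟨h1, 0, h2⟩
  summand_closed M N h := by
    rw [mem_PDcat_iff] at *
    obtain ⟨h, n, hn⟩ := h
    have : Module.Finite S (M × N) := h
    exact ⟨Module.Finite.of_surjective (LinearMap.fst S M N) LinearMap.fst_surjective, n,
      fun L hL i hi => (hn L hL i hi).retract (LinearMap.inl S M N) (LinearMap.fst S M N) (by ext; simp)⟩
  ext_closed A B C f g h hA hC := by
    rw [mem_PDcat_iff] at *
    obtain ⟨hA, n, hn⟩ := hA
    obtain ⟨hC, m, hm⟩ := hC
    exact ⟨h.finite_mid, max n m, fun L hL i hi => h.ev_mid (hn L hL i (by omega))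
      (hm L hL i (by omega))⟩
  syzygy_closed K P M f g h h1 h2 h3 hM := by
    rw [mem_PDcat_iff] at *
    obtain ⟨hM, n, hn⟩ := hM
    exact ⟨h1, n, fun L hL i hi => (h.ev_shift (by omega)).2 (hn L hL _ (by omega))⟩

theorem GG.proj_of_pdLE [IsNoetherianRing S] {n : ℕ} {M : ModuleCat.{u} S} (hM : GG S M)
    (h : pdLE S n M) : Module.Projective S M := by
  induction n generalizing M with
  | zero => exact h
  | succ n ih =>
    obtain ⟨K, P, f, g, _, _, hs, hK⟩ := h
    have hKG : GG S K := GG.left hs (GG.proj P) hM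
    have := ih hKG hK
    have := hKG.1
    obtain ⟨r, hr⟩ := hs.retraction_of_ev (hM.coproj K le_rfl)
    obtain ⟨s, hs'⟩ := hs.section_of_retraction r hr
    exact Module.Projective.of_split s g hs'

theorem GG.ev_pdLE [IsNoetherianRing S] {n : ℕ} {Y : ModuleCat.{u} S} (hM : GG S M)
    (hY : Module.Finite S Y) (h : pdLE S n Y) {i : ℕ} (hi : 1 ≤ i) : EV S M Y i := by
  induction n generalizing Y i with
  | zero =>
    have : Module.Projective S Y := h
    exact hM.coproj Y hi
  | succ n ih =>
    obtain ⟨K, P, f, g, _, _, hs, hK⟩ := h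
    exact hs.coex1 (hM.coproj P hi) (ih hs.finite_left hK (by omega))

theorem GG.ev_PD [IsNoetherianRing S] {Y : ModuleCat.{u} S} (hM : GG S M)
    (hY : Y ∈ PDcat S) {i : ℕ} (hi : 1 ≤ i) : EV S M Y i := by
  obtain ⟨h, n, hn⟩ := hY
  exact hM.ev_pdLE h hn hi

/-! ### duality -/

theorem IsSES.dual {f : A →ₗ[S] B} {g : B →ₗ[S] C} (h : IsSES f g) (hC : EV S C S 1) :
    IsSES g.dualMap f.dualMap := by
  refine IsSES.mk' (LinearMap.dualMap_injective_of_surjective h.2.1) ?_ ?_ ?_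
  · intro k
    obtain ⟨l, hl⟩ := h.ev_ext hC k
    exact ⟨l, hl⟩
  · intro k
    ext a
    simp [h.apply_zero]
  · intro k hk
    obtain ⟨l, hl⟩ := h.desc k (fun a => LinearMap.congr_fun hk a)
    exact ⟨l, hl⟩

/-- Local boundedness of Ext. -/
def Hloc (S : Type u) [CommRing S] : Prop :=
  ∀ p : Ideal S, ∀ _ : p.IsPrime, ∃ h : ℕ, ∀ L : ModuleCat.{u} S, Module.Finite S L →
    ∀ i, h < i → TV p.primeCompl L S i

theorem EV_of_local {n : ℕ} (h : ∀ p : Ideal S, ∀ _ : p.IsPrime, TV p.primeCompl M N n) :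
    EV S M N n := by
  intro e
  by_contra he
  let I : Ideal S := LinearMap.ker (LinearMap.toSpanSingleton S _ e)
  have hI : I ≠ ⊤ := by
    intro hI
    have : (1 : S) ∈ I := by rw [hI]; trivial
    apply he
    simpa [I] using this
  obtain ⟨p, hp, hIp⟩ := Ideal.exists_le_maximal I hI
  obtain ⟨s, hs, hse⟩ := h p hp.isPrime e
  exact hs (hIp (by simpa [I] using hse))

variable [IsNoetherianRing S]

theorem dual_finite' [Module.Finite S M] : Module.Finite S (Module.Dual S M) := by
  obtain ⟨P, g, hg, _, _⟩ := exists_fp S M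
  exact Module.Finite.of_injective g.dualMap (LinearMap.dualMap_injective_of_surjective hg)

theorem GG.dual_TV (p : Ideal S) [p.IsPrime] (h : ℕ)
    (hh : ∀ L : ModuleCat.{u} S, Module.Finite S L → ∀ i, h < i → TV p.primeCompl L S i) (j : ℕ) :
    ∀ (M : ModuleCat.{u} S), GG S M → ∀ i, 1 ≤ i → h < i + j →
      TV p.primeCompl (Module.Dual S M) S i := by
  induction j with
  | zero =>
    intro M hM i _ hi
    have := hM.1
    exact hh (ModuleCat.of S (Module.Dual S M)) dual_finite' i hi
  | succ j ih =>
    intro M hM i hi hj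
    have := hM.1
    obtain ⟨K, P, f, g, hs, _, _, _⟩ := exists_syz S M
    have hK : GG S K := GG.left hs (GG.proj P) hM
    have hd := hs.dual (hM.2 1 le_rfl)
    exact (hd.tv_shift hi).2 (ih K hK (i+1) (by omega) (by omega))

theorem GG.dual (H : Hloc S) (hM : GG S M) : GG S (Module.Dual S M) := by
  have := hM.1
  refine ⟨dual_finite', fun i hi => EV_of_local fun p hp => ?_⟩
  obtain ⟨h, hh⟩ := H p hp
  exact GG.dual_TV p h hh (h+1) (ModuleCat.of S M) hM i hi (by omega)

theorem GG.eval_surj (H : Hloc S) (hM : GG S M) :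
    Function.Surjective (Module.Dual.eval S M) := by
  have := hM.1
  obtain ⟨K, P, f, g, hs, _, _, _⟩ := exists_syz S M
  have hK : GG S K := GG.left hs (GG.proj P) hM
  have hd := (hs.dual (hM.2 1 le_rfl)).dual ((hK.dual H).2 1 le_rfl)
  intro φ
  obtain ⟨ψ, rfl⟩ := hd.2.1 φ
  obtain ⟨x, rfl⟩ := (Module.bijective_dual_eval S P).2 ψ
  exact ⟨g x, rfl⟩

theorem GG.eval_bij (H : Hloc S) (hM : GG S M) :
    Function.Bijective (Module.Dual.eval S M) := by
  refine ⟨?_, hM.eval_surj H⟩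
  have := hM.1
  obtain ⟨K, P, f, g, hs, _, _, _⟩ := exists_syz S M
  have hK : GG S K := GG.left hs (GG.proj P) hM
  have hd := (hs.dual (hM.2 1 le_rfl)).dual ((hK.dual H).2 1 le_rfl)
  rw [injective_iff_map_eq_zero]
  intro m hm
  obtain ⟨x, rfl⟩ := hs.2.1 m
  obtain ⟨ψ, hψ⟩ := hd.exists_of (Module.Dual.eval S P x) hm
  obtain ⟨k, rfl⟩ := hK.eval_surj H ψ
  have : f k = x := (Module.bijective_dual_eval S P).1 hψ
  rw [← this, hs.apply_zero]

/-- Existence of cosyzygies. -/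
theorem GG.cosyz (H : Hloc S) (hM : GG S M) :
    ∃ (P M' : ModuleCat.{u} S) (f : M →ₗ[S] P) (g : P →ₗ[S] M'), IsSES f g ∧ Module.Finite S P ∧
      Module.Projective S P ∧ GG S M' := by
  have hD := hM.dual H
  have := hD.1
  obtain ⟨K, P, f, g, hs, _, _, _⟩ := exists_syz S (Module.Dual S M)
  have hK : GG S K := GG.left hs (GG.proj P) hD
  have hd := hs.dual (hD.2 1 le_rfl)
  exact ⟨ModuleCat.of S (Module.Dual S P), ModuleCat.of S (Module.Dual S K), _, _,
    hd.comp_equiv_left (LinearEquiv.ofBijective _ (hM.eval_bij H)),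
    (inferInstance : Module.Finite S (Module.Dual S P)),
    (inferInstance : Module.Projective S (Module.Dual S P)), hK.dual H⟩

theorem GG.regular (H : Hloc S) (hM : GG S M) {x : S} (hx : x ∈ nonZeroDivisors S) :
    IsSMulRegular M x := by
  obtain ⟨P, M', f, g, hs, _, _, _⟩ := hM.cosyz H
  have hP : IsSMulRegular P x := by
    obtain ⟨k, q, hq⟩ := Module.Finite.exists_fin' S P
    obtain ⟨i, hi⟩ := Module.projective_lifting_property q LinearMap.id hq
    have h1 : IsSMulRegular (Fin k → S) x :=
      IsSMulRegular.pi fun _ => by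
        intro a b hab
        exact (mul_cancel_left_mem_nonZeroDivisors hx).1 hab
    intro a b hab
    have h2 : i a = i b := h1 (by
      change x • i a = x • i b
      rw [← map_smul, ← map_smul]; exact congrArg i hab)
    have := congrArg q h2
    have hqi := LinearMap.congr_fun hi
    simpa using (hqi a).symm.trans (this.trans (hqi b))
  intro a b hab
  apply hs.1
  apply hP
  change x • f a = x • f b
  rw [← map_smul, ← map_smul]; exact congrArg f hab

end GG
end ResolvPaper
namespace ResolvPaper

/-! ## Change of rings -/
section cr
open TensorProduct
variable {S : Type u} [CommRing S] {S' : Type u} [CommRing S'] [Algebra S S']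
variable {A B C K P M N L : Type u} [AddCommGroup A] [Module S A] [AddCommGroup B] [Module S B]
  [AddCommGroup C] [Module S C] [AddCommGroup M] [Module S M] [AddCommGroup N] [Module S N]
  [AddCommGroup K] [Module S K] [AddCommGroup P] [Module S P]
  [AddCommGroup L] [Module S L] [Module S' L] [IsScalarTower S S' L]

/-- adjunction for extension problems -/
theorem IsSES.ext_baseChange (f : K →ₗ[S] P) :
    (∀ k : K →ₗ[S] L, ∃ l : P →ₗ[S] L, l ∘ₗ f = k) ↔
    (∀ k : (S' ⊗[S] K) →ₗ[S'] L, ∃ l : (S' ⊗[S] P) →ₗ[S'] L, l ∘ₗ f.baseChange S' = k) := by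
  constructor
  · intro H k
    obtain ⟨l, hl⟩ := H (k.restrictScalars S ∘ₗ TensorProduct.mk S S' K 1)
    refine ⟨l.liftBaseChange S', ?_⟩
    apply TensorProduct.AlgebraTensorModule.curry_injective
    ext a
    have := LinearMap.congr_fun hl a
    simpa using this
  · intro H k
    obtain ⟨l, hl⟩ := H (k.liftBaseChange S')
    refine ⟨l.restrictScalars S ∘ₗ TensorProduct.mk S S' P 1, ?_⟩
    ext a
    have := LinearMap.congr_fun hl (1 ⊗ₜ a)
    simpa using this

/-- Base change for Ext, for a class of modules whose presentations are preserved. -/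
theorem EV_baseChange [IsNoetherianRing S] (Q : ModuleCat.{u} S → Prop)
    (hQ : ∀ (K P N : ModuleCat.{u} S) (f : K →ₗ[S] P) (g : P →ₗ[S] N), IsSES f g → Q N →
      Module.Finite S P → Module.Projective S P →
      Q K ∧ IsSES (f.baseChange S') (g.baseChange S')) (N : ModuleCat.{u} S)
    (hN : Module.Finite S N) (hq : Q N) {i : ℕ} (hi : 1 ≤ i) :
    EV S N L i ↔ EV S' (S' ⊗[S] N) L i := by
  induction i, hi using Nat.le_induction generalizing N with
  | base =>
    obtain ⟨K, P, f, g, hs, _, _, _⟩ := exists_syz S N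
    rw [hs.ev_one, (hQ K P N f g hs hq ‹_› ‹_›).2.ev_one]
    exact IsSES.ext_baseChange f
  | succ i hi ih =>
    obtain ⟨K, P, f, g, hs, _, _, _⟩ := exists_syz S N
    obtain ⟨h1, h2⟩ := hQ K P N f g hs hq ‹_› ‹_›
    rw [← hs.ev_shift hi, ← h2.ev_shift hi, ih K ‹_› h1]

theorem IsSES.baseChange_flat [Module.Flat S S'] {f : A →ₗ[S] B} {g : B →ₗ[S] C} (h : IsSES f g) :
    IsSES (f.baseChange S') (g.baseChange S') := by
  have he := Module.Flat.lTensor_exact S' (LinearMap.exact_iff.2 h.2.2.symm)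
  refine IsSES.mk' (Module.Flat.lTensor_preserves_injective_linearMap f h.1)
    (LinearMap.lTensor_surjective S' h.2.1) (fun a => ?_) (fun b hb => ?_)
  · exact (he _).2 ⟨a, rfl⟩
  · exact (he b).1 hb

theorem EV_flat [IsNoetherianRing S] [Module.Flat S S'] [Module.Finite S N] {i : ℕ} (hi : 1 ≤ i) :
    EV S N L i ↔ EV S' (S' ⊗[S] N) L i :=
  EV_baseChange (fun _ => True) (fun K P N f g hs _ _ _ => ⟨trivial, hs.baseChange_flat⟩)
    (ModuleCat.of S N) ‹_› trivial hi

theorem proj_regular (P : Type u) [AddCommGroup P] [Module S P] [Module.Finite S P]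
    [Module.Projective S P] {x : S} (hx : x ∈ nonZeroDivisors S) : IsSMulRegular P x := by
  obtain ⟨k, q, hq⟩ := Module.Finite.exists_fin' S P
  obtain ⟨i, hi⟩ := Module.projective_lifting_property q LinearMap.id hq
  have h1 : IsSMulRegular (Fin k → S) x :=
    IsSMulRegular.pi fun _ => by
      intro a b hab
      exact (mul_cancel_left_mem_nonZeroDivisors hx).1 hab
  intro a b hab
  have h2 : i a = i b := h1 (by
    change x • i a = x • i b
    rw [← map_smul, ← map_smul]; exact congrArg i hab)
  have := congrArg q h2
  have hqi := LinearMap.congr_fun hi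
  simpa using (hqi a).symm.trans (this.trans (hqi b))

theorem regular_of_injective {f : A →ₗ[S] B} (hf : Function.Injective f) {x : S}
    (hB : IsSMulRegular B x) : IsSMulRegular A x := by
  intro a b hab
  apply hf
  apply hB
  change x • f a = x • f b
  rw [← map_smul, ← map_smul]; exact congrArg f hab

theorem IsSMulRegular.zero_of {x : S} (h : IsSMulRegular M x) {m : M} (hm : x • m = 0) : m = 0 :=
  h (by simpa using hm)

/-- `S' = S/(x)` with `x` a nonzerodivisor. -/
structure QS (S S' : Type u) [CommRing S] [CommRing S'] [Algebra S S'] (x : S) : Prop where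
  surj : Function.Surjective (algebraMap S S')
  ker : ∀ s, algebraMap S S' s = 0 ↔ ∃ t, s = x * t
  nzd : x ∈ nonZeroDivisors S

namespace QS
variable {x : S} (q : QS S S' x)
include q

theorem map_x : algebraMap S S' x = 0 := (q.ker x).2 ⟨1, by simp⟩

theorem noeth [IsNoetherianRing S] : IsNoetherianRing S' :=
  isNoetherianRing_of_surjective S S' (algebraMap S S') q.surj

theorem mk_surj (M : Type u) [AddCommGroup M] [Module S M] (z : S' ⊗[S] M) : ∃ m, 1 ⊗ₜ m = z :=
  TensorProduct.mk_surjective S M S' q.surj z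

theorem mk_x (m : M) : (1 : S') ⊗ₜ[S] (x • m) = 0 := by
  rw [TensorProduct.tmul_smul, TensorProduct.smul_tmul', ← Algebra.algebraMap_eq_smul_one, q.map_x,
    TensorProduct.zero_tmul]

theorem mk_zero (m : M) : (1 : S') ⊗ₜ[S] m = 0 ↔ ∃ n, m = x • n := by
  constructor
  · intro h
    have hex : Function.Exact (x • LinearMap.id : S →ₗ[S] S) (Algebra.linearMap S S') := by
      intro s
      rw [Algebra.linearMap_apply, q.ker s]
      exact ⟨fun ⟨t, ht⟩ => ⟨t, by simp [ht]⟩, fun ⟨t, ht⟩ => ⟨t, by simpa using ht.symm⟩⟩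
    have := (rTensor_exact M hex q.surj) (1 ⊗ₜ m)
    obtain ⟨z, hz⟩ := this.1 (by simpa using h)
    refine ⟨TensorProduct.lid S M z, ?_⟩
    have h2 := congrArg (TensorProduct.lid S M) hz
    rw [TensorProduct.lid_tmul, one_smul] at h2
    rw [← h2]
    clear hz h2
    induction z using TensorProduct.induction_on with
    | zero => simp
    | tmul a b => simp [mul_smul]
    | add a b h1 h2 => rw [map_add, map_add, map_add, smul_add, h1, h2]
  · rintro ⟨n, rfl⟩
    exact q.mk_x n

theorem ses_mul (hM : IsSMulRegular M x) :
    IsSES (x • LinearMap.id : M →ₗ[S] M) (TensorProduct.mk S S' M 1) := by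
  refine IsSES.mk' hM (q.mk_surj M) (fun m => q.mk_x m) fun m hm => ?_
  obtain ⟨n, rfl⟩ := (q.mk_zero m).1 hm
  exact ⟨n, rfl⟩

theorem ses_ring : IsSES (x • LinearMap.id : S →ₗ[S] S) (Algebra.linearMap S S') := by
  refine IsSES.mk' (fun a b hab => (mul_cancel_left_mem_nonZeroDivisors q.nzd).1 hab) q.surj
    (fun m => by simp [q.map_x]) fun m hm => ?_
  obtain ⟨n, rfl⟩ := (q.ker m).1 hm
  exact ⟨n, rfl⟩

theorem ses {f : A →ₗ[S] B} {g : B →ₗ[S] C} (h : IsSES f g) (hC : IsSMulRegular C x) :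
    IsSES (f.baseChange S') (g.baseChange S') := by
  refine IsSES.mk' ?_ ?_ ?_ ?_
  · rw [injective_iff_map_eq_zero]
    intro z hz
    obtain ⟨a, rfl⟩ := q.mk_surj A z
    rw [LinearMap.baseChange_tmul, q.mk_zero] at hz
    obtain ⟨b, hb⟩ := hz
    have : g b = 0 := by
      apply IsSMulRegular.zero_of hC
      rw [← map_smul, ← hb, h.apply_zero]
    obtain ⟨a', rfl⟩ := h.exists_of b this
    rw [q.mk_zero]
    exact ⟨a', h.1 (by rw [hb, map_smul])⟩
  · intro z
    obtain ⟨c, rfl⟩ := q.mk_surj C z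
    obtain ⟨b, rfl⟩ := h.2.1 c
    exact ⟨1 ⊗ₜ b, by simp⟩
  · intro z
    obtain ⟨a, rfl⟩ := q.mk_surj A z
    simp [h.apply_zero]
  · intro z hz
    obtain ⟨b, rfl⟩ := q.mk_surj B z
    rw [LinearMap.baseChange_tmul, q.mk_zero] at hz
    obtain ⟨c, hc⟩ := hz
    obtain ⟨b', rfl⟩ := h.2.1 c
    obtain ⟨a, ha⟩ := h.exists_of (b - x • b') (by simp [hc])
    refine ⟨1 ⊗ₜ a, ?_⟩
    rw [LinearMap.baseChange_tmul, ha, TensorProduct.tmul_sub, q.mk_x, sub_zero]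

theorem EV_iff [IsNoetherianRing S] [Module.Finite S N] (hN : IsSMulRegular N x) {i : ℕ}
    (hi : 1 ≤ i) : EV S N L i ↔ EV S' (S' ⊗[S] N) L i :=
  EV_baseChange (fun N => IsSMulRegular N x)
    (fun _ P _ _ _ hs hN _ _ => ⟨regular_of_injective hs.1 (proj_regular P q.nzd), q.ses hs hN⟩)
    (ModuleCat.of S N) ‹_› hN hi

theorem EV_ring {i : ℕ} (h1 : EV S N S i) (h2 : EV S N S (i+1)) : EV S N S' i :=
  q.ses_ring.coex1 h1 h2

theorem EV_nak [IsNoetherianRing S] [IsLocalRing S] (hx : x ∈ IsLocalRing.maximalIdeal S)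
    [Module.Finite S N] {i : ℕ} (h : EV S N S' i) : EV S N S i := by
  have hfin : Module.Finite S (XT S N S i) := finite_XT
  have key : (⊤ : Submodule S (XT S N S i)) ≤ IsLocalRing.maximalIdeal S • ⊤ := by
    intro e _
    obtain ⟨e', he'⟩ := Abelian.Ext.covariant_sequence_exact₂ (ModuleCat.of S N)
      q.ses_ring.shortExact e (h _)
    have : e = x • e' := by
      rw [← he', Abelian.Ext.smul_eq_comp_mk₀]
      rfl
    rw [this]
    exact Submodule.smul_mem_smul hx trivial
  have := Submodule.eq_bot_of_le_smul_of_le_jacobson_bot _ _ hfin.1 key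
    (IsLocalRing.jacobson_eq_maximalIdeal ⊥ bot_ne_top).ge
  intro e
  have : e ∈ (⊤ : Submodule S (XT S N S i)) := trivial
  simpa [*] using this

theorem EV_up [IsNoetherianRing S] [IsLocalRing S] (hx : x ∈ IsLocalRing.maximalIdeal S)
    [Module.Finite S N] (hN : IsSMulRegular N x) {i : ℕ} (hi : 1 ≤ i)
    (h : EV S' (S' ⊗[S] N) S' i) : EV S N S i :=
  q.EV_nak hx ((q.EV_iff hN hi).2 h)

theorem GG_down [IsNoetherianRing S] (hN : IsSMulRegular N x) (h : GG S N) :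
    GG S' (S' ⊗[S] N) := by
  have := h.1
  exact ⟨inferInstance, fun i hi => (q.EV_iff hN hi).1
    (q.EV_ring (h.2 i hi) (h.2 (i+1) (by omega)))⟩

theorem GG_up [IsNoetherianRing S] [IsLocalRing S] (hx : x ∈ IsLocalRing.maximalIdeal S)
    [Module.Finite S N] (hN : IsSMulRegular N x) (h : GG S' (S' ⊗[S] N)) : GG S N :=
  ⟨‹_›, fun i hi => q.EV_up hx hN hi (h.2 i hi)⟩

end QS
end cr
end ResolvPaper
namespace ResolvPaper

section reg
open TensorProduct
variable {S : Type u} [CommRing S] {S' : Type u} [CommRing S'] [Algebra S S']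
variable {N L : Type u} [AddCommGroup N] [Module S N]  [AddCommGroup L] [Module S L]

theorem QS.mk' {x : S} (hx : x ∈ nonZeroDivisors S) : QS S (S ⧸ Ideal.span {x}) x where
  surj := Ideal.Quotient.mk_surjective
  ker s := by
    rw [Ideal.Quotient.algebraMap_eq, Ideal.Quotient.eq_zero_iff_mem, Ideal.mem_span_singleton]
    rfl
  nzd := hx

theorem QS.EV_nak' {x : S} (q : QS S S' x) [IsNoetherianRing S] [IsLocalRing S]
    (hx : x ∈ IsLocalRing.maximalIdeal S)
    [Module.Finite S N] [Module.Finite S L] (hL : IsSMulRegular L x) {i : ℕ}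
    (h : EV S N (S' ⊗[S] L) i) : EV S N L i := by
  have hfin : Module.Finite S (XT S N L i) := finite_XT
  have key : (⊤ : Submodule S (XT S N L i)) ≤ IsLocalRing.maximalIdeal S • ⊤ := by
    intro e _
    obtain ⟨e', he'⟩ := Abelian.Ext.covariant_sequence_exact₂ (ModuleCat.of S N)
      (q.ses_mul hL).shortExact e (h _)
    have : e = x • e' := by
      rw [← he', Abelian.Ext.smul_eq_comp_mk₀]
      rfl
    rw [this]
    exact Submodule.smul_mem_smul hx trivial
  have := Submodule.eq_bot_of_le_smul_of_le_jacobson_bot _ _ hfin.1 key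
    (IsLocalRing.jacobson_eq_maximalIdeal ⊥ bot_ne_top).ge
  intro e
  have : e ∈ (⊤ : Submodule S (XT S N L i)) := trivial
  simpa [*] using this

/-- bounded global dimension (f.g. modules) -/
def GD (S : Type u) [CommRing S] (n : ℕ) : Prop :=
  ∀ M N : ModuleCat.{u} S, Module.Finite S M → Module.Finite S N → ∀ i, n < i → EV S M N i

theorem QS.GD_up {x : S} (q : QS S S' x) [IsNoetherianRing S] [IsLocalRing S]
    (hx : x ∈ IsLocalRing.maximalIdeal S) {n : ℕ} (h : GD S' n) : GD S (n+1) := by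
  have key : ∀ M N : ModuleCat.{u} S, Module.Finite S M → Module.Finite S N →
      IsSMulRegular N x → ∀ i, n + 1 < i → EV S M N i := by
    intro M N hM hN hr i hi
    obtain ⟨K, P, f, g, hs, _, _, _⟩ := exists_syz S M
    obtain ⟨j, rfl⟩ : ∃ j, i = j + 1 := ⟨i - 1, by omega⟩
    rw [← hs.ev_shift (by omega)]
    have hK : IsSMulRegular K x := regular_of_injective hs.1 (proj_regular P q.nzd)
    apply q.EV_nak' hx hr
    rw [q.EV_iff (S' := S') hK (by omega)]
    exact h (ModuleCat.of S' (S' ⊗[S] K)) (ModuleCat.of S' (S' ⊗[S] N)) inferInstance inferInstance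
      j (by omega)
  intro M N hM hN i hi
  obtain ⟨K, P, f, g, hs, _, _, _⟩ := exists_syz S N
  exact hs.coex1 (key M P hM ‹_› (proj_regular P q.nzd) i hi)
    (key M K hM ‹_› (regular_of_injective hs.1 (proj_regular P q.nzd)) (i+1) (by omega))

theorem local_quot [IsLocalRing S] {x : S} (hx : x ∈ IsLocalRing.maximalIdeal S) :
    Nontrivial (S ⧸ Ideal.span {x}) :=
  Ideal.Quotient.nontrivial_iff.2 fun h => by
    have : Ideal.span {x} ≤ IsLocalRing.maximalIdeal S := by simpa [Ideal.span_le] using hx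
    rw [h, top_le_iff] at this
    exact (IsLocalRing.maximalIdeal.isMaximal S).ne_top this

theorem max_of_surj [IsLocalRing S] [IsLocalRing S'] (h : Function.Surjective (algebraMap S S')) :
    (IsLocalRing.maximalIdeal S).map (algebraMap S S') = IsLocalRing.maximalIdeal S' := by
  exact IsLocalRing.map_maximalIdeal_of_surjective _ h

theorem wb_le {n : ℕ} {d : WithBot ℕ∞} (h : ((n + 1 : ℕ) : WithBot ℕ∞) ≤ d + ((1 : ℕ) : WithBot ℕ∞)) :
    (n : WithBot ℕ∞) ≤ d := by
  induction d with
  | bot => simp at h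
  | coe d =>
    induction d with
    | top => exact le_top
    | coe d =>
      have : n + 1 ≤ d + 1 := by exact_mod_cast h
      have : n ≤ d := by omega
      exact_mod_cast this

theorem reg_aux (n : ℕ) : ∀ (S : Type u) [CommRing S] [IsLocalRing S] [IsNoetherianRing S],
    (∃ s : Finset S, s.card ≤ n ∧ Ideal.span (s : Set S) = IsLocalRing.maximalIdeal S) →
    (n : WithBot ℕ∞) ≤ ringKrullDim S → IsDomain S ∧ GD S n := by
  induction n with
  | zero =>
    rintro S _ _ _ ⟨s, hs, hm⟩ -
    have : s = ∅ := Finset.card_eq_zero.1 (by omega)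
    subst this
    have hm' : IsLocalRing.maximalIdeal S = ⊥ := by simpa using hm.symm
    have hF : IsField S := IsLocalRing.isField_iff_maximalIdeal_eq.2 hm'
    refine ⟨hF.isDomain, ?_⟩
    intro M N _ _ i hi
    let _ := hF.toField
    have : Module.Projective S M := Module.Projective.of_free
    exact EV.proj M hi
  | succ n ih =>
    rintro S _ _ _ ⟨s, hs, hm⟩ hd
    classical
    have hnf : IsLocalRing.maximalIdeal S ∉ minimalPrimes S := by
      intro h
      have h1 : (IsLocalRing.maximalIdeal S).height = 0 := by
        exact Ideal.height_eq_zero_iff.2 h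
      rw [← IsLocalRing.maximalIdeal_height_eq_ringKrullDim, h1] at hd
      have : ((n+1 : ℕ) : ℕ∞) ≤ 0 := by exact_mod_cast hd
      simp at this
    have hm2 : ¬ IsLocalRing.maximalIdeal S ≤ IsLocalRing.maximalIdeal S ^ 2 := by
      intro h
      have := Submodule.eq_bot_of_le_smul_of_le_jacobson_bot (IsLocalRing.maximalIdeal S)
        (IsLocalRing.maximalIdeal S) (IsNoetherian.noetherian _) (by simpa [sq] using h)
        (IsLocalRing.jacobson_eq_maximalIdeal ⊥ bot_ne_top).ge
      apply hnf
      rw [this]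
      have hp : (⊥ : Ideal S).IsPrime := this ▸ (IsLocalRing.maximalIdeal.isMaximal S).isPrime
      exact ⟨⟨hp, le_rfl⟩, fun _ _ _ => bot_le⟩
    obtain ⟨x, hxm, hx⟩ : ∃ x ∈ IsLocalRing.maximalIdeal S,
        x ∉ IsLocalRing.maximalIdeal S ^ 2 ∧ ∀ P ∈ minimalPrimes S, x ∉ P := by
      by_contra! hcon
      have := (Ideal.subset_union_prime_finite (f := id)
        (Set.Finite.insert (IsLocalRing.maximalIdeal S ^ 2)
          (minimalPrimes.finite_of_isNoetherianRing S))
        (IsLocalRing.maximalIdeal S ^ 2) (IsLocalRing.maximalIdeal S ^ 2)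
        (I := IsLocalRing.maximalIdeal S) ?_).1 ?_
      · obtain ⟨P, hP, hle⟩ := this
        rcases hP with rfl | hP
        · exact hm2 hle
        · have := (IsLocalRing.maximalIdeal.isMaximal S).eq_of_le hP.1.1.ne_top hle
          exact hnf (this ▸ hP)
      · rintro P (rfl | hP) h1 h2
        · exact absurd rfl h1
        · exact hP.1.1
      · intro y hy
        simp only [Set.mem_iUnion]
        by_cases h : y ∈ IsLocalRing.maximalIdeal S ^ 2
        · exact ⟨_, Set.mem_insert _ _, h⟩
        · obtain ⟨P, hP, hyP⟩ := hcon y hy h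
          exact ⟨P, Set.mem_insert_of_mem _ hP, hyP⟩
    have hnt := local_quot hxm
    have hl : IsLocalRing (S ⧸ Ideal.span {x}) :=
      IsLocalRing.of_surjective' (Ideal.Quotient.mk _) Ideal.Quotient.mk_surjective
    have hmm := max_of_surj (S := S) (S' := S ⧸ Ideal.span {x}) Ideal.Quotient.mk_surjective
    obtain ⟨f, hf⟩ := Submodule.mem_span_finset.1 (show x ∈ Submodule.span S (s : Set S) from by
      change x ∈ Ideal.span _; rwa [hm])
    obtain ⟨a, has, hfa⟩ : ∃ a ∈ s, IsUnit (f a) := by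
      by_contra! hcon
      apply hx.1
      rw [← hf.2, sq]
      refine Ideal.sum_mem _ fun a ha => Ideal.mul_mem_mul (hcon a ha) ?_
      rw [← hm]; exact Ideal.subset_span ha
    have hq := ih (S ⧸ Ideal.span {x}) ⟨(s.erase a).image (algebraMap S (S ⧸ Ideal.span {x})), ?_, ?_⟩ ?_
    · obtain ⟨hdom, hgd⟩ := hq
      have hxp : (Ideal.span {x}).IsPrime := Ideal.Quotient.isDomain_iff_prime _ |>.1 hdom
      obtain ⟨P, hP, hPx⟩ := Ideal.exists_minimalPrimes_le (I := (⊥ : Ideal S))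
        (J := Ideal.span {x}) bot_le
      have hP' : P ∈ minimalPrimes S := hP
      have hPp : P.IsPrime := hP'.1.1
      have hb : P = ⊥ := by
        refine Submodule.eq_bot_of_le_smul_of_le_jacobson_bot (IsLocalRing.maximalIdeal S)
          P (IsNoetherian.noetherian _) ?_ (IsLocalRing.jacobson_eq_maximalIdeal ⊥ bot_ne_top).ge
        intro y hy
        obtain ⟨z, rfl⟩ := Ideal.mem_span_singleton.1 (hPx hy)
        have hz : z ∈ P := (hPp.mem_or_mem hy).resolve_left (hx.2 P hP')
        exact Submodule.smul_mem_smul hxm hz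
      have hD : IsDomain S := by
        subst hb
        exact IsDomain.of_bot_isPrime S
      refine ⟨hD, (QS.mk' (mem_nonZeroDivisors_of_ne_zero ?_)).GD_up hxm hgd⟩
      rintro rfl
      exact hx.1 (Ideal.zero_mem _)
    · have := Finset.card_image_le (s := s.erase a) (f := algebraMap S (S ⧸ Ideal.span {x}))
      rw [Finset.card_erase_of_mem has] at this
      omega
    · rw [← hmm, ← hm, Finset.coe_image, ← Ideal.map_span]
      apply le_antisymm
      · exact Ideal.map_mono (Ideal.span_mono (by simp))
      · rw [Ideal.map_span, Ideal.span_le]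
        rintro _ ⟨b, hb, rfl⟩
        by_cases hba : b = a
        · subst hba
          have h0 : algebraMap S (S ⧸ Ideal.span {x}) x = 0 := by
            rw [Ideal.Quotient.algebraMap_eq, Ideal.Quotient.eq_zero_iff_mem]
            exact Ideal.mem_span_singleton_self x
          have h1 := congrArg (algebraMap S (S ⧸ Ideal.span {x})) hf.2
          rw [h0, ← Finset.add_sum_erase _ _ has, map_add, smul_eq_mul, map_mul] at h1
          have hu := hfa.map (algebraMap S (S ⧸ Ideal.span {x}))
          refine (Ideal.unit_mul_mem_iff_mem _ hu).1 ?_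
          rw [eq_neg_of_add_eq_zero_left h1]
          refine neg_mem (Ideal.mem_map_of_mem _ (Ideal.sum_mem _ fun c hc => ?_))
          exact Ideal.mul_mem_left _ _ (Ideal.subset_span hc)
        · exact Ideal.mem_map_of_mem _ (Ideal.subset_span (by simpa using ⟨hb, hba⟩))
    · have := ringKrullDim_le_ringKrullDim_quotient_add_card ({x} : Finset S) (by
        simpa [IsLocalRing.ringJacobson_eq_maximalIdeal] using hxm)
      rw [Finset.coe_singleton, Finset.card_singleton] at this
      exact wb_le (hd.trans this)

theorem reg_GD (S : Type u) [CommRing S] [IsLocalRing S] (h : IsRegLocalRing S) : ∃ n, GD S n := by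
  obtain ⟨_, s, hs, hd⟩ := h
  exact ⟨_, (reg_aux s.card S ⟨s, le_rfl, hs⟩ hd.ge).2⟩

theorem GD.pdLE {n : ℕ} (h : GD S n) [IsNoetherianRing S] (M : ModuleCat.{u} S) (hM : Module.Finite S M) :
    pdLE S n M := pdLE_of_ev hM fun N hN i hi => h M N hM hN i hi

end reg
end ResolvPaper
namespace ResolvPaper

section ci
open TensorProduct
variable {S : Type u} [CommRing S] {S' : Type u} [CommRing S'] [Algebra S S']

/-- an `S`-linear map between `S'`-modules is `S'`-linear -/
def upLin (h : Function.Surjective (algebraMap S S')) {A B : Type u} [AddCommGroup A] [Module S A]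
    [Module S' A] [IsScalarTower S S' A] [AddCommGroup B] [Module S B]
    [Module S' B] [IsScalarTower S S' B] (f : A →ₗ[S] B) : A →ₗ[S'] B :=
  { f with
    map_smul' := fun s a => by
      obtain ⟨t, rfl⟩ := h s
      change f (algebraMap S S' t • a) = algebraMap S S' t • f a
      rw [algebraMap_smul, algebraMap_smul, map_smul] }

theorem upLin_apply (h : Function.Surjective (algebraMap S S')) {A B : Type u} [AddCommGroup A]
    [Module S A] [Module S' A] [IsScalarTower S S' A] [AddCommGroup B] [Module S B]
    [Module S' B] [IsScalarTower S S' B] (f : A →ₗ[S] B) (a : A) : upLin h f a = f a := rfl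

theorem QS.x_smul {x : S} (q : QS S S' x) {M : Type u} [AddCommGroup M] [Module S M] [Module S' M]
    [IsScalarTower S S' M] (m : M) : x • m = 0 := by
  rw [← algebraMap_smul S' x m, q.map_x, zero_smul]

theorem QS.eisenbud {x : S} (q : QS S S' x) {M K P : Type u} [AddCommGroup M] [Module S M]
    [Module S' M] [IsScalarTower S S' M] [AddCommGroup K] [Module S K] [AddCommGroup P] [Module S P]
    [Module.Finite S P] [Module.Projective S P] {k : K →ₗ[S] P} {p : P →ₗ[S] M} (hs : IsSES k p) :
    ∃ (W : ModuleCat.{u} S') (j : M →ₗ[S'] S' ⊗[S] K) (v : S' ⊗[S] K →ₗ[S'] W)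
      (i : W →ₗ[S'] S' ⊗[S] P) (t : S' ⊗[S] P →ₗ[S'] M), IsSES j v ∧ IsSES i t := by
  have hP := proj_regular P q.nzd
  obtain ⟨θ, hθ⟩ := hs.lift (x • LinearMap.id : P →ₗ[S] P) (fun m => by simp [q.x_smul])
  have hθ' : ∀ y, k (θ y) = x • y := LinearMap.congr_fun hθ
  have hθk : ∀ y, θ (k y) = x • y := fun y => hs.1 (by rw [hθ', map_smul])
  obtain ⟨j, hj⟩ := hs.desc (TensorProduct.mk S S' K 1 ∘ₗ θ) (fun a => by
    simp only [LinearMap.comp_apply, hθk]; exact q.mk_x a)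
  have hj' : ∀ y, j (p y) = 1 ⊗ₜ θ y := LinearMap.congr_fun hj
  refine ⟨ModuleCat.of S' (LinearMap.range (k.baseChange S')), upLin q.surj j,
    (k.baseChange S').rangeRestrict, (LinearMap.range (k.baseChange S')).subtype,
    p.liftBaseChange S', ?_, ?_⟩
  · refine IsSES.mk' ?_ (LinearMap.surjective_rangeRestrict _) ?_ ?_
    · rw [injective_iff_map_eq_zero]
      intro m hm
      obtain ⟨y, rfl⟩ := hs.2.1 m
      rw [upLin_apply, hj', q.mk_zero] at hm
      obtain ⟨n, hn⟩ := hm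
      have : y = k n := hP (by
        change x • y = x • k n
        rw [← hθ', hn, map_smul])
      rw [this, hs.apply_zero]
    · intro m
      obtain ⟨y, rfl⟩ := hs.2.1 m
      apply Subtype.ext
      change k.baseChange S' (upLin q.surj j (p y)) = 0
      rw [upLin_apply, hj', LinearMap.baseChange_tmul, hθ', q.mk_x]
    · intro z hz
      obtain ⟨y, rfl⟩ := q.mk_surj K z
      have h0 : k.baseChange S' (1 ⊗ₜ y) = 0 := congrArg Subtype.val hz
      rw [LinearMap.baseChange_tmul, q.mk_zero] at h0
      obtain ⟨n, hn⟩ := h0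
      refine ⟨p n, ?_⟩
      rw [upLin_apply, hj']
      congr 1
      apply hs.1
      rw [hθ', hn]
  · refine IsSES.mk' (Submodule.subtype_injective _) ?_ ?_ ?_
    · intro m
      obtain ⟨y, rfl⟩ := hs.2.1 m
      exact ⟨1 ⊗ₜ y, by simp⟩
    · rintro ⟨_, z, rfl⟩
      obtain ⟨y, rfl⟩ := q.mk_surj K z
      simp [hs.apply_zero]
    · intro z hz
      obtain ⟨y, rfl⟩ := q.mk_surj P z
      obtain ⟨a, rfl⟩ := hs.exists_of y (by simpa using hz)
      exact ⟨⟨_, 1 ⊗ₜ a, rfl⟩, by simp⟩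

/-- Properties of abstract complete intersections. -/
structure Good (S : Type u) [CommRing S] : Prop where
  loc : IsLocalRing S
  noeth : IsNoetherianRing S
  bdd : ∃ n, ∀ L : ModuleCat.{u} S, Module.Finite S L → ∀ i, n < i → EV S L S i
  cosyz : ∀ 𝒳 : Set (ModuleCat.{u} S), IsResolving S 𝒳 → ∀ (M F N : ModuleCat.{u} S)
    (f : M →ₗ[S] F) (g : F →ₗ[S] N), IsSES f g → Module.Finite S F → Module.Projective S F →
    GG S M → GG S N → M ∈ 𝒳 → N ∈ 𝒳

theorem Good.hloc (h : Good S) : Hloc S := by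
  obtain ⟨n, hn⟩ := h.bdd
  exact fun p _ => ⟨n, fun L hL i hi => (hn L hL i hi).tv _⟩

theorem Good.of_reg (S : Type u) [CommRing S] [IsLocalRing S] (h : IsRegLocalRing S) : Good S := by
  have := h.1
  obtain ⟨n, hn⟩ := reg_GD S h
  refine ⟨‹_›, h.1, ⟨n, fun L hL i hi => hn L (ModuleCat.of S S) hL inferInstance i hi⟩, ?_⟩
  intro 𝒳 hX M F N f g hs _ _ _ hN hM
  have := hN.1
  have : Module.Projective S N := hN.proj_of_pdLE (hn.pdLE N this)
  exact hX.proj (P := N)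

theorem resolving_up {x : S} (q : QS S S' x) [IsNoetherianRing S] (H : Hloc S)
    {𝒳 : Set (ModuleCat.{u} S')} (hX : IsResolving S' 𝒳) :
    IsResolving S {X | GG S X ∧ ModuleCat.of S' (S' ⊗[S] X) ∈ 𝒳} where
  fg M hM := hM.1.1
  iso_closed M N := fun ⟨e⟩ hM => ⟨hM.1.iso e, hX.iso (e.baseChange S S' M N) hM.2⟩
  proj_mem M _ _ := ⟨GG.proj M, hX.proj⟩
  summand_closed M N h := ⟨h.1.retract (LinearMap.inl S M N) (LinearMap.fst S M N) (by ext; simp),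
    hX.retract ((LinearMap.inl S M N).baseChange S') ((LinearMap.fst S M N).baseChange S')
      (by rw [← LinearMap.baseChange_comp]; simp) h.2⟩
  ext_closed A B C f g hs hA hC := ⟨GG.mid hs hA.1 hC.1,
    hX.ext (q.ses hs (hC.1.regular H q.nzd)) hA.2 hC.2⟩
  syzygy_closed K P M f g hs _ _ _ hM := ⟨GG.left hs (GG.proj P) hM.1, by
    have := q.noeth
    exact hX.syz (q.ses hs (hM.1.regular H q.nzd)) hM.2⟩

theorem QS.mem_max {x : S} (q : QS S S' x) [IsLocalRing S] [Nontrivial S'] :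
    x ∈ IsLocalRing.maximalIdeal S := by
  intro hu
  have := hu.map (algebraMap S S')
  rw [q.map_x] at this
  exact not_isUnit_zero this

theorem QS.fin {x : S} (q : QS S S' x) (M : Type u) [AddCommGroup M] [Module S M] [Module S' M]
    [IsScalarTower S S' M] [Module.Finite S' M] : Module.Finite S M := by
  have : Module.Finite S S' := Module.Finite.of_surjective (Algebra.linearMap S S') q.surj
  exact Module.Finite.trans S' M

theorem QS.tensor_equiv {x : S} (q : QS S S' x) (M : Type u) [AddCommGroup M] [Module S M] [Module S' M]
    [IsScalarTower S S' M] : Nonempty ((S' ⊗[S] M) ≃ₗ[S'] M) := by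
  refine ⟨LinearEquiv.ofBijective (LinearMap.liftBaseChange S' (LinearMap.id : M →ₗ[S] M)) ⟨?_, ?_⟩⟩
  · rw [injective_iff_map_eq_zero]
    intro z hz
    obtain ⟨m, rfl⟩ := q.mk_surj M z
    have : m = 0 := by simpa using hz
    simp [this]
  · intro m
    exact ⟨1 ⊗ₜ m, by simp⟩

theorem QS.lift_of_ev {x : S} (q : QS S S' x) {K : Type u} [AddCommGroup K] [Module S K]
    (h : EV S K S 1) (ψ : K →ₗ[S] S') : ∃ ψ' : K →ₗ[S] S, ∀ k, algebraMap S S' (ψ' k) = ψ k := by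
  let U : Submodule S (S × K) := LinearMap.eqLocus (Algebra.linearMap S S' ∘ₗ LinearMap.fst S S K)
    (ψ ∘ₗ LinearMap.snd S S K)
  have hx' : ∀ s : S, algebraMap S S' (x * s) = 0 := fun s => by rw [map_mul, q.map_x, zero_mul]
  let f : S →ₗ[S] U := LinearMap.codRestrict U (LinearMap.inl S S K ∘ₗ (x • LinearMap.id))
    (fun s => by simp [U, LinearMap.mem_eqLocus, q.map_x])
  let g : U →ₗ[S] K := LinearMap.snd S S K ∘ₗ U.subtype
  have hs : IsSES f g := by
    refine IsSES.mk' ?_ ?_ ?_ ?_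
    · intro a b hab
      have h1 : x * a = x * b := congrArg (fun z : U => z.1.1) hab
      exact (mul_cancel_left_mem_nonZeroDivisors q.nzd).1 h1
    · intro k
      obtain ⟨s, hs⟩ := q.surj (ψ k)
      exact ⟨⟨(s, k), hs⟩, rfl⟩
    · intro s; rfl
    · rintro ⟨⟨s, k⟩, hsk⟩ hk
      have hk : k = 0 := hk
      subst hk
      have h0 : algebraMap S S' s = 0 := by
        have : algebraMap S S' s = ψ 0 := hsk
        rw [this, map_zero]
      obtain ⟨t, rfl⟩ := (q.ker s).1 h0
      exact ⟨t, Subtype.ext rfl⟩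
  obtain ⟨r, hr⟩ := hs.retraction_of_ev h
  obtain ⟨s, hs'⟩ := hs.section_of_retraction r hr
  refine ⟨LinearMap.fst S S K ∘ₗ U.subtype ∘ₗ s, fun k => ?_⟩
  have h1 : algebraMap S S' (s k).1.1 = ψ (s k).1.2 := (s k).2
  have h2 : (s k).1.2 = k := LinearMap.congr_fun hs' k
  rw [h2] at h1
  exact h1

/-- degree one Rees lemma -/
theorem QS.rees_one {x : S} (q : QS S S' x) [IsNoetherianRing S] {W F L : Type u}
    [AddCommGroup W] [Module S W]
    [Module S' W] [IsScalarTower S S' W] [AddCommGroup F] [Module S F]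
    [Module S' F] [IsScalarTower S S' F] [AddCommGroup L] [Module S L]
    [Module S' L] [IsScalarTower S S' L] [Module.Finite S F] {f : W →ₗ[S'] F} {g : F →ₗ[S'] L}
    (hs : IsSES f g) (h : EV S L S 2) (φ : W →ₗ[S'] S') : ∃ l : F →ₗ[S'] S', l ∘ₗ f = φ := by
  obtain ⟨K0, P, k0, p, hp, _, _, _⟩ := exists_syz S F
  have hgp : Function.Surjective (g.restrictScalars S ∘ₗ p) := hs.2.1.comp hp.2.1
  have hK := IsSES.ker _ hgp
  have hKE := (hK.ev_shift (N := S) (n := 1) le_rfl).2 h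
  have hsS : IsSES (f.restrictScalars S) (g.restrictScalars S) :=
    IsSES.mk' hs.1 hs.2.1 hs.apply_zero hs.exists_of
  obtain ⟨θ, hθ⟩ := hsS.lift (p ∘ₗ (LinearMap.ker (g.restrictScalars S ∘ₗ p)).subtype)
    (fun m => m.2)
  have hθ' : ∀ m, f (θ m) = p m.1 := LinearMap.congr_fun hθ
  obtain ⟨ψ, hψ⟩ := q.lift_of_ev hKE (φ.restrictScalars S ∘ₗ θ)
  have hψ' : ∀ m, algebraMap S S' (ψ m) = φ (θ m) := hψ
  let xm : P →ₗ[S] LinearMap.ker (g.restrictScalars S ∘ₗ p) :=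
    LinearMap.codRestrict _ (x • LinearMap.id) (fun m => by
      rw [LinearMap.mem_ker]; simp [q.x_smul])
  have hd : ∀ m, ∃ t, ψ (xm m) = x * t := fun m => by
    rw [← q.ker, hψ']
    have : θ (xm m) = 0 := hs.1 (by
      rw [hθ', map_zero]
      change p (x • m) = 0
      rw [map_smul, q.x_smul])
    rw [this, map_zero]
  obtain ⟨ρ, hρ⟩ := q.ses_ring.lift (ψ ∘ₗ xm) (fun m => by
    obtain ⟨t, ht⟩ := hd m
    rw [LinearMap.comp_apply, ht]
    exact (q.ker _).2 ⟨t, rfl⟩)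
  have hρ' : ∀ m, x * ρ m = ψ (xm m) := LinearMap.congr_fun hρ
  have hρK : ∀ m : LinearMap.ker (g.restrictScalars S ∘ₗ p), ρ m.1 = ψ m := fun m => by
    apply (mul_cancel_left_mem_nonZeroDivisors q.nzd).1
    rw [hρ', ← smul_eq_mul x (ψ m), ← map_smul]
    rfl
  obtain ⟨l, hl⟩ := hp.desc (Algebra.linearMap S S' ∘ₗ ρ) (fun a => by
    have ha : k0 a ∈ LinearMap.ker (g.restrictScalars S ∘ₗ p) := by
      rw [LinearMap.mem_ker, LinearMap.comp_apply, hp.apply_zero, map_zero]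
    have h1 := hρK ⟨_, ha⟩
    have h2 : θ ⟨_, ha⟩ = 0 := hs.1 (by rw [hθ', map_zero]; exact hp.apply_zero a)
    change algebraMap S S' (ρ (k0 a)) = 0
    change ρ (k0 a) = _ at h1
    rw [h1, hψ', h2, map_zero])
  refine ⟨upLin q.surj l, ?_⟩
  ext w
  obtain ⟨m, hm⟩ := hp.2.1 (f w)
  have ha : m ∈ LinearMap.ker (g.restrictScalars S ∘ₗ p) := by
    rw [LinearMap.mem_ker, LinearMap.comp_apply, hm]; exact hs.apply_zero w
  have h1 := hρK ⟨_, ha⟩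
  have h2 : θ ⟨_, ha⟩ = w := hs.1 (by rw [hθ']; exact hm)
  rw [LinearMap.comp_apply, upLin_apply, ← hm]
  have h3 := LinearMap.congr_fun hl m
  change l (p m) = algebraMap S S' (ρ m) at h3
  change ρ m = _ at h1
  rw [h3, h1, hψ', h2]

theorem QS.ev_proj {x : S} (q : QS S S' x) (F : Type u) [AddCommGroup F] [Module S F]
    [Module S' F] [IsScalarTower S S' F] [Module.Finite S' F] [Module.Projective S' F] {i : ℕ}
    (hi : 2 ≤ i) : EV S F S i := by
  obtain ⟨k, f, hf⟩ := Module.Finite.exists_fin' S' F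
  obtain ⟨s, hs⟩ := Module.projective_lifting_property f LinearMap.id hf
  refine EV.retract (M' := Fin k → S') (s.restrictScalars S) (f.restrictScalars S)
    (LinearMap.ext fun z => LinearMap.congr_fun hs z) ?_
  obtain ⟨j, rfl⟩ : ∃ j, i = j + 1 := ⟨i - 1, by omega⟩
  have h1 : EV S S' S (j+1) := (q.ses_ring.ev_shift (n := j) (by omega)).1 (EV.proj S (by omega))
  clear hs s hf f
  induction k with
  | zero => exact EV.subsingleton
  | succ k ih => exact EV.iso (Fin.consLinearEquiv S (fun _ : Fin (k+1) => S')).symm (h1.prod ih)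

/-- Rees' lemma -/
theorem QS.rees {x : S} (q : QS S S' x) [IsNoetherianRing S] {i : ℕ} (L : Type u)
    [AddCommGroup L] [Module S L] [Module S' L] [IsScalarTower S S' L] [Module.Finite S' L]
    (h : EV S L S (i + 2)) : EV S' L S' (i + 1) := by
  induction i generalizing L with
  | zero =>
    have := q.noeth
    obtain ⟨W, F, f, g, hs, _, _, _⟩ := exists_syz S' L
    let _ : Module S W := Module.compHom W (algebraMap S S')
    have : IsScalarTower S S' W := ⟨fun a b c => by
      rw [Algebra.smul_def, mul_smul]; rfl⟩
    let _ : Module S F := Module.compHom F (algebraMap S S')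
    have : IsScalarTower S S' F := ⟨fun a b c => by
      rw [Algebra.smul_def, mul_smul]; rfl⟩
    have := q.fin F
    rw [hs.ev_one]
    exact q.rees_one hs h
  | succ i ih =>
    have := q.noeth
    obtain ⟨W, F, f, g, hs, _, _, _⟩ := exists_syz S' L
    let _ : Module S W := Module.compHom W (algebraMap S S')
    have : IsScalarTower S S' W := ⟨fun a b c => by
      rw [Algebra.smul_def, mul_smul]; rfl⟩
    let _ : Module S F := Module.compHom F (algebraMap S S')
    have : IsScalarTower S S' F := ⟨fun a b c => by
      rw [Algebra.smul_def, mul_smul]; rfl⟩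
    have hsS : IsSES (f.restrictScalars S) (g.restrictScalars S) :=
      IsSES.mk' hs.1 hs.2.1 hs.apply_zero hs.exists_of
    rw [← hs.ev_shift (by omega)]
    exact ih W (hsS.ev_left (q.ev_proj F (by omega)) h)

theorem QS.good {x : S} (q : QS S S' x) [Nontrivial S'] (h : Good S) : Good S' := by
  have := h.loc
  have := h.noeth
  have := q.noeth
  have hl : IsLocalRing S' := IsLocalRing.of_surjective' _ q.surj
  have hxm := q.mem_max
  refine ⟨hl, this, ?_, ?_⟩
  · obtain ⟨n, hn⟩ := h.bdd
    refine ⟨n + 1, fun L hL i hi => ?_⟩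
    let _ : Module S L := Module.compHom L (algebraMap S S')
    have : IsScalarTower S S' L := ⟨fun a b c => by
      rw [Algebra.smul_def, mul_smul]; rfl⟩
    have := q.fin L
    obtain ⟨j, rfl⟩ : ∃ j, i = j + 1 := ⟨i - 1, by omega⟩
    exact q.rees L (hn (ModuleCat.of S L) this (j+2) (by omega))
  · intro 𝒳 hX M F N f g hs _ _ hMG hNG hM
    have := hMG.1
    let _ : Module S M := Module.compHom M (algebraMap S S')
    have : IsScalarTower S S' M := ⟨fun a b c => by
      rw [Algebra.smul_def, mul_smul]; rfl⟩
    have := q.fin M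
    obtain ⟨K, P, k, p, hkp, _, _, _⟩ := exists_syz S M
    obtain ⟨W, j, v, i, t, h1, h2⟩ := q.eisenbud hkp
    have hWX : W ∈ 𝒳 := hX.syz h2 hM
    have hWG : GG S' W := GG.left h2 (GG.proj _) hMG
    have hUX : ModuleCat.of S' (S' ⊗[S] K) ∈ 𝒳 := hX.ext h1 hM hWX
    have hKG : GG S K := q.GG_up hxm (regular_of_injective hkp.1 (proj_regular P q.nzd))
      (GG.mid h1 hMG hWG)
    obtain ⟨F1, K', a, b, hab, _, _, hK'⟩ := hKG.cosyz h.hloc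
    have hK'X := h.cosyz _ (resolving_up q h.hloc hX) K F1 K' a b hab ‹_› ‹_› hKG hK' ⟨hKG, hUX⟩
    obtain ⟨E, i1, p1, i2, p2, hE1, hE2, -⟩ := hs.pushout h1
    have hEX : E ∈ 𝒳 := hX.ext hE1 hX.proj hWX
    obtain ⟨V, i3, p3, i4, p4, hV1, hV2, -⟩ := hE2.pushout (q.ses hab (hK'.regular h.hloc q.nzd))
    have hVX : V ∈ 𝒳 := hX.ext hV1 hEX hK'X.2
    obtain ⟨r, hr⟩ := hV2.retraction_of_ev (hNG.coproj _ le_rfl)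
    obtain ⟨s, hs'⟩ := hV2.section_of_retraction r hr
    exact hX.retract s p4 hs' hVX

end ci
end ResolvPaper
namespace ResolvPaper

section cix
open TensorProduct

/-- abstract complete intersections -/
inductive CIx : ∀ (S : Type u), CommRing S → Prop
  | reg (S : Type u) [i : CommRing S] [IsLocalRing S] (h : IsRegLocalRing S) : CIx S i
  | quot (S S' : Type u) [i : CommRing S] [i' : CommRing S'] [Algebra S S'] [Nontrivial S'] (x : S)
      (q : QS S S' x) (h : CIx S i) : CIx S' i'

theorem CIx.good {S : Type u} {i : CommRing S} (h : CIx S i) : Good S := by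
  induction h with
  | reg S h => exact Good.of_reg S h
  | quot S S' x q _ ih => exact q.good ih

theorem IsRegLocalRing.equiv {S T : Type u} [CommRing S] [IsLocalRing S] [CommRing T] [IsLocalRing T]
    (e : S ≃+* T) (h : IsRegLocalRing S) : IsRegLocalRing T := by
  obtain ⟨h1, s, hs, hd⟩ := h
  classical
  refine ⟨isNoetherianRing_of_ringEquiv S e, s.image e, ?_, ?_⟩
  · rw [Finset.coe_image, ← IsLocalRing.map_maximalIdeal_of_surjective e.toRingHom e.surjective, ← hs,
      Ideal.map_span]
    rfl
  · rw [Finset.card_image_of_injective _ e.injective, ← hd, ringKrullDim_eq_of_ringEquiv e]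

theorem CIx.equiv {S T : Type u} {i : CommRing S} [j : CommRing T]
    (e : S ≃+* T) (h : CIx S i) : CIx T j := by
  cases h with
  | reg S h =>
    have : Nontrivial T := e.injective.nontrivial
    have : IsLocalRing T := IsLocalRing.of_surjective' e.toRingHom e.surjective
    exact CIx.reg T (h.equiv e)
  | quot S _ x q h =>
    have : Nontrivial T := e.injective.nontrivial
    let _ : Algebra S T := (e.toRingHom.comp (algebraMap _ _)).toAlgebra
    refine CIx.quot S T x ⟨?_, ?_, q.nzd⟩ h
    · exact e.surjective.comp q.surj
    · intro s
      rw [← q.ker s]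
      exact map_eq_zero_iff e e.injective


theorem CIx.list (n : ℕ) : ∀ {S : Type u} [i : CommRing S] (_ : CIx S i) (T : Type u)
    [j : CommRing T] [Nontrivial T] (f : S →+* T) (rs : List S), rs.length = n →
    Function.Surjective f → RingHom.ker f = Ideal.ofList rs →
    RingTheory.Sequence.IsWeaklyRegular S rs → CIx T j := by
  induction n with
  | zero =>
    intro S _ h T _ _ f rs hn hf hk _
    obtain rfl := List.length_eq_zero_iff.1 hn
    rw [Ideal.ofList_nil] at hk
    exact h.equiv (RingEquiv.ofBijective f ⟨(RingHom.injective_iff_ker_eq_bot f).2 hk, hf⟩)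
  | succ n ih =>
    intro S _ h T _ _ f rs hn hf hk hr
    cases rs with
    | nil => simp at hn
    | cons x rs =>
      rw [RingTheory.Sequence.isWeaklyRegular_cons_iff'] at hr
      obtain ⟨hx, hr⟩ := hr
      have hx' : x ∈ nonZeroDivisors S := by
        rw [mem_nonZeroDivisors_iff_right]
        intro z hz
        exact hx (by simpa [mul_comm] using hz)
      have hfx : ∀ a ∈ Ideal.span {x}, f a = 0 := by
        intro a ha
        rw [← RingHom.mem_ker, hk, Ideal.ofList_cons]
        exact Ideal.mem_sup_left ha
      let f' : S ⧸ Ideal.span {x} →+* T := Ideal.Quotient.lift _ f hfx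
      have hf' : Function.Surjective f' := Ideal.Quotient.lift_surjective_of_surjective _ _ hf
      have hnt : Nontrivial (S ⧸ Ideal.span {x}) := f'.domain_nontrivial
      have h' : CIx (S ⧸ Ideal.span {x}) _ := CIx.quot S _ x (QS.mk' hx') h
      refine ih h' T f' (rs.map (Ideal.Quotient.mk _)) (by simpa using hn) hf' ?_ ?_
      · rw [← Ideal.map_ofList]
        ext a
        obtain ⟨a, rfl⟩ := Ideal.Quotient.mk_surjective a
        rw [RingHom.mem_ker]
        change f a = 0 ↔ _
        rw [← RingHom.mem_ker, hk, Ideal.ofList_cons, sup_comm, ← Ideal.mem_quotient_iff_mem_sup]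
      · have e : QuotSMulTop x S ≃ₗ[S] (S ⧸ Ideal.span {x}) :=
          Submodule.quotEquivOfEq _ _ (by
            ext a
            rw [Submodule.mem_smul_pointwise_iff_exists, Ideal.mem_span_singleton]
            exact ⟨fun ⟨b, _, hb⟩ => ⟨b, hb.symm⟩, fun ⟨b, hb⟩ => ⟨b, trivial, hb.symm⟩⟩)
        rw [← Ideal.Quotient.algebraMap_eq,
          RingTheory.Sequence.isWeaklyRegular_map_algebraMap_iff] at hr ⊢
        exact (e.isWeaklyRegular_congr rs).1 hr

/-- Nakayama for Ext. -/
theorem EV_nak_ses {S : Type u} [CommRing S] [IsNoetherianRing S] [IsLocalRing S] {y : S}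
    (hy : y ∈ IsLocalRing.maximalIdeal S) {A C N : Type u} [AddCommGroup A] [Module S A]
    [AddCommGroup C] [Module S C] [AddCommGroup N] [Module S N] [Module.Finite S A]
    [Module.Finite S N] {g : A →ₗ[S] C} (hs : IsSES (y • LinearMap.id : A →ₗ[S] A) g) {i : ℕ}
    (h : EV S C N (i+1)) : EV S A N i := by
  have hfin : Module.Finite S (XT S A N i) := finite_XT
  have key : (⊤ : Submodule S (XT S A N i)) ≤ IsLocalRing.maximalIdeal S • ⊤ := by
    intro e _
    obtain ⟨e', he'⟩ := hs.ex1 e (h _)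
    rw [← XT.smul_eq_pre] at he'
    rw [← he']
    exact Submodule.smul_mem_smul hy trivial
  have := Submodule.eq_bot_of_le_smul_of_le_jacobson_bot _ _ hfin.1 key
    (IsLocalRing.jacobson_eq_maximalIdeal ⊥ bot_ne_top).ge
  intro e
  have : e ∈ (⊤ : Submodule S (XT S A N i)) := trivial
  simpa [*] using this

theorem quot_prime_ses {S : Type u} [CommRing S] (P : Ideal S) [P.IsPrime] {y : S} (hy : y ∉ P) :
    IsSES (y • LinearMap.id : (S ⧸ P) →ₗ[S] (S ⧸ P))
      (LinearMap.range (y • LinearMap.id : (S ⧸ P) →ₗ[S] (S ⧸ P))).mkQ := by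
  refine IsSES.mk' ?_ (Submodule.mkQ_surjective _) (fun a => ?_) (fun a ha => ?_)
  · rw [injective_iff_map_eq_zero]
    intro a ha
    obtain ⟨a, rfl⟩ := Ideal.Quotient.mk_surjective a
    have : Ideal.Quotient.mk P (y * a) = 0 := ha
    rw [Ideal.Quotient.eq_zero_iff_mem] at this ⊢
    exact (Ideal.IsPrime.mem_or_mem ‹_› this).resolve_left hy
  · rw [Submodule.mkQ_apply, Submodule.Quotient.mk_eq_zero]
    exact ⟨a, rfl⟩
  · rwa [Submodule.mkQ_apply, Submodule.Quotient.mk_eq_zero] at ha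

theorem artin_lemma (S : Type u) [CommRing S] [IsLocalRing S] [IsNoetherianRing S]
    (hb : ∃ n, ∀ L : ModuleCat.{u} S, Module.Finite S L → ∀ i, n < i → EV S L S i)
    (a : S) (ha : a ≠ 0) (hma : ∀ y ∈ IsLocalRing.maximalIdeal S, y * a = 0) :
    (∀ L : ModuleCat.{u} S, Module.Finite S L → ∀ i, 0 < i → EV S L S i) ∧
    IsNilpotent (IsLocalRing.maximalIdeal S) := by
  let m := IsLocalRing.maximalIdeal S
  let j : (S ⧸ m) →ₗ[S] S := m.liftQ (LinearMap.toSpanSingleton S S a) (fun y hy => by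
    simpa using hma y hy)
  have hj1 : ∀ s, j (Ideal.Quotient.mk m s) = s * a := fun s => rfl
  have hj : Function.Injective j := by
    rw [injective_iff_map_eq_zero]
    intro z hz
    obtain ⟨z, rfl⟩ := Ideal.Quotient.mk_surjective z
    rw [hj1] at hz
    rw [Ideal.Quotient.eq_zero_iff_mem]
    by_contra hzm
    have hu : IsUnit z := by
      by_contra hu; exact hzm hu
    exact ha (hu.mul_right_eq_zero.1 hz)
  have hk := IsSES.quot (LinearMap.range j)
  have e : (S ⧸ m) ≃ₗ[S] LinearMap.range j := LinearEquiv.ofInjective j hj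
  obtain ⟨n, hn⟩ := hb
  have main : ∀ L : ModuleCat.{u} S, Module.Finite S L → ∀ i, 0 < i → EV S L S i := by
    induction n with
    | zero => exact hn
    | succ n ih =>
      apply ih
      intro L hL i hi
      rcases lt_or_eq_of_le (show n + 1 ≤ i from hi) with h | rfl
      · exact hn L hL i h
      refine IsNoetherianRing.induction_on_isQuotientEquivQuotientPrime S (M := L) hL
        (motive := fun N _ _ _ => EV S N S (n+1)) ?_ ?_ ?_
      · intro N _ _ _ _
        exact EV.subsingleton
      · intro N _ _ _ P e'
        refine EV.iso e' ?_
        have := P.2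
        by_cases hP : P.1 = m
        · rw [hP]
          refine EV.iso e ?_
          exact hk.ev_left (EV.proj S (by omega))
            (hn (ModuleCat.of S (S ⧸ LinearMap.range j)) inferInstance _ (by omega))
        · obtain ⟨y, hy, hyP⟩ : ∃ y ∈ m, y ∉ P.1 := by
            by_contra! h
            exact hP ((IsLocalRing.maximalIdeal.isMaximal S).eq_of_le P.2.ne_top h).symm
          exact EV_nak_ses hy (quot_prime_ses P.1 hyP)
            (hn (ModuleCat.of S (_ ⧸ _)) inferInstance _ (by omega))
      · intro N1 _ _ _ N2 _ _ _ N3 _ _ _ f g hf hg hfg h1 h3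
        have : IsSES f g := ⟨hf, hg, (LinearMap.exact_iff.1 hfg).symm⟩
        exact this.ev_mid h1 h3
  refine ⟨main, ?_⟩
  have hall : ∀ P : Ideal S, P.IsPrime → P = m := by
    intro P hP
    by_contra hPm
    obtain ⟨y, hy, hyP⟩ : ∃ y ∈ m, y ∉ P := by
      by_contra! h
      exact hPm ((IsLocalRing.maximalIdeal.isMaximal S).eq_of_le hP.ne_top h).symm
    have h0 : EV S (S ⧸ P) S 0 := EV_nak_ses hy (quot_prime_ses P hyP)
      (main (ModuleCat.of S (_ ⧸ _)) inferInstance _ (by omega))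
    let t : (S ⧸ P) →ₗ[S] S := P.liftQ (LinearMap.toSpanSingleton S S a) (fun y hy => by
      simpa using hma y (IsLocalRing.le_maximalIdeal hP.ne_top hy))
    have h1 : t = 0 := by
      rw [← (XT.zeroEquiv (S := S) (S ⧸ P) S).apply_symm_apply t,
        show (XT.zeroEquiv (S := S) (S ⧸ P) S).symm t = 0 from h0 _, map_zero]
    have h2 : t (Ideal.Quotient.mk P 1) = 1 * a := rfl
    rw [h1, one_mul] at h2
    exact ha h2.symm
  have : m = nilradical S := by
    rw [nilradical_eq_sInf]
    apply le_antisymm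
    · exact le_sInf fun P hP => (hall P hP).ge
    · exact sInf_le (IsLocalRing.maximalIdeal.isMaximal S).isPrime
  change IsNilpotent m
  rw [this]
  exact IsNoetherianRing.isNilpotent_nilradical S

end cix
end ResolvPaper
namespace ResolvPaper

section cif
open TensorProduct IsLocalRing Pointwise

/-- formally complete intersection -/
def CIF (S : Type u) [CommRing S] [IsLocalRing S] : Prop :=
  ∃ (T : Type u) (i : CommRing T) (_ : IsLocalRing T) (_ : Algebra S T), CIx T i ∧ Module.Flat S T ∧
    (maximalIdeal S).map (algebraMap S T) = maximalIdeal T ∧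
    ∀ t : T, ∃ s : S, t - algebraMap S T s ∈ maximalIdeal T

theorem CIF.of (S : Type u) [CommRing S] [IsLocalRing S] [IsNoetherianRing S]
    (h : IsCompleteIntersectionLocalRing S) : CIF S := by
  obtain ⟨Q, _, _, rs, hQ, hrs, ⟨e⟩⟩ := h
  refine ⟨AdicCompletion (maximalIdeal S) S, inferInstance, inferInstance, inferInstance, ?_,
    inferInstance, (AdicCompletion.maximalIdeal_eq_map (R := S)).symm, ?_⟩
  · refine CIx.list _ (CIx.reg Q hQ) _ (e.symm.toRingHom.comp (Ideal.Quotient.mk _)) rs rfl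
      (e.symm.surjective.comp Ideal.Quotient.mk_surjective) ?_ hrs.toIsWeaklyRegular
    ext a
    rw [RingHom.mem_ker, ← Ideal.Quotient.eq_zero_iff_mem]
    exact map_eq_zero_iff e.symm e.symm.injective
  · intro t
    obtain ⟨s, hs⟩ := (AdicCompletion.residueField_map_bijective (R := S)).2 (residue _ t)
    obtain ⟨s, rfl⟩ := residue_surjective s
    refine ⟨s, ?_⟩
    rw [← residue_eq_zero_iff, map_sub, sub_eq_zero, ← hs]
    rfl

theorem CIF.quot {S : Type u} [CommRing S] [IsLocalRing S] [IsNoetherianRing S] (h : CIF S)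
    {S' : Type u} [CommRing S'] [IsLocalRing S'] [Algebra S S'] {x : S} (q : QS S S' x) : CIF S' := by
  obtain ⟨T, _, _, _, hT, _, hm, hr⟩ := h
  let _ : Algebra T (S' ⊗[S] T) := Algebra.TensorProduct.rightAlgebra
  have hal : ∀ t : T, algebraMap T (S' ⊗[S] T) t = 1 ⊗ₜ t := fun t => rfl
  have hcomm : (algebraMap S' (S' ⊗[S] T)).comp (algebraMap S S') =
      (algebraMap T (S' ⊗[S] T)).comp (algebraMap S T) := by
    ext s
    simp only [RingHom.comp_apply, hal]
    rw [Algebra.algebraMap_eq_smul_one (R := S) (A := T), ← TensorProduct.smul_tmul,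
      ← Algebra.algebraMap_eq_smul_one]
    rfl
  have hq : QS T (S' ⊗[S] T) (algebraMap S T x) := by
    refine ⟨fun z => ?_, fun t => ?_, ?_⟩
    · obtain ⟨t, ht⟩ := q.mk_surj T z
      exact ⟨t, ht⟩
    · rw [hal, q.mk_zero]
      simp [Algebra.smul_def]
    · rw [mem_nonZeroDivisors_iff_right]
      intro z hz
      have h1 : IsSMulRegular S x := fun a b hab =>
        (mul_cancel_left_mem_nonZeroDivisors q.nzd).1 hab
      have h2 : IsSMulRegular T (algebraMap S T x) := h1.of_flat
      exact h2 (by simpa [mul_comm] using hz)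
  have hxm := q.mem_max
  have hnt : Nontrivial (S' ⊗[S] T) := by
    refine ⟨⟨0, 1, fun h01 => ?_⟩⟩
    have : (1 : S') ⊗ₜ[S] (1 : T) = 0 := h01.symm
    rw [q.mk_zero] at this
    obtain ⟨n, hn⟩ := this
    have h1 : algebraMap S T x ∈ maximalIdeal T := hm ▸ Ideal.mem_map_of_mem _ hxm
    rw [Algebra.smul_def] at hn
    exact (Ideal.ne_top_iff_one _).1 (maximalIdeal.isMaximal T).ne_top
      (hn ▸ Ideal.mul_mem_right _ _ h1)
  have hl : IsLocalRing (S' ⊗[S] T) := IsLocalRing.of_surjective' _ hq.surj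
  refine ⟨S' ⊗[S] T, inferInstance, hl, inferInstance, CIx.quot T _ _ hq hT, inferInstance, ?_, ?_⟩
  · rw [← max_of_surj q.surj, Ideal.map_map, hcomm, ← Ideal.map_map, hm, max_of_surj hq.surj]
  · intro z
    obtain ⟨t, rfl⟩ := hq.surj z
    obtain ⟨s, hs⟩ := hr t
    refine ⟨algebraMap S S' s, ?_⟩
    have := Ideal.mem_map_of_mem (algebraMap T (S' ⊗[S] T)) hs
    rw [max_of_surj hq.surj, map_sub] at this
    have h2 := RingHom.congr_fun hcomm s
    rw [RingHom.comp_apply] at h2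
    rw [h2]
    exact this

/-- reduction to the artinian case by a regular sequence in `J` -/
inductive Red : ℕ → ∀ (S : Type u) [CommRing S], Ideal S → Prop
  | base (S : Type u) [CommRing S] [IsLocalRing S] [IsNoetherianRing S] (J : Ideal S) (h : Good S)
    (hn : IsNilpotent (maximalIdeal S))
    (hE : ∀ L : ModuleCat.{u} S, Module.Finite S L → ∀ i, 0 < i → EV S L S i) : Red 0 S J
  | step (n : ℕ) (S S' : Type u) [CommRing S] [IsLocalRing S] [IsNoetherianRing S] [CommRing S']
    [Algebra S S'] [Nontrivial S'] (x : S) (q : QS S S' x) (J : Ideal S) (hx : x ∈ J)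
    (h : Red n S' (J.map (algebraMap S S'))) : Red (n+1) S J

theorem Red.of_zero (S : Type u) [CommRing S] [IsLocalRing S] [IsNoetherianRing S] (h : CIF S)
    (J : Ideal S) (a : S) (ha : a ≠ 0) (hma : ∀ y ∈ maximalIdeal S, y * a = 0) : Red 0 S J := by
  obtain ⟨T, _, _, _, hT, hflat, hm, hr⟩ := h
  have hloc : IsLocalHom (algebraMap S T) := by
    apply ((IsLocalRing.local_hom_TFAE _).out 0 2).mpr
    exact hm.le
  have hff : Module.FaithfullyFlat S T := Module.FaithfullyFlat.of_flat_of_isLocalHom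
  have hinj : Function.Injective (algebraMap S T) := FaithfulSMul.algebraMap_injective S T
  have := hT.good.noeth
  obtain ⟨-, k, hk⟩ := artin_lemma T hT.good.bdd (algebraMap S T a)
    (by rwa [ne_eq, map_eq_zero_iff _ hinj]) (by
      intro y hy
      have : maximalIdeal T ≤ (Ideal.span {algebraMap S T a}).annihilator := by
        rw [← hm, Ideal.map_le_iff_le_comap]
        intro z hz
        rw [Ideal.mem_comap, Submodule.mem_annihilator_span_singleton, smul_eq_mul, ← map_mul, hma z hz,
          map_zero]
      exact (Submodule.mem_annihilator_span_singleton _ _).1 (this hy))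
  have key : ∀ j : ℕ, ∀ t : T, ∃ s : S, t - algebraMap S T s ∈ maximalIdeal T ^ j := by
    intro j
    induction j with
    | zero => intro t; exact ⟨0, by simp⟩
    | succ j ih =>
      intro t
      obtain ⟨s, hs⟩ := ih t
      have h2 : ∀ z ∈ maximalIdeal T ^ j, ∃ s, z - algebraMap S T s ∈ maximalIdeal T ^ (j+1) := by
        intro z hz
        rw [← hm, ← Ideal.map_pow] at hz
        refine Submodule.span_induction ?_ ?_ ?_ ?_ hz
        · rintro _ ⟨s, -, rfl⟩; exact ⟨s, by simp⟩
        · exact ⟨0, by simp⟩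
        · rintro z1 z2 _ _ ⟨s1, h1⟩ ⟨s2, h2⟩
          refine ⟨s1 + s2, ?_⟩
          rw [map_add, add_sub_add_comm]
          exact add_mem h1 h2
        · rintro t z hz' ⟨s, hs⟩
          obtain ⟨s0, hs0⟩ := hr t
          refine ⟨s0 * s, ?_⟩
          have hz2 : z ∈ maximalIdeal T ^ j := by
            rw [← hm, ← Ideal.map_pow]; exact hz'
          have : t • z - algebraMap S T (s0 * s) = (t - algebraMap S T s0) * z +
              algebraMap S T s0 * (z - algebraMap S T s) := by
            rw [map_mul, smul_eq_mul]; ring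
          rw [this]
          refine add_mem ?_ (Ideal.mul_mem_left _ _ hs)
          rw [pow_succ']
          exact Ideal.mul_mem_mul hs0 hz2
      obtain ⟨s', hs'⟩ := h2 _ hs
      exact ⟨s + s', by rw [map_add, ← sub_sub]; exact hs'⟩
  have hsurj : Function.Surjective (algebraMap S T) := by
    intro t
    obtain ⟨s, hs⟩ := key k t
    rw [hk] at hs
    exact ⟨s, (sub_eq_zero.1 hs).symm⟩
  have hS : CIx S _ := hT.equiv (RingEquiv.ofBijective _ ⟨hinj, hsurj⟩).symm
  obtain ⟨h1, h2⟩ := artin_lemma S hS.good.bdd a ha hma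
  exact Red.base S J hS.good h2 h1

theorem wb_lt {n : ℕ} {d : WithBot ℕ∞} (h : d + 1 < ((n + 1 : ℕ) : WithBot ℕ∞)) :
    d < (n : WithBot ℕ∞) := by
  induction d with
  | bot => exact WithBot.bot_lt_coe _
  | coe d =>
    induction d with
    | top => exact absurd h (not_lt.2 le_top)
    | coe d =>
      have : d + 1 < n + 1 := by exact_mod_cast h
      have : d < n := by omega
      exact_mod_cast this

theorem Red.exists_aux (d : ℕ) : ∀ (S : Type u) [CommRing S] [IsLocalRing S] [IsNoetherianRing S]
    (_ : CIF S) (J : Ideal S) (k : ℕ), maximalIdeal S ^ k ≤ J → J ≤ maximalIdeal S →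
    ringKrullDim S < d → ∃ n, Red n S J := by
  induction d with
  | zero =>
    intro S _ _ _ _ J k _ _ hd
    exact absurd hd (not_lt.2 ringKrullDim_nonneg_of_nontrivial)
  | succ d ih =>
    intro S _ _ _ hS J k hk hJ hd
    by_cases hx : ∃ x ∈ J, x ∈ nonZeroDivisors S
    · obtain ⟨x, hxJ, hx⟩ := hx
      have hnt := local_quot (hJ hxJ)
      have hl : IsLocalRing (S ⧸ Ideal.span {x}) :=
        IsLocalRing.of_surjective' (Ideal.Quotient.mk _) Ideal.Quotient.mk_surjective
      have q := QS.mk' hx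
      have hmm := max_of_surj q.surj
      rw [← ringKrullDim_quotient_span_singleton_succ_eq_ringKrullDim_of_mem_nonZeroDivisors hx
        (hJ hxJ)] at hd
      obtain ⟨n, hn⟩ := ih _ (hS.quot q) (J.map (algebraMap S _)) k
        (by rw [← hmm, ← Ideal.map_pow]; exact Ideal.map_mono hk)
        (by rw [← hmm]; exact Ideal.map_mono hJ) (wb_lt hd)
      exact ⟨n+1, Red.step n S _ x q J hxJ hn⟩
    · push Not at hx
      obtain ⟨P, hP, hJP⟩ := (Ideal.subset_union_prime_finite (f := id) (I := J)
        (associatedPrimes.finite S S) 0 0 fun _ h _ _ ↦ h.isPrime).1 (by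
          simp_rw [id, biUnion_associatedPrimes_eq_compl_nonZeroDivisors]
          exact hx)
      have hPm : P = maximalIdeal S := by
        have := hP.isPrime
        exact ((maximalIdeal.isMaximal S).eq_of_le this.ne_top
          (this.le_of_pow_le (hk.trans hJP))).symm
      have h := hP
      rw [AssociatedPrimes.mem_iff, isAssociatedPrime_iff] at h
      obtain ⟨prime, a, h⟩ := h
      have hmem : ∀ y, y ∈ maximalIdeal S ↔ y * a = 0 := by
        intro y
        rw [← hPm, h]
        simp
      refine ⟨0, Red.of_zero S hS J a ?_ fun y hy => (hmem y).1 hy⟩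
      rintro rfl
      have : (1 : S) ∈ maximalIdeal S := (hmem 1).2 (by simp)
      exact (Ideal.ne_top_iff_one _).1 (maximalIdeal.isMaximal S).ne_top this

theorem Red.exists (S : Type u) [CommRing S] [IsLocalRing S] [IsNoetherianRing S]
    (h : CIF S) (J : Ideal S) (k : ℕ) (hk : maximalIdeal S ^ k ≤ J) (hJ : J ≤ maximalIdeal S) :
    ∃ n, Red n S J := by
  have : ringKrullDim S < ⊤ := ringKrullDim_lt_top
  obtain ⟨d, hd⟩ : ∃ d : ℕ, ringKrullDim S = d := by
    have h0 : 0 ≤ ringKrullDim S := ringKrullDim_nonneg_of_nontrivial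
    induction hr : ringKrullDim S with
    | bot => simp [hr] at h0
    | coe d =>
      induction d with
      | top => rw [hr] at this; exact absurd this (lt_irrefl _)
      | coe d => exact ⟨d, rfl⟩
  exact Red.exists_aux (d+1) S h J k hk hJ (by rw [hd]; exact_mod_cast Nat.lt_succ_self d)

theorem Red.isLocal {n : ℕ} {S : Type u} [CommRing S] {J : Ideal S} (h : Red n S J) :
    IsLocalRing S ∧ IsNoetherianRing S := by
  cases h <;> exact ⟨‹_›, ‹_›⟩

theorem QS.ringEquiv {S S' : Type u} [CommRing S] [CommRing S'] [Algebra S S'] {x : S}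
    (q : QS S S' x) : Nonempty ((S ⧸ Ideal.span {x}) ≃+* S') := by
  have : Ideal.span {x} = RingHom.ker (algebraMap S S') := by
    ext s
    rw [RingHom.mem_ker, q.ker, Ideal.mem_span_singleton]
    rfl
  rw [this]
  exact ⟨RingHom.quotientKerEquivOfSurjective q.surj⟩

theorem Red.dim {n : ℕ} {S : Type u} [CommRing S] {J : Ideal S} (h : Red n S J) :
    ringKrullDim S = n := by
  induction h with
  | base S J _ hn _ =>
    have h1 : (maximalIdeal S).height = 0 := by
      refine Ideal.height_eq_zero_iff.2 ⟨⟨(maximalIdeal.isMaximal S).isPrime, bot_le⟩, ?_⟩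
      rintro P ⟨hP, -⟩ -
      obtain ⟨k, hk⟩ := hn
      exact hP.le_of_pow_le (by rw [hk]; exact bot_le)
    rw [← IsLocalRing.maximalIdeal_height_eq_ringKrullDim, h1]
    rfl
  | step n S S' x q J hx _ ih =>
    obtain ⟨e⟩ := q.ringEquiv
    rw [← ringKrullDim_quotient_span_singleton_succ_eq_ringKrullDim_of_mem_nonZeroDivisors q.nzd
      q.mem_max, ringKrullDim_eq_of_ringEquiv e, ih]
    norm_cast

theorem Red.bdd {n : ℕ} {S : Type u} [CommRing S] {J : Ideal S} (h : Red n S J) :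
    ∀ L : ModuleCat.{u} S, Module.Finite S L → ∀ i, n < i → EV S L S i := by
  induction h with
  | base S J _ hn h => exact h
  | step n S S' x q J hx _ ih =>
    intro L hL i hi
    obtain ⟨K, P, f, g, hs, _, _, _⟩ := exists_syz S L
    obtain ⟨j, rfl⟩ : ∃ j, i = j + 1 := ⟨i - 1, by omega⟩
    rw [← hs.ev_shift (by omega)]
    have hK : IsSMulRegular K x := regular_of_injective hs.1 (proj_regular P q.nzd)
    exact q.EV_up q.mem_max hK (by omega)
      (ih (ModuleCat.of S' (S' ⊗[S] K)) inferInstance j (by omega))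

theorem Red.hloc {n : ℕ} {S : Type u} [CommRing S] {J : Ideal S} (h : Red n S J) : Hloc S :=
  fun _ _ => ⟨n, fun L hL i hi => (h.bdd L hL i hi).tv _⟩

theorem Red.seq {n : ℕ} {S : Type u} [CommRing S] {J : Ideal S} (h : Red n S J) :
    ∃ (rs : List S) (k : ℕ), rs.length = n ∧ (∀ r ∈ rs, r ∈ J) ∧
      (∀ P : Ideal S, P.IsMaximal → P ^ k ≤ Ideal.ofList rs) ∧
      ∀ M : ModuleCat.{u} S, GG S M → RingTheory.Sequence.IsWeaklyRegular M rs := by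
  induction h with
  | base S J _ hn h =>
    obtain ⟨k, hk⟩ := hn
    refine ⟨[], k, rfl, by simp, fun P hP => ?_, fun M _ => RingTheory.Sequence.IsWeaklyRegular.nil _ _⟩
    rw [IsLocalRing.eq_maximalIdeal hP, hk]; exact bot_le
  | step n S S' x q J hx h ih =>
    have hloc := (Red.step n S S' x q J hx h).hloc
    obtain ⟨rs, k, hl, hJ, hk, hr⟩ := ih
    obtain ⟨_, _⟩ := h.isLocal
    have : ∀ r ∈ rs, ∃ s ∈ J, algebraMap S S' s = r := fun r hr => by
      obtain ⟨s, hs, hs'⟩ := (Ideal.mem_map_iff_of_surjective _ q.surj).1 (hJ r hr)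
      exact ⟨s, hs, hs'⟩
    have hss : ∃ ss : List S, (∀ s ∈ ss, s ∈ J) ∧ ss.map (algebraMap S S') = rs := by
      clear hr hk hl hJ
      induction rs with
      | nil => exact ⟨[], by simp, rfl⟩
      | cons r rs ih2 =>
        obtain ⟨ss, h1, h2⟩ := ih2 (fun r hr => this r (by simp [hr]))
        obtain ⟨s, h3, h4⟩ := this r (by simp)
        exact ⟨s :: ss, by simpa using ⟨h3, h1⟩, by simp [h2, h4]⟩
    obtain ⟨ss, hssJ, rfl⟩ := hss
    refine ⟨x :: ss, k, by simpa using hl, by simpa using ⟨hx, hssJ⟩, fun P hP => ?_, fun M hM => ?_⟩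
    · have h1 := hk (maximalIdeal S') inferInstance
      rw [IsLocalRing.eq_maximalIdeal hP]
      rw [← max_of_surj q.surj, ← Ideal.map_pow, ← Ideal.map_ofList, Ideal.map_le_iff_le_comap,
        Ideal.comap_map_of_surjective _ q.surj] at h1
      refine h1.trans ?_
      rw [Ideal.ofList_cons, sup_comm]
      refine sup_le_sup_right ?_ _
      intro s hs
      obtain ⟨t, rfl⟩ := (q.ker s).1 (by simpa using hs)
      exact Ideal.mul_mem_right _ _ (Ideal.mem_span_singleton_self x)
    · have hreg := hM.regular hloc q.nzd
      refine RingTheory.Sequence.IsWeaklyRegular.cons hreg ?_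
      have h2 := hr (ModuleCat.of S' (S' ⊗[S] M)) (q.GG_down hreg hM)
      have h3 : RingTheory.Sequence.IsWeaklyRegular (S' ⊗[S] M) (ss.map (algebraMap S S')) := h2
      rw [RingTheory.Sequence.isWeaklyRegular_map_algebraMap_iff] at h3
      have hker : x • (⊤ : Submodule S M) = LinearMap.ker (TensorProduct.mk S S' M 1) := by
        ext m
        rw [LinearMap.mem_ker, Submodule.mem_smul_pointwise_iff_exists]
        change _ ↔ 1 ⊗ₜ m = 0
        rw [q.mk_zero]
        exact ⟨fun ⟨b, _, hb⟩ => ⟨b, hb.symm⟩, fun ⟨b, hb⟩ => ⟨b, trivial, hb.symm⟩⟩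
      let e : QuotSMulTop x M ≃ₗ[S] S' ⊗[S] M := (Submodule.quotEquivOfEq _ _ hker).trans
        (LinearMap.quotKerEquivOfSurjective (TensorProduct.mk S S' M 1) (q.mk_surj M))
      exact (e.isWeaklyRegular_congr ss).2 h3

end cif
end ResolvPaper
namespace ResolvPaper

section sz
open TensorProduct
variable {S : Type u} [CommRing S]
variable {A B C L U X : Type u} [AddCommGroup A] [Module S A] [AddCommGroup B] [Module S B]
  [AddCommGroup C] [Module S C] [AddCommGroup L] [Module S L] [AddCommGroup X] [Module S X]
  [AddCommGroup U] [Module S U]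

/-- first syzygies are in `𝒳` -/
def Sz (𝒳 : Set (ModuleCat.{u} S)) (L : Type u) [AddCommGroup L] [Module S L] : Prop :=
  ∃ (K P : ModuleCat.{u} S) (k : K →ₗ[S] P) (p : P →ₗ[S] L), IsSES k p ∧ Module.Finite S P ∧
    Module.Projective S P ∧ K ∈ 𝒳

variable {𝒳 : Set (ModuleCat.{u} S)} (hX : IsResolving S 𝒳)
include hX

theorem Sz.iso (e : A ≃ₗ[S] B) (h : Sz 𝒳 A) : Sz 𝒳 B := by
  obtain ⟨K, P, k, p, hs, h1, h2, h3⟩ := h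
  exact ⟨K, P, k, e.toLinearMap ∘ₗ p, IsSES.mk' hs.1 (e.surjective.comp hs.2.1)
    (fun a => by simp [hs.apply_zero]) (fun b hb => hs.exists_of b (by simpa using hb)), h1, h2, h3⟩

theorem Sz.mid {f : A →ₗ[S] B} {g : B →ₗ[S] C} (hs : IsSES f g) (hA : Sz 𝒳 A) (hC : Sz 𝒳 C) :
    Sz 𝒳 B := by
  obtain ⟨K, P, k, p, hs1, _, _, h1⟩ := hA
  obtain ⟨K2, P2, k2, p2, hs2, _, _, h2⟩ := hC
  obtain ⟨E, a, b, c, d, h3, h4⟩ := hs.horseshoe hs1 hs2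
  exact ⟨E, ModuleCat.of S (P × P2), a, b, h3, inferInstanceAs (Module.Finite S (P × P2)),
    inferInstanceAs (Module.Projective S (P × P2)), hX.ext h4 h1 h2⟩

theorem Sz.left [IsNoetherianRing S] [Module.Finite S A] {f : A →ₗ[S] B} {g : B →ₗ[S] C}
    (hs : IsSES f g) (hB : Sz 𝒳 B) (hC : Sz 𝒳 C) : Sz 𝒳 A := by
  obtain ⟨K, P, k, p, hs1, _, _, _⟩ := exists_syz S A
  obtain ⟨K1, P1, k1, p1, hs1', _, _, h1⟩ := hB
  obtain ⟨K2, P2, k2, p2, hs2, _, _, h2⟩ := hC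
  obtain ⟨E, a, b, c, d, h3, h4⟩ := hs.horseshoe hs1 hs2
  have hE := hX.syz_indep hs1' h3 h1
  exact ⟨K, P, k, p, hs1, ‹_›, ‹_›, hX.ker h4 hE h2⟩

theorem Sz.fst [IsNoetherianRing S] [Module.Finite S A] [Module.Finite S B] (h : Sz 𝒳 (A × B)) :
    Sz 𝒳 A := by
  obtain ⟨K, P, k, p, hs1, _, _, _⟩ := exists_syz S A
  obtain ⟨K1, P1, k1, p1, hs1', _, _, _⟩ := exists_syz S B
  obtain ⟨K2, P2, k2, p2, hs2, _, _, h2⟩ := h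
  exact ⟨K, P, k, p, hs1, ‹_›, ‹_›, hX.fst (hX.syz_indep hs2 (hs1.prodMap hs1') h2)⟩

theorem Sz.kerX {f : U →ₗ[S] X} {g : X →ₗ[S] C} (hs : IsSES f g)
    (h : ModuleCat.of S X ∈ 𝒳) (hC : Sz 𝒳 C) : ModuleCat.of S U ∈ 𝒳 := by
  obtain ⟨K2, P2, k2, p2, hs2, _, _, h2⟩ := hC
  obtain ⟨E, a, b, c, d, h3, h4, -⟩ := hs.pullback hs2
  have hE : E ∈ 𝒳 := hX.ext h4 h2 h
  obtain ⟨e, -⟩ := h3.equiv_of_proj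
  exact hX.fst (hX.iso e hE)

theorem Sz.right [IsNoetherianRing S] {f : A →ₗ[S] B} {g : B →ₗ[S] C} (hs : IsSES f g)
    (hA : ModuleCat.of S A ∈ 𝒳) (hB : ModuleCat.of S B ∈ 𝒳) : Sz 𝒳 C := by
  have := hX.fin hB
  obtain ⟨K, P, k, p, hs1, _, _, _⟩ := exists_syz S B
  obtain ⟨K2, i2, j, q, h1, h2⟩ := hs.lemZ hs1
  exact ⟨K2, P, i2, _, h1, ‹_›, ‹_›, hX.ext h2 (hX.syz hs1 hB) hA⟩

variable {S' : Type u} [CommRing S'] [Algebra S S'] {x : S} (q : QS S S' x)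

omit hX in
include q in
theorem QS.ev_proj' (F : Type u) [AddCommGroup F] [Module S F]
    [Module S' F] [IsScalarTower S S' F] [Module.Finite S' F] [Module.Projective S' F] {i : ℕ}
    (hi : 2 ≤ i) : EV S F U i := by
  obtain ⟨k, f, hf⟩ := Module.Finite.exists_fin' S' F
  obtain ⟨s, hs⟩ := Module.projective_lifting_property f LinearMap.id hf
  refine EV.retract (M' := Fin k → S') (s.restrictScalars S) (f.restrictScalars S)
    (LinearMap.ext fun z => LinearMap.congr_fun hs z) ?_
  obtain ⟨j, rfl⟩ : ∃ j, i = j + 1 := ⟨i - 1, by omega⟩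
  have h1 : EV S S' U (j+1) := (q.ses_ring.ev_shift (n := j) (by omega)).1 (EV.proj S (by omega))
  clear hs s hf f
  induction k with
  | zero => exact EV.subsingleton
  | succ k ih => exact EV.iso (Fin.consLinearEquiv S (fun _ : Fin (k+1) => S')).symm (h1.prod ih)

include q in
theorem Sz.proj [IsNoetherianRing S] (F : Type u) [AddCommGroup F] [Module S F]
    [Module S' F] [IsScalarTower S S' F] [Module.Finite S' F] [Module.Projective S' F] : Sz 𝒳 F := by
  have := q.fin F
  obtain ⟨K, P, k, p, hs, _, _, _⟩ := exists_syz S F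
  obtain ⟨K1, P1, k1, p1, hs1, _, _, _⟩ := exists_syz S K
  have : EV S K K1 1 := (hs.ev_shift le_rfl).2 (q.ev_proj' F le_rfl)
  obtain ⟨r, hr⟩ := hs1.retraction_of_ev this
  obtain ⟨s, hs'⟩ := hs1.section_of_retraction r hr
  have : Module.Projective S K := Module.Projective.of_split s p1 hs'
  exact ⟨K, P, k, p, hs, ‹_›, ‹_›, hX.proj (P := K)⟩

omit hX

/-- the induced class over `S'` -/
def SzUp (𝒳 : Set (ModuleCat.{u} S)) (S' : Type u) [CommRing S'] [Algebra S S'] :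
    Set (ModuleCat.{u} S') :=
  {L | GG S' L ∧ @Sz S _ 𝒳 L _ (Module.compHom L (algebraMap S S'))}

theorem mem_SzUp (L : Type u) [AddCommGroup L] [i : Module S L] [Module S' L] [IsScalarTower S S' L] :
    ModuleCat.of S' L ∈ SzUp 𝒳 S' ↔ GG S' L ∧ Sz 𝒳 L := by
  have : i = Module.compHom L (algebraMap S S') := by
    apply Module.ext'
    intro r m
    rw [← algebraMap_smul S' r m]
    rfl
  subst this
  rfl

include hX q in
theorem SzUp.resolving [IsNoetherianRing S] : IsResolving S' (SzUp 𝒳 S') := by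
  have hn := q.noeth
  have hG := GGcat.resolving S'
  have tow : ∀ (L : ModuleCat.{u} S'), ∃ i : Module S L, IsScalarTower S S' L := fun L => by
    letI i : Module S L := Module.compHom L (algebraMap S S')
    exact ⟨i, ⟨fun a b c => by rw [Algebra.smul_def, mul_smul]; rfl⟩⟩
  refine ⟨?_, ?_, ?_, ?_, ?_, ?_⟩
  · intro M hM; exact hM.1.1
  · rintro M N ⟨e⟩ hM
    obtain ⟨_, _⟩ := tow M
    obtain ⟨_, _⟩ := tow N
    refine (mem_SzUp N).2 ?_
    obtain ⟨h1, h2⟩ := (mem_SzUp M).1 hM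
    exact ⟨h1.iso e, h2.iso hX (e.restrictScalars S)⟩
  · intro M _ _
    obtain ⟨_, _⟩ := tow M
    exact (mem_SzUp M).2 ⟨GG.proj M, Sz.proj hX q M⟩
  · intro M N h
    obtain ⟨_, _⟩ := tow M
    obtain ⟨_, _⟩ := tow N
    obtain ⟨h1, h2⟩ := (mem_SzUp (M × N)).1 h
    have hM := h1.retract (LinearMap.inl S' M N) (LinearMap.fst S' M N) (by ext; simp)
    have hN := h1.retract (LinearMap.inr S' M N) (LinearMap.snd S' M N) (by ext; simp)
    have := hM.1
    have := hN.1
    have := q.fin M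
    have := q.fin N
    exact (mem_SzUp M).2 ⟨hM, h2.fst hX⟩
  · intro A B C f g hs hA hC
    obtain ⟨_, _⟩ := tow A
    obtain ⟨_, _⟩ := tow B
    obtain ⟨_, _⟩ := tow C
    obtain ⟨h1, h2⟩ := (mem_SzUp A).1 hA
    obtain ⟨h3, h4⟩ := (mem_SzUp C).1 hC
    have hsS : IsSES (f.restrictScalars S) (g.restrictScalars S) :=
      IsSES.mk' hs.1 hs.2.1 hs.apply_zero hs.exists_of
    exact (mem_SzUp B).2 ⟨GG.mid hs h1 h3, Sz.mid hX hsS h2 h4⟩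
  · intro A B C f g hs _ _ _ hC
    obtain ⟨_, _⟩ := tow A
    obtain ⟨_, _⟩ := tow B
    obtain ⟨_, _⟩ := tow C
    obtain ⟨h3, h4⟩ := (mem_SzUp C).1 hC
    have hsS : IsSES (f.restrictScalars S) (g.restrictScalars S) :=
      IsSES.mk' hs.1 hs.2.1 hs.apply_zero hs.exists_of
    have := q.fin A
    exact (mem_SzUp A).2 ⟨GG.left hs (GG.proj B) h3, Sz.left hX hsS (Sz.proj hX q B) h4⟩

/-- The local key theorem. -/
theorem Red.key {n : ℕ} {S : Type u} [CommRing S] {J : Ideal S} (h : Red n S J) :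
    ∀ 𝒳 : Set (ModuleCat.{u} S), IsResolving S 𝒳 → 𝒳 ⊆ GGcat S → ∀ (M F N : ModuleCat.{u} S)
    (f : M →ₗ[S] F) (g : F →ₗ[S] N), IsSES f g → Module.Finite S F → Module.Projective S F →
    GG S N → M ∈ 𝒳 → (∀ y ∈ J, ∃ X ∈ 𝒳, ∃ (a : N →ₗ[S] X) (b : X →ₗ[S] N), b ∘ₗ a = y • LinearMap.id) →
    N ∈ 𝒳 := by
  induction h with
  | base S J h _ _ =>
    intro 𝒳 hX hXG M F N f g hs hF hFp hN hM _
    exact h.cosyz 𝒳 hX M F N f g hs hF hFp (hXG hM) hN hM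
  | step n S S' x q J hx h ih =>
    intro 𝒳 hX hXG M F N f g hs hF hFp hN hM hJ
    have hloc := (Red.step n S S' x q J hx h).hloc
    have hNr := hN.regular hloc q.nzd
    have hX' := SzUp.resolving hX q
    have hup : ∀ X : ModuleCat.{u} S, X ∈ 𝒳 → ModuleCat.of S' (S' ⊗[S] X) ∈ SzUp 𝒳 S' := by
      intro X hXX
      have hXr := (hXG hXX).regular hloc q.nzd
      exact (mem_SzUp (S' ⊗[S] X)).2 ⟨q.GG_down hXr (hXG hXX), Sz.right hX (q.ses_mul hXr) hXX hXX⟩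
    have hN' := ih (SzUp 𝒳 S') hX' (fun L hL => hL.1) (ModuleCat.of S' (S' ⊗[S] M))
      (ModuleCat.of S' (S' ⊗[S] F)) (ModuleCat.of S' (S' ⊗[S] N)) (f.baseChange S') (g.baseChange S')
      (q.ses hs hNr) inferInstance inferInstance (q.GG_down hNr hN) (hup M hM) (by
        intro y hy
        obtain ⟨s, hs, rfl⟩ := (Ideal.mem_map_iff_of_surjective _ q.surj).1 hy
        obtain ⟨X, hXX, a, b, hab⟩ := hJ s hs
        refine ⟨_, hup X hXX, a.baseChange S', b.baseChange S', ?_⟩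
        change (b.baseChange S') ∘ₗ (a.baseChange S') = _
        rw [← LinearMap.baseChange_comp, hab]
        apply LinearMap.ext
        intro z
        obtain ⟨m, rfl⟩ := q.mk_surj N z
        rw [LinearMap.baseChange_tmul]
        simp)
    have hSz : Sz 𝒳 (S' ⊗[S] N) := ((mem_SzUp (S' ⊗[S] N)).1 hN').2
    obtain ⟨X, hXX, a, b, hab⟩ := hJ x hx
    have hab' : ∀ n, b (a n) = x • n := LinearMap.congr_fun hab
    have := hN.1
    obtain ⟨Q, t, ht, _, _⟩ := exists_fp S N
    obtain ⟨b1, a1, hab1, hb1⟩ : ∃ (b1 : X × Q →ₗ[S] N) (a1 : N →ₗ[S] X × Q),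
        (∀ n, b1 (a1 n) = x • n) ∧ Function.Surjective b1 := by
      refine ⟨b.coprod t, LinearMap.inl S X Q ∘ₗ a, fun n => by simp [hab'], fun n => ?_⟩
      obtain ⟨z, hz⟩ := ht n
      exact ⟨(0, z), by simp [hz]⟩
    have hses : IsSES ((LinearMap.ker b1).subtype.coprod a1) (TensorProduct.mk S S' N 1 ∘ₗ b1) := by
      refine IsSES.mk' ?_ ?_ ?_ ?_
      · rw [injective_iff_map_eq_zero]
        rintro ⟨k, n⟩ hkn
        have h1 := congrArg b1 hkn
        have hk : b1 k.1 = 0 := k.2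
        rw [LinearMap.coprod_apply, map_add, hab1, Submodule.subtype_apply, hk, zero_add, map_zero] at h1
        have h2 : n = 0 := IsSMulRegular.zero_of hNr h1
        subst h2
        have h3 : k = 0 := Subtype.ext (by simpa using hkn)
        rw [h3]; rfl
      · exact Function.Surjective.comp (g := TensorProduct.mk S S' N 1) (q.mk_surj N) hb1
      · rintro ⟨k, n⟩
        have hk : b1 k.1 = 0 := k.2
        rw [LinearMap.comp_apply, LinearMap.coprod_apply, map_add, hab1, Submodule.subtype_apply, hk,
          zero_add]
        exact q.mk_x n
      · intro z hz
        obtain ⟨n, hn⟩ := (q.mk_zero (b1 z)).1 hz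
        refine ⟨(⟨z - a1 n, ?_⟩, n), by simp⟩
        rw [LinearMap.mem_ker, map_sub, hab1, hn, sub_self]
    exact hX.snd (Sz.kerX hX hses (hX.prod hXX (hX.proj (P := Q))) hSz)

end sz
end ResolvPaper
namespace ResolvPaper

/-! ## Localization -/
section locz
open TensorProduct
open Pointwise
open IsLocalRing (maximalIdeal)
variable {S : Type u} [CommRing S] [IsNoetherianRing S] (W : Submonoid S)
variable {A B C K P M N L : Type u} [AddCommGroup A] [Module S A] [AddCommGroup B] [Module S B]
  [AddCommGroup C] [Module S C] [AddCommGroup M] [Module S M] [AddCommGroup N] [Module S N]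
  [AddCommGroup L] [Module S L]

theorem TV_loc (φ : N →ₗ[S] L) [IsLocalizedModule W φ] (M : ModuleCat.{u} S) [hM : Module.Finite S M]
    {i : ℕ} (hi : 1 ≤ i) : TV W M N i ↔ EV S M L i := by
  induction i, hi using Nat.le_induction generalizing M with
  | base =>
    obtain ⟨K, P, f, g, hs, _, _, _⟩ := exists_syz S M
    have := Module.finitePresentation_of_finite S K
    have := Module.finitePresentation_of_finite S P
    rw [hs.ev_one, hs.tv_one]
    constructor
    · intro H k
      obtain ⟨k0, w, hk0⟩ := Module.FinitePresentation.exists_lift_of_isLocalizedModule W φ k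
      obtain ⟨w1, hw1, l, hl⟩ := H k0
      have hu := (Module.End.isUnit_iff _).1 (IsLocalizedModule.map_units φ (⟨w1, hw1⟩ * w))
      let e := LinearEquiv.ofBijective _ hu
      refine ⟨e.symm.toLinearMap ∘ₗ φ ∘ₗ l, ?_⟩
      apply LinearMap.ext
      intro a
      change e.symm (φ (l (f a))) = k a
      rw [LinearEquiv.symm_apply_eq]
      have h1 : l (f a) = w1 • k0 a := LinearMap.congr_fun hl a
      have h2 : φ (k0 a) = w • k a := LinearMap.congr_fun hk0 a
      rw [h1, map_smul, h2]
      change w1 • (w : S) • k a = (w1 * (w : S)) • k a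
      rw [mul_smul]
    · intro H k
      obtain ⟨l, hl⟩ := H (φ ∘ₗ k)
      obtain ⟨l0, w, hl0⟩ := Module.FinitePresentation.exists_lift_of_isLocalizedModule W φ l
      obtain ⟨w1, hw1⟩ := Module.Finite.exists_smul_of_comp_eq_of_isLocalizedModule W φ
        ((w : S) • k) (l0 ∘ₗ f) (by
          apply LinearMap.ext
          intro a
          have h1 : l (f a) = φ (k a) := LinearMap.congr_fun hl a
          have h2 : φ (l0 (f a)) = (w : S) • l (f a) := LinearMap.congr_fun hl0 (f a)
          change φ ((w : S) • k a) = φ (l0 (f a))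
          rw [h2, h1, map_smul])
      refine ⟨w1 * w, (w1 * w).2, (w1 : S) • l0, ?_⟩
      apply LinearMap.ext
      intro a
      have h3 : (w1 : S) • (w : S) • k a = (w1 : S) • l0 (f a) := LinearMap.congr_fun hw1 a
      change (w1 : S) • l0 (f a) = ((w1 : S) * w) • k a
      rw [← h3, mul_smul]
  | succ i hi ih =>
    obtain ⟨K, P, f, g, hs, _, _, _⟩ := exists_syz S M
    rw [← hs.ev_shift hi, ← hs.tv_shift hi, ih K]

theorem TV_loc' (S' : Type u) [CommRing S'] [Algebra S S'] [IsLocalization W S']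
    (M : ModuleCat.{u} S) [hM : Module.Finite S M]
    {i : ℕ} (hi : 1 ≤ i) : TV W M S i ↔ EV S' (S' ⊗[S] M) S' i := by
  have := IsLocalization.flat S' W
  rw [TV_loc W (Algebra.linearMap S S') M hi]
  exact EV_flat hi

theorem GG.localize (W : Submonoid S) (S' : Type u) [CommRing S'] [Algebra S S'] [IsLocalization W S']
    (hM : GG S M) : GG S' (S' ⊗[S] M) := by
  have := hM.1
  exact ⟨inferInstance, fun i hi => (TV_loc' W S' (ModuleCat.of S M) hi).1 ((hM.2 i hi).tv W)⟩

theorem GG.of_local (M : ModuleCat.{u} S) [Module.Finite S M] (h : ∀ p : Ideal S, ∀ _ : p.IsPrime,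
    GG (Localization.AtPrime p) (Localization.AtPrime p ⊗[S] M)) : GG S M := by
  refine ⟨‹_›, fun i hi => EV_of_local fun p hp => ?_⟩
  exact (TV_loc' p.primeCompl (Localization.AtPrime p) M hi).2 ((h p hp).2 i hi)

/-- hypothesis of the main theorem, in usable form -/
def LCI (S : Type u) [CommRing S] : Prop := ∀ p : Ideal S, ∀ _ : p.IsPrime, CIF (Localization.AtPrime p)

theorem LCI.red (H : LCI S) (p : Ideal S) [p.IsPrime] :
    ∃ n, Red n (Localization.AtPrime p) (maximalIdeal (Localization.AtPrime p)) := by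
  have : IsNoetherianRing (Localization.AtPrime p) := IsLocalization.isNoetherianRing p.primeCompl _ ‹_›
  exact Red.exists _ (H p inferInstance) _ 1 (by simp) le_rfl

theorem LCI.hloc (H : LCI S) : Hloc S := by
  intro p hp
  obtain ⟨n, hn⟩ := H.red p
  refine ⟨n, fun L hL i hi => (TV_loc' p.primeCompl (Localization.AtPrime p) L (by omega)).2 ?_⟩
  exact hn.bdd (ModuleCat.of _ (Localization.AtPrime p ⊗[S] L)) inferInstance i hi

theorem EV_of_weaklyRegular [IsLocalRing S] (n : ℕ)
    (hb : ∀ L : ModuleCat.{u} S, Module.Finite S L → ∀ i, n < i → EV S L S i) (rs : List S) :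
    ∀ (M : ModuleCat.{u} S), Module.Finite S M → (∀ r ∈ rs, r ∈ maximalIdeal S) →
    RingTheory.Sequence.IsWeaklyRegular M rs → ∀ i, n < i + rs.length → EV S M S i := by
  induction rs with
  | nil => intro M hM _ _ i hi; exact hb M hM i (by simpa using hi)
  | cons y rs ih =>
    intro M hM hm hr i hi
    rw [RingTheory.Sequence.isWeaklyRegular_cons_iff] at hr
    have h1 := ih (ModuleCat.of S (QuotSMulTop y M)) inferInstance
      (fun r hr => hm r (List.mem_cons_of_mem _ hr)) hr.2 (i+1) (by simp at hi; omega)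
    refine EV_nak_ses (hm y List.mem_cons_self) (g := Submodule.mkQ (y • (⊤ : Submodule S M))) ?_ h1
    refine IsSES.mk' hr.1 (Submodule.mkQ_surjective _) ?_ ?_
    · intro a
      rw [Submodule.mkQ_apply, Submodule.Quotient.mk_eq_zero]
      exact Submodule.smul_mem_pointwise_smul a y ⊤ trivial
    · intro b hb
      rw [Submodule.mkQ_apply, Submodule.Quotient.mk_eq_zero] at hb
      obtain ⟨a, -, ha⟩ := hb
      exact ⟨a, ha⟩

theorem Red.GG_iff_depth {n : ℕ} {S : Type u} [CommRing S] [IsLocalRing S]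
    (h : Red n S (maximalIdeal S)) (M : ModuleCat.{u} S) (hM : Module.Finite S M) :
    GG S M ↔ (n : ℕ∞) ≤ depthE S (maximalIdeal S) M := by
  have := h.isLocal.2
  constructor
  · intro hG
    obtain ⟨rs, k, h1, h2, -, h3⟩ := h.seq
    exact le_sSup ⟨rs, h2, h3 M hG, by rw [h1]⟩
  · intro hd
    obtain ⟨rs, h1, h2, h3⟩ : ∃ rs : List S, (∀ r ∈ rs, r ∈ maximalIdeal S) ∧
        RingTheory.Sequence.IsWeaklyRegular M rs ∧ n ≤ rs.length := by
      by_contra! hc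
      cases n with
      | zero =>
        have := hc [] (by simp) (RingTheory.Sequence.IsWeaklyRegular.nil S M)
        omega
      | succ n =>
        have : depthE S (maximalIdeal S) M ≤ n := by
          refine sSup_le ?_
          rintro _ ⟨rs, h1, h2, rfl⟩
          have := hc rs h1 h2
          exact_mod_cast (by omega : rs.length ≤ n)
        have h4 := hd.trans this
        have : n + 1 ≤ n := by exact_mod_cast h4
        omega
    exact ⟨hM, fun i hi => EV_of_weaklyRegular n h.bdd rs M hM h1 h2 i (by omega)⟩

theorem LCI.mcm (H : LCI S) : MCMcat S = GGcat S := by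
  ext M
  have hloc : ∀ (hM : Module.Finite S M) (p : PrimeSpectrum S), heightE S p ≤ localDepth S p M ↔
      GG (Localization.AtPrime p.asIdeal) (Localization.AtPrime p.asIdeal ⊗[S] M) := by
    intro hM p
    obtain ⟨n, hn⟩ := H.red p.asIdeal
    let e := LocalizedModule.equivTensorProduct p.asIdeal.primeCompl M
    have hfin : Module.Finite (Localization.AtPrime p.asIdeal) (LocalizedModule p.asIdeal.primeCompl M) :=
      Module.Finite.equiv e.symm
    have h1 := hn.GG_iff_depth (ModuleCat.of _ (LocalizedModule p.asIdeal.primeCompl M)) hfin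
    have h2 : heightE S p = n := by
      have := hn.dim
      rw [IsLocalization.AtPrime.ringKrullDim_eq_height p.asIdeal] at this
      have h3 : p.asIdeal.height = n := by exact_mod_cast this
      rw [PrimeSpectrum.height_eq_orderHeight] at h3
      exact h3
    rw [h2]
    refine Iff.trans h1.symm ⟨fun h => h.iso e, fun h => h.iso e.symm⟩
  constructor
  · rintro ⟨hM, h⟩
    exact GG.of_local M fun p hp => (hloc hM ⟨p, hp⟩).1 (h ⟨p, hp⟩)
  · intro h
    exact ⟨h.1, fun p => (hloc h.1 p).2 (h.localize p.asIdeal.primeCompl _)⟩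

end locz
end ResolvPaper
namespace ResolvPaper

/-! ## Eventual vanishing of Ext -/
section goto
open TensorProduct
open Pointwise
open IsLocalRing (maximalIdeal)
variable {S : Type u} [CommRing S]
variable {A B C K P M N L : Type u} [AddCommGroup A] [Module S A] [AddCommGroup B] [Module S B]
  [AddCommGroup C] [Module S C] [AddCommGroup M] [Module S M] [AddCommGroup N] [Module S N]
  [AddCommGroup L] [Module S L]

theorem prime_filt [IsNoetherianRing S] (a : Ideal S) (Pr : ModuleCat.{u} S → Prop)
    (h0 : ∀ N : ModuleCat.{u} S, Subsingleton N → Pr N)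
    (hq : ∀ (q : Ideal S), q.IsPrime → a ≤ q → ∀ N : ModuleCat.{u} S, (N ≃ₗ[S] (S ⧸ q)) → Pr N)
    (hext : ∀ (A B C : ModuleCat.{u} S) (f : A →ₗ[S] B) (g : B →ₗ[S] C), IsSES f g → Pr A → Pr C → Pr B)
    (M : ModuleCat.{u} S) (hfin : Module.Finite S M) (hM : ∀ x ∈ a, ∀ m : M, x • m = 0) : Pr M := by
  have key : (∀ x ∈ a, ∀ m : M, x • m = 0) → Pr (ModuleCat.of S M) := by
    refine IsNoetherianRing.induction_on_isQuotientEquivQuotientPrime S (M := M) hfin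
      (motive := fun N _ _ _ => (∀ x ∈ a, ∀ m : N, x • m = 0) → Pr (ModuleCat.of S N)) ?_ ?_ ?_
    · intro N _ _ _ h _
      exact h0 _ h
    · intro N _ _ _ P e' hN
      refine hq P.1 P.2 ?_ _ e'
      intro x hx
      have h1 := hN x hx (e'.symm (Ideal.Quotient.mk _ 1))
      rw [← map_smul, LinearEquiv.map_eq_zero_iff] at h1
      have h2 : Ideal.Quotient.mk P.1 (x * 1) = 0 := h1
      rwa [mul_one, Ideal.Quotient.eq_zero_iff_mem] at h2
    · intro N1 _ _ _ N2 _ _ _ N3 _ _ _ f g hf hg hfg h1 h3 h2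
      have : IsSES f g := ⟨hf, hg, (LinearMap.exact_iff.1 hfg).symm⟩
      refine hext _ (ModuleCat.of S N2) _ f g this (h1 ?_) (h3 ?_)
      · intro x hx m
        apply hf
        rw [map_smul, h2 x hx, map_zero]
      · intro x hx m
        obtain ⟨m, rfl⟩ := hg m
        rw [← map_smul, h2 x hx, map_zero]
  exact key hM

theorem TV.single [IsNoetherianRing S] [Module.Finite S M] [Module.Finite S N] {W : Submonoid S} {i : ℕ}
    (h : TV W M N i) : ∃ s ∈ W, ∀ e : XT S M N i, s • e = 0 := by
  have hfin : Module.Finite S (XT S M N i) := finite_XT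
  obtain ⟨σ, hσ⟩ := hfin.1
  choose s hs he using h
  classical
  refine ⟨σ.prod s, Submonoid.prod_mem _ fun x _ => hs x, ?_⟩
  intro e
  have : e ∈ Submodule.span S (σ : Set (XT S M N i)) := by rw [hσ]; trivial
  induction this using Submodule.span_induction with
  | mem x hx =>
    rw [← Finset.prod_erase_mul σ s hx, mul_smul, he, smul_zero]
  | zero => simp
  | add x y _ _ hx hy => rw [smul_add, hx, hy, add_zero]
  | smul r x _ hx => rw [smul_comm, hx, smul_zero]

/-- finite projective dimension of a localization gives uniform annihilation of Ext -/
theorem exists_kill [IsNoetherianRing S] (W : Submonoid S) (S' : Type u) [CommRing S'] [Algebra S S']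
    [IsLocalization W S'] (d : ℕ) : ∀ (L : ModuleCat.{u} S), Module.Finite S L →
    (∀ (N : ModuleCat.{u} S') (i : ℕ), d < i → EV S' (S' ⊗[S] L) N i) →
    ∃ s ∈ W, ∀ i, d < i → ∀ e : XT S L S i, s • e = 0 := by
  have hflat := IsLocalization.flat S' W
  induction d with
  | zero =>
    intro L hL h
    obtain ⟨K, P, f, g, hs, _, _, _⟩ := exists_syz S L
    have h1 := h (ModuleCat.of S' (S' ⊗[S] K)) 1 (by omega)
    have h2 : EV S L (S' ⊗[S] K) 1 := (EV_flat le_rfl).2 h1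
    have hloc : IsLocalizedModule W (TensorProduct.mk S S' K 1) :=
      (isLocalizedModule_iff_isBaseChange W S' _).2 (TensorProduct.isBaseChange S K S')
    have h3 : TV W L K 1 := (TV_loc W (TensorProduct.mk S S' K 1) L le_rfl).2 h2
    rw [hs.tv_one] at h3
    obtain ⟨s, hsW, l, hl⟩ := h3 LinearMap.id
    have hl' : ∀ k, l (f k) = s • k := LinearMap.congr_fun hl
    obtain ⟨t, ht⟩ := hs.desc (s • LinearMap.id - f ∘ₗ l) (fun a => by simp [hl'])
    refine ⟨s, hsW, fun i hi e => XT.smul_zero_of_factor s t g ?_ (EV.proj P hi) e⟩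
    apply LinearMap.ext
    intro y
    obtain ⟨y, rfl⟩ := hs.2.1 y
    have := LinearMap.congr_fun ht y
    simp only [LinearMap.comp_apply, LinearMap.sub_apply, LinearMap.smul_apply, LinearMap.id_apply] at this ⊢
    rw [this, map_sub, hs.apply_zero, sub_zero, map_smul]
  | succ d ih =>
    intro L hL h
    obtain ⟨K, P, f, g, hs, _, _, _⟩ := exists_syz S L
    have hs' : IsSES (f.baseChange S') (g.baseChange S') := hs.baseChange_flat
    obtain ⟨s, hsW, hk⟩ := ih K ‹_› (fun N i hi => (hs'.ev_shift (by omega)).2 (h N (i+1) (by omega)))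
    refine ⟨s, hsW, fun i hi e => ?_⟩
    obtain ⟨i, rfl⟩ : ∃ j, i = j + 1 := ⟨i - 1, by omega⟩
    obtain ⟨e', rfl⟩ := hs.ex3 e (EV.proj P (by omega) _)
    rw [← map_smul, hk i (by omega), map_zero]

theorem EV_quot_weaklyRegular (rs : List S) (N : Type u) [AddCommGroup N] [Module S N] :
    ∀ (M : ModuleCat.{u} S) (d : ℕ), RingTheory.Sequence.IsWeaklyRegular M rs →
    (∀ i, d < i → EV S M N i) → ∀ i, d + rs.length < i →
      EV S (M ⧸ (Ideal.ofList rs • ⊤ : Submodule S M)) N i := by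
  induction rs with
  | nil =>
    intro M d _ h i hi
    refine EV.iso (Submodule.quotEquivOfEqBot _ ?_) (h i (by simpa using hi))
    simp
  | cons y rs ih =>
    intro M d hr h i hi
    rw [RingTheory.Sequence.isWeaklyRegular_cons_iff] at hr
    refine EV.iso (Submodule.quotOfListConsSMulTopEquivQuotSMulTopInner M y rs) ?_
    refine ih (ModuleCat.of S (QuotSMulTop y M)) (d+1) hr.2 ?_ i (by simp at hi; omega)
    intro j hj
    obtain ⟨j, rfl⟩ : ∃ k, j = k + 1 := ⟨j - 1, by omega⟩
    have hs : IsSES (y • LinearMap.id : M →ₗ[S] M) (Submodule.mkQ (y • (⊤ : Submodule S M))) := by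
      refine IsSES.mk' hr.1 (Submodule.mkQ_surjective _) ?_ ?_
      · intro a
        rw [Submodule.mkQ_apply, Submodule.Quotient.mk_eq_zero]
        exact Submodule.smul_mem_pointwise_smul a y ⊤ trivial
      · intro b hb
        rw [Submodule.mkQ_apply, Submodule.Quotient.mk_eq_zero] at hb
        obtain ⟨a, -, ha⟩ := hb
        exact ⟨a, ha⟩
    exact hs.ev_right (h j (by omega)) (h (j+1) (by omega))

/-- A `p`-primary ideal with uniformly annihilated Ext. -/
theorem LCI.exists_primary [IsNoetherianRing S] (H : LCI S) (p : Ideal S) [p.IsPrime] :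
    ∃ (I : Ideal S) (k d : ℕ), p ^ k ≤ I ∧ I ≤ p ∧ ∃ s ∉ p, ∀ i, d < i →
      ∀ e : XT S (S ⧸ I) S i, s • e = 0 := by
  obtain ⟨n, hn⟩ := H.red p
  obtain ⟨rs, k, h1, h2, h3, h4⟩ := hn.seq
  let S' := Localization.AtPrime p
  let I : Ideal S := (Ideal.ofList rs).comap (algebraMap S S')
  have hmap : I.map (algebraMap S S') = Ideal.ofList rs := IsLocalization.map_under p.primeCompl S' _
  have hle : Ideal.ofList rs ≤ maximalIdeal S' := Ideal.span_le.2 fun r hr => h2 r hr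
  refine ⟨I, k, n, ?_, ?_, ?_⟩
  · rw [← Ideal.map_le_iff_le_comap, Ideal.map_pow, Localization.AtPrime.map_eq_maximalIdeal]
    exact h3 _ (IsLocalRing.maximalIdeal.isMaximal S')
  · refine (Ideal.comap_mono hle).trans ?_
    exact (IsLocalization.AtPrime.under_maximalIdeal S' p).le
  · have hk := exists_kill p.primeCompl S' n (ModuleCat.of S (S ⧸ I)) inferInstance (by
      intro N i hi
      have h5 := EV_quot_weaklyRegular rs N (ModuleCat.of S' S') 0 (h4 _ (GG.proj S'))
        (fun i hi => EV.proj S' hi) i (by omega)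
      refine EV.iso ?_ h5
      refine (Ideal.qoutMapEquivTensorQout S' (I := I)).symm ≪≫ₗ Submodule.quotEquivOfEq _ _ ?_
      rw [hmap]
      simp)
    obtain ⟨s, hs, hk⟩ := hk
    exact ⟨s, hs, hk⟩

/-- Eventual vanishing. -/
def Bd (M : Type u) [AddCommGroup M] [Module S M] : Prop := ∃ h : ℕ, ∀ i, h < i → EV S M S i

theorem Bd.mid {f : A →ₗ[S] B} {g : B →ₗ[S] C} (h : IsSES f g) (hA : Bd (S := S) A) (hC : Bd (S := S) C) :
    Bd (S := S) B := by
  obtain ⟨a, ha⟩ := hA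
  obtain ⟨c, hc⟩ := hC
  exact ⟨max a c, fun i hi => h.ev_mid (ha i (lt_of_le_of_lt (le_max_left _ _) hi))
    (hc i (lt_of_le_of_lt (le_max_right _ _) hi))⟩

theorem LCI.bd_prime [IsNoetherianRing S] (H : LCI S) (p : Ideal S) (hp : p.IsPrime)
    (ih : ∀ q : Ideal S, p < q → q.IsPrime → Bd (S := S) (S ⧸ q)) : Bd (S := S) (S ⧸ p) := by
  obtain ⟨I, k, d, hkI, hIp, s, hsp, hs⟩ := H.exists_primary p
  let π : (S ⧸ I) →ₗ[S] (S ⧸ p) := Submodule.factor hIp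
  have hπ : Function.Surjective π := Submodule.factor_surjective hIp
  have hses := IsSES.ker π hπ
  -- comparison for modules killed by a power of `p`
  obtain ⟨h2, hU⟩ : ∃ h2 : ℕ, ∀ i, h2 < i → ∀ W : Submonoid S, TV W (S ⧸ p) S i →
      TV W (LinearMap.ker π) S i := by
    refine prime_filt (p ^ k) (fun N => ∃ h2 : ℕ, ∀ i, h2 < i → ∀ W : Submonoid S, TV W (S ⧸ p) S i →
      TV W N S i) ?_ ?_ ?_ (ModuleCat.of S (LinearMap.ker π)) inferInstance ?_
    · intro N _
      exact ⟨0, fun i _ W _ => EV.tv EV.subsingleton W⟩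
    · intro q hq hle N e
      have hpq : p ≤ q := Ideal.IsPrime.le_of_pow_le hle
      rcases eq_or_lt_of_le hpq with rfl | hlt
      · exact ⟨0, fun i _ W h => h.iso e⟩
      · obtain ⟨h, hh⟩ := ih q hlt hq
        exact ⟨h, fun i hi W _ => ((hh i hi).iso e).tv W⟩
    · rintro A B C f g hs ⟨a, ha⟩ ⟨c, hc⟩
      exact ⟨max a c, fun i hi W h => hs.tv_mid (ha i (lt_of_le_of_lt (le_max_left _ _) hi) W h)
        (hc i (lt_of_le_of_lt (le_max_right _ _) hi) W h)⟩
    · rintro x hx ⟨m, hm⟩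
      apply Subtype.ext
      obtain ⟨m, rfl⟩ := Ideal.Quotient.mk_surjective m
      change Ideal.Quotient.mk I (x * m) = 0
      rw [Ideal.Quotient.eq_zero_iff_mem]
      exact I.mul_mem_right _ (hkI hx)
  obtain ⟨h0, hh0⟩ := H.hloc p hp
  obtain ⟨i0, hi0⟩ : ∃ i0, i0 = h0 + h2 + d + 1 := ⟨_, rfl⟩
  obtain ⟨t, htp, ht⟩ := (hh0 (ModuleCat.of S (S ⧸ p)) inferInstance i0 (by omega)).single
  obtain ⟨f, hf⟩ : ∃ f, f = t * s := ⟨_, rfl⟩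
  have hfp : f ∉ p := fun h => (hp.mem_or_mem (hf ▸ h)).elim htp hsp
  have hall : ∀ i, i0 ≤ i → TV (Submonoid.powers f) (S ⧸ p) S i := by
    intro i hi
    induction i, hi using Nat.le_induction with
    | base => exact fun e => ⟨f, Submonoid.mem_powers f, by
        rw [hf, mul_comm, mul_smul, ht, smul_zero]⟩
    | succ i hi ih2 =>
      refine hses.tv_right (hU i (by omega) _ ih2) ?_
      exact fun e => ⟨f, Submonoid.mem_powers f, by
        rw [hf, mul_smul, hs _ (by omega), smul_zero]⟩
  have hq := quot_prime_ses p hfp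
  obtain ⟨h3, hC⟩ : Bd (S := S) ((S ⧸ p) ⧸ (LinearMap.range (f • LinearMap.id : (S ⧸ p) →ₗ[S] (S ⧸ p)))) := by
    refine prime_filt (p ⊔ Ideal.span {f}) (fun N => Bd (S := S) N) ?_ ?_ ?_
      (ModuleCat.of S ((S ⧸ p) ⧸ (LinearMap.range (f • LinearMap.id : (S ⧸ p) →ₗ[S] (S ⧸ p)))))
      inferInstance ?_
    · intro N _
      exact ⟨0, fun i _ => EV.subsingleton⟩
    · intro q hq hle N e
      have hlt : p < q := lt_of_le_of_ne (le_sup_left.trans hle) (by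
        rintro rfl
        exact hfp (hle (Ideal.mem_sup_right (Ideal.mem_span_singleton_self f))))
      obtain ⟨h, hh⟩ := ih q hlt hq
      exact ⟨h, fun i hi => (hh i hi).iso e⟩
    · intro A B C f g hs hA hC
      exact Bd.mid hs hA hC
    · intro x hx m
      obtain ⟨m, rfl⟩ := Submodule.Quotient.mk_surjective _ m
      obtain ⟨m, rfl⟩ := Ideal.Quotient.mk_surjective m
      obtain ⟨a, ha, b, hb, rfl⟩ := Submodule.mem_sup.1 hx
      obtain ⟨c, rfl⟩ := Ideal.mem_span_singleton'.1 hb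
      rw [← Submodule.Quotient.mk_smul, Submodule.Quotient.mk_eq_zero]
      refine ⟨Ideal.Quotient.mk p (c * m), ?_⟩
      change Ideal.Quotient.mk p (f * (c * m)) = Ideal.Quotient.mk p ((a + c * f) * m)
      rw [Ideal.Quotient.eq]
      have : f * (c * m) - (a + c * f) * m = - (a * m) := by ring
      rw [this]
      exact p.neg_mem (p.mul_mem_right _ ha)
  refine ⟨i0 + h3, fun i hi e => ?_⟩
  have hinj : ∀ e : XT S (S ⧸ p) S i, f • e = 0 → e = 0 := by
    intro e he
    rw [XT.smul_eq_pre] at he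
    obtain ⟨e', rfl⟩ := hq.ex2 e he
    rw [hC i (by omega) e', map_zero]
  obtain ⟨_, ⟨n, rfl⟩, hn⟩ := hall i (by omega) e
  clear hi
  simp only at hn
  induction n with
  | zero => simpa using hn
  | succ n ihn =>
    apply ihn
    apply hinj
    rw [smul_smul, ← pow_succ', hn]

theorem LCI.bd [IsNoetherianRing S] (H : LCI S) (M : ModuleCat.{u} S) (hM : Module.Finite S M) :
    Bd (S := S) M := by
  have hpr : ∀ p : Ideal S, p.IsPrime → Bd (S := S) (S ⧸ p) := by
    intro p
    induction p using WellFoundedGT.induction with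
    | ind p ih => exact fun hp => H.bd_prime p hp ih
  refine prime_filt ⊥ (fun N => Bd (S := S) N) ?_ ?_ ?_ M hM ?_
  · intro N _
    exact ⟨0, fun i _ => EV.subsingleton⟩
  · intro q hq _ N e
    obtain ⟨h, hh⟩ := hpr q hq
    exact ⟨h, fun i hi => (hh i hi).iso e⟩
  · intro A B C f g hs hA hC
    exact Bd.mid hs hA hC
  · rintro x hx m
    rw [Submodule.mem_bot] at hx
    rw [hx, zero_smul]

end goto
end ResolvPaper
namespace ResolvPaper

/-! ## Localizing resolving subcategories -/
section locres
open TensorProduct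
variable {S : Type u} [CommRing S]
variable {A B C A' B' C' K P M N L X Y : Type u} [AddCommGroup A] [Module S A] [AddCommGroup B] [Module S B]
  [AddCommGroup C] [Module S C] [AddCommGroup A'] [Module S A'] [AddCommGroup B'] [Module S B']
  [AddCommGroup C'] [Module S C'] [AddCommGroup M] [Module S M] [AddCommGroup N] [Module S N]
  [AddCommGroup L] [Module S L] [AddCommGroup X] [Module S X] [AddCommGroup Y] [Module S Y]
  [AddCommGroup K] [Module S K] [AddCommGroup P] [Module S P]

theorem IsSES.pushout1 {f : K →ₗ[S] P} {g : P →ₗ[S] Y} (h : IsSES f g) (k : K →ₗ[S] X) :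
    ∃ (E : ModuleCat.{u} S) (i : X →ₗ[S] E) (p : E →ₗ[S] Y) (j : P →ₗ[S] E), IsSES i p ∧
      (∀ x, p (j x) = g x) ∧ (∀ x, i (k x) = j (f x)) ∧ (∀ e, ∃ x y, e = i x + j y) ∧
      (∀ (Z : Type u) [AddCommGroup Z] [Module S Z] (a : X →ₗ[S] Z) (b : P →ₗ[S] Z),
        (∀ x, a (k x) = b (f x)) → ∃ w : E →ₗ[S] Z, (∀ x, w (i x) = a x) ∧ (∀ x, w (j x) = b x)) := by
  let U : Submodule S (X × P) := LinearMap.range (k.prod (-f))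
  have e0 : ∀ x : X × P, U.mkQ x = 0 ↔ ∃ a, (k a, -f a) = x := by
    intro x
    rw [Submodule.mkQ_apply, Submodule.Quotient.mk_eq_zero]
    rfl
  have hU : ∀ z ∈ U, g (z.2) = 0 := by
    rintro _ ⟨a, rfl⟩; simp [h.apply_zero]
  refine ⟨ModuleCat.of S ((X × P) ⧸ U), U.mkQ ∘ₗ LinearMap.inl S X P,
    U.liftQ (g ∘ₗ LinearMap.snd S X P) hU, U.mkQ ∘ₗ LinearMap.inr S X P, ?_, fun x => rfl, ?_, ?_, ?_⟩
  · refine IsSES.mk' ?_ ?_ ?_ ?_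
    · rw [injective_iff_map_eq_zero]
      intro x hx
      obtain ⟨a, ha⟩ := (e0 _).1 hx
      have h1 : k a = x := congrArg Prod.fst ha
      have h2 : -f a = 0 := congrArg Prod.snd ha
      have h3 : a = 0 := h.1 (by rw [map_zero]; exact neg_eq_zero.1 h2)
      rw [← h1, h3, map_zero]
    · intro y
      obtain ⟨x, rfl⟩ := h.2.1 y
      exact ⟨U.mkQ (0, x), rfl⟩
    · intro x
      change g 0 = 0
      exact map_zero g
    · intro b hb
      obtain ⟨⟨x, y⟩, rfl⟩ := U.mkQ_surjective b
      obtain ⟨a, rfl⟩ := h.exists_of y hb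
      refine ⟨x + k a, ?_⟩
      rw [← sub_eq_zero]
      change U.mkQ ((x + k a, 0) - (x, f a)) = 0
      rw [e0]
      exact ⟨a, by ext <;> simp⟩
  · intro x
    rw [← sub_eq_zero]
    change U.mkQ ((k x, 0) - (0, f x)) = 0
    rw [e0]
    exact ⟨x, by ext <;> simp⟩
  · intro e
    obtain ⟨⟨x, y⟩, rfl⟩ := U.mkQ_surjective e
    refine ⟨x, y, ?_⟩
    change _ = U.mkQ ((x, 0) + (0, y))
    simp
  · intro Z _ _ a b hab
    refine ⟨U.liftQ (a.coprod b) ?_, fun x => ?_, fun x => ?_⟩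
    · rintro _ ⟨z, rfl⟩
      simp [hab]
    · change (a.coprod b) (x, 0) = _
      simp
    · change (a.coprod b) (0, x) = _
      simp

theorem IsSES.short5 {f : A →ₗ[S] B} {g : B →ₗ[S] C} (h : IsSES f g) {f' : A' →ₗ[S] B'}
    {g' : B' →ₗ[S] C'} (h' : IsSES f' g') (a : A →ₗ[S] A') (b : B →ₗ[S] B') (c : C →ₗ[S] C')
    (ha : Function.Bijective a) (hc : Function.Bijective c) (h1 : ∀ x, b (f x) = f' (a x))
    (h2 : ∀ x, g' (b x) = c (g x)) : Function.Bijective b := by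
  constructor
  · rw [injective_iff_map_eq_zero]
    intro x hx
    have h3 : g x = 0 := hc.1 (by rw [← h2, hx, map_zero, map_zero])
    obtain ⟨y, rfl⟩ := h.exists_of x h3
    rw [h1] at hx
    have h4 : a y = 0 := h'.1 (by rw [hx, map_zero])
    have h5 : y = 0 := ha.1 (by rw [h4, map_zero])
    rw [h5, map_zero]
  · intro y
    obtain ⟨z, hz⟩ := hc.2 (g' y)
    obtain ⟨x, rfl⟩ := h.2.1 z
    obtain ⟨w, hw⟩ := h'.exists_of (y - b x) (by rw [map_sub, h2, hz, sub_self])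
    obtain ⟨v, rfl⟩ := ha.2 w
    exact ⟨x + f v, by rw [map_add, h1, hw]; abel⟩

variable (W : Submonoid S) (S' : Type u) [CommRing S'] [Algebra S S'] [IsLocalization W S']

include W in
theorem mk_loc : IsLocalizedModule W (TensorProduct.mk S S' K 1) :=
  (isLocalizedModule_iff_isBaseChange W S' _).2 (TensorProduct.isBaseChange S K S')

include W in
theorem loc_ext [IsNoetherianRing S] [Module.Finite S X] [Module.Finite S Y] {E : Type u} [AddCommGroup E]
    [Module S' E] {f : (S' ⊗[S] X) →ₗ[S'] E} {g : E →ₗ[S'] (S' ⊗[S] Y)} (h : IsSES f g) :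
    ∃ (E0 : ModuleCat.{u} S) (i : X →ₗ[S] E0) (p : E0 →ₗ[S] Y), IsSES i p ∧
      Nonempty ((S' ⊗[S] E0) ≃ₗ[S'] E) := by
  have hflat := IsLocalization.flat S' W
  letI : Module S E := Module.compHom E (algebraMap S S')
  haveI : IsScalarTower S S' E := ⟨fun a b c => by rw [Algebra.smul_def, mul_smul]; rfl⟩
  obtain ⟨K, P, κ, π, hs, _, _, _⟩ := exists_syz S Y
  obtain ⟨q, hq⟩ := Module.projective_lifting_property g (π.baseChange S') h.2.1
  have hq' : ∀ z, g (q z) = π.baseChange S' z := LinearMap.congr_fun hq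
  have hs' : IsSES (κ.baseChange S') (π.baseChange S') := hs.baseChange_flat
  obtain ⟨k', hk'⟩ := h.lift (q ∘ₗ κ.baseChange S') (fun m => by
    rw [LinearMap.comp_apply, hq', hs'.apply_zero])
  have hk'' : ∀ z, f (k' z) = q (κ.baseChange S' z) := LinearMap.congr_fun hk'
  have hX := mk_loc (K := X) W S'
  have := Module.finitePresentation_of_finite S K
  obtain ⟨k, w, hk⟩ := Module.FinitePresentation.exists_lift_of_isLocalizedModule W
    (TensorProduct.mk S S' X 1) ((k'.restrictScalars S) ∘ₗ TensorProduct.mk S S' K 1)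
  have hk2 : ∀ z, (1 : S') ⊗ₜ[S] k z = (w : S) • k' ((1 : S') ⊗ₜ z) := LinearMap.congr_fun hk
  obtain ⟨E0, i, p, j, hses, hpj, hij, hspan, huniv⟩ := hs.pushout1 k
  obtain ⟨b0, hb1, hb2⟩ := huniv E ((f.restrictScalars S) ∘ₗ TensorProduct.mk S S' X 1)
    ((w : S) • ((q.restrictScalars S) ∘ₗ TensorProduct.mk S S' P 1)) (fun x => by
      change f ((1 : S') ⊗ₜ[S] k x) = (w : S) • q (1 ⊗ₜ κ x)
      rw [hk2, ← algebraMap_smul S', map_smul, hk'', LinearMap.baseChange_tmul, algebraMap_smul])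
  refine ⟨E0, i, p, hses, ?_⟩
  have hc : Function.Bijective ((algebraMap S S' w) • LinearMap.id : (S' ⊗[S] Y) →ₗ[S'] (S' ⊗[S] Y)) := by
    obtain ⟨v, hv⟩ := (IsLocalization.map_units S' w).exists_left_inv
    refine Function.bijective_iff_has_inverse.2 ⟨fun y => v • y, fun y => ?_, fun y => ?_⟩
    · change v • (algebraMap S S' w) • y = y
      rw [smul_smul, hv, one_smul]
    · change (algebraMap S S' w) • v • y = y
      rw [smul_smul, mul_comm, hv, one_smul]
  have hg0 : ∀ e, g (b0 e) = (algebraMap S S' w) • ((1 : S') ⊗ₜ[S] p e) := by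
    intro e
    obtain ⟨x, y, rfl⟩ := hspan e
    rw [map_add, hb1, hb2, map_add, map_add, hses.apply_zero, zero_add, hpj]
    change g (f _) + g ((w : S) • q (1 ⊗ₜ y)) = _
    rw [h.apply_zero, zero_add, ← algebraMap_smul S', map_smul, hq', LinearMap.baseChange_tmul]
  refine ⟨LinearEquiv.ofBijective (b0.liftBaseChange S') ?_⟩
  refine IsSES.short5 (hses.baseChange_flat (S' := S')) h LinearMap.id _ _ Function.bijective_id hc ?_ ?_
  · intro z
    induction z using TensorProduct.induction_on with
    | zero => simp
    | add x y hx hy => rw [map_add, map_add, hx, hy, map_add, map_add]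
    | tmul a x =>
      rw [LinearMap.baseChange_tmul, LinearMap.liftBaseChange_tmul, hb1]
      change a • f (1 ⊗ₜ x) = f (a ⊗ₜ x)
      rw [← map_smul, smul_tmul', smul_eq_mul, mul_one]
  · intro z
    induction z using TensorProduct.induction_on with
    | zero => simp
    | add x y hx hy => rw [map_add, map_add, hx, hy, map_add, map_add]
    | tmul a x =>
      rw [LinearMap.baseChange_tmul, LinearMap.liftBaseChange_tmul, map_smul, hg0]
      change a • (algebraMap S S' w) • ((1:S') ⊗ₜ[S] p x) = (algebraMap S S' w) • (a ⊗ₜ[S] p x)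
      rw [smul_comm, smul_tmul' a, smul_eq_mul, mul_one]

/-- summands of localizations of objects of `𝒳` -/
def LocC (𝒳 : Set (ModuleCat.{u} S)) (S' : Type u) [CommRing S'] [Algebra S S'] : Set (ModuleCat.{u} S') :=
  {L | ∃ X ∈ 𝒳, ∃ (i : L →ₗ[S'] (S' ⊗[S] X)) (r : (S' ⊗[S] X) →ₗ[S'] L), r ∘ₗ i = LinearMap.id}

variable {S'} {𝒳 : Set (ModuleCat.{u} S)} (hX : IsResolving S 𝒳)

theorem LocC.of (hXm : ModuleCat.of S X ∈ 𝒳) : ModuleCat.of S' (S' ⊗[S] X) ∈ LocC 𝒳 S' :=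
  ⟨_, hXm, LinearMap.id, LinearMap.id, rfl⟩

theorem LocC.retract {L L' : ModuleCat.{u} S'} (i : L →ₗ[S'] L') (r : L' →ₗ[S'] L)
    (h : r ∘ₗ i = LinearMap.id) (hL : L' ∈ LocC 𝒳 S') : L ∈ LocC 𝒳 S' := by
  obtain ⟨X, hX, i', r', h'⟩ := hL
  refine ⟨X, hX, i' ∘ₗ i, r ∘ₗ r', ?_⟩
  rw [LinearMap.comp_assoc, ← LinearMap.comp_assoc i, h', LinearMap.id_comp, h]

include hX in
theorem LocC.prod {L L' : ModuleCat.{u} S'} (h : L ∈ LocC 𝒳 S') (h' : L' ∈ LocC 𝒳 S') :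
    ModuleCat.of S' (L × L') ∈ LocC 𝒳 S' := by
  obtain ⟨X, hX1, i, r, h⟩ := h
  obtain ⟨X', hX1', i', r', h'⟩ := h'
  have h1 := LinearMap.congr_fun h
  have h2 := LinearMap.congr_fun h'
  refine LocC.retract (L' := ModuleCat.of S' (S' ⊗[S] (X × X')))
    (((LinearMap.inl S X X').baseChange S' ∘ₗ i).coprod ((LinearMap.inr S X X').baseChange S' ∘ₗ i'))
    ((r ∘ₗ (LinearMap.fst S X X').baseChange S').prod (r' ∘ₗ (LinearMap.snd S X X').baseChange S')) ?_
    (LocC.of (hX.prod hX1 hX1'))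
  have e1 : ∀ z, (LinearMap.fst S X X').baseChange S' ((LinearMap.inl S X X').baseChange S' z) = z :=
    fun z => by rw [← LinearMap.comp_apply, ← LinearMap.baseChange_comp]; simp
  have e2 : ∀ z, (LinearMap.snd S X X').baseChange S' ((LinearMap.inr S X X').baseChange S' z) = z :=
    fun z => by rw [← LinearMap.comp_apply, ← LinearMap.baseChange_comp]; simp
  have e3 : ∀ z, (LinearMap.fst S X X').baseChange S' ((LinearMap.inr S X X').baseChange S' z) = 0 :=
    fun z => by rw [← LinearMap.comp_apply, ← LinearMap.baseChange_comp]; simp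
  have e4 : ∀ z, (LinearMap.snd S X X').baseChange S' ((LinearMap.inl S X X').baseChange S' z) = 0 :=
    fun z => by rw [← LinearMap.comp_apply, ← LinearMap.baseChange_comp]; simp
  apply LinearMap.ext
  rintro ⟨a, b⟩
  have h1a : r (i a) = a := h1 a
  have h2b : r' (i' b) = b := h2 b
  simp [e1, e2, e3, e4, h1a, h2b]

include hX in
theorem LocC.proj (P : Type u) [AddCommGroup P] [Module S' P] [Module.Finite S' P] [Module.Projective S' P] :
    ModuleCat.of S' P ∈ LocC 𝒳 S' := by
  obtain ⟨n, q, hq⟩ := Module.Finite.exists_fin' S' P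
  obtain ⟨i, hi⟩ := Module.projective_lifting_property q LinearMap.id hq
  have hm : ModuleCat.of S (Fin n → S) ∈ 𝒳 := hX.proj
  refine LocC.retract (L' := ModuleCat.of S' (Fin n → S')) i q hi ?_
  let e := TensorProduct.piScalarRight S S' S' (Fin n)
  exact LocC.retract (L' := ModuleCat.of S' (S' ⊗[S] (Fin n → S))) e.symm.toLinearMap e.toLinearMap
    (by ext1; simp) (LocC.of hm)

include hX W in
theorem LocC.resolving [IsNoetherianRing S] : IsResolving S' (LocC 𝒳 S') := by
  have hflat := IsLocalization.flat S' W
  refine ⟨?_, ?_, ?_, ?_, ?_, ?_⟩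
  · rintro M ⟨X, hXm, i, r, h⟩
    have := hX.fg X hXm
    exact Module.Finite.of_surjective r (fun m => ⟨i m, LinearMap.congr_fun h m⟩)
  · rintro M N ⟨e⟩ hM
    exact LocC.retract e.symm.toLinearMap e.toLinearMap (by ext1; simp) hM
  · intro M _ _
    exact LocC.proj hX M
  · intro M N h
    exact LocC.retract (LinearMap.inl S' M N) (LinearMap.fst S' M N) (by ext; simp) h
  · rintro A B C f g hs ⟨X, hXm, i, r, hir⟩ ⟨Y, hYm, i', r', hir'⟩
    have := hX.fg X hXm
    have := hX.fg Y hYm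
    have hr : Function.Surjective r := fun m => ⟨i m, LinearMap.congr_fun hir m⟩
    have hr' : Function.Surjective r' := fun m => ⟨i' m, LinearMap.congr_fun hir' m⟩
    -- complements
    have k1 := IsSES.ker r hr
    have k2 := IsSES.ker r' hr'
    obtain ⟨ρ1, hρ1⟩ := k1.retraction_of_section i hir
    obtain ⟨ρ2, hρ2⟩ := k2.retraction_of_section i' hir'
    obtain ⟨e1, -, -⟩ := k1.equiv_of_retraction ρ1 hρ1
    obtain ⟨e2, -, -⟩ := k2.equiv_of_retraction ρ2 hρ2
    have hbig := (IsSES.prod_inl_snd (S := S') (A := LinearMap.ker r) (B := LinearMap.ker r')).prodMap hs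
    have hbig2 := (hbig.comp_equiv_left e1).comp_equiv_right e2.symm
    obtain ⟨E0, i0, p0, h0, ⟨e⟩⟩ := loc_ext W S' hbig2
    have hE0 := hX.ext h0 hXm hYm
    refine LocC.retract (L' := ModuleCat.of S' (S' ⊗[S] E0)) (e.symm.toLinearMap ∘ₗ LinearMap.inr S' _ B)
      (LinearMap.snd S' _ B ∘ₗ e.toLinearMap) ?_ (LocC.of hE0)
    apply LinearMap.ext
    intro b
    simp
  · rintro A B C f g hs _ _ _ ⟨Y, hYm, i, r, hir⟩
    have := hX.fg Y hYm
    obtain ⟨K, P, κ, π, hk, _, _, _⟩ := exists_syz S Y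
    have hK := hX.syz hk hYm
    have hk' : IsSES (κ.baseChange S') (π.baseChange S') := hk.baseChange_flat
    obtain ⟨β, hβ⟩ := Module.projective_lifting_property (π.baseChange S') (i ∘ₗ g) hk'.2.1
    obtain ⟨ρ, hρ⟩ := Module.projective_lifting_property g (r ∘ₗ π.baseChange S') hs.2.1
    have hβ' : ∀ z, π.baseChange S' (β z) = i (g z) := LinearMap.congr_fun hβ
    have hρ' : ∀ z, g (ρ z) = r (π.baseChange S' z) := LinearMap.congr_fun hρ
    have hir' : ∀ z, r (i z) = z := LinearMap.congr_fun hir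
    obtain ⟨α, hα⟩ := hk'.lift (β ∘ₗ f) (fun m => by
      rw [LinearMap.comp_apply, hβ', hs.apply_zero, map_zero])
    obtain ⟨σ, hσ⟩ := hs.lift (ρ ∘ₗ κ.baseChange S') (fun m => by
      rw [LinearMap.comp_apply, hρ', hk'.apply_zero, map_zero])
    obtain ⟨t, ht⟩ := hs.lift (LinearMap.id - ρ ∘ₗ β) (fun m => by
      rw [LinearMap.sub_apply, map_sub, LinearMap.comp_apply, hρ', hβ', hir', LinearMap.id_apply, sub_self])
    have hα' : ∀ z, κ.baseChange S' (α z) = β (f z) := LinearMap.congr_fun hα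
    have hσ' : ∀ z, f (σ z) = ρ (κ.baseChange S' z) := LinearMap.congr_fun hσ
    have ht' : ∀ z, f (t z) = z - ρ (β z) := LinearMap.congr_fun ht
    refine LocC.retract (L' := ModuleCat.of S' ((S' ⊗[S] K) × B)) (α.prod f) (σ.coprod t) ?_
      (LocC.prod hX (LocC.of hK) (LocC.proj hX B))
    apply LinearMap.ext
    intro a
    apply hs.1
    change f (σ (α a) + t (f a)) = f a
    rw [map_add, hσ', hα', ht']
    abel

end locres
end ResolvPaper
namespace ResolvPaper

/-! ## Closure under cosyzygies, globally -/
section keyglobal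
open TensorProduct
variable {S : Type u} [CommRing S]

/-- the ideal of elements whose homothety on `M` factors through `𝒵` -/
def facIdeal {𝒵 : Set (ModuleCat.{u} S)} (hZ : IsResolving S 𝒵) (M : ModuleCat.{u} S) : Ideal S where
  carrier := {s | ∃ X ∈ 𝒵, ∃ (a : M →ₗ[S] X) (b : X →ₗ[S] M), b ∘ₗ a = s • LinearMap.id}
  zero_mem' := ⟨ModuleCat.of S S, hZ.proj_mem _ (inferInstanceAs (Module.Finite S S))
    (inferInstanceAs (Module.Projective S S)), 0, 0, by simp⟩
  add_mem' := by
    rintro s t ⟨X, hX, a, b, h⟩ ⟨Y, hY, c, d, h'⟩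
    refine ⟨ModuleCat.of S (X × Y), hZ.prod hX hY, a.prod c, b.coprod d, ?_⟩
    rw [add_smul, ← h, ← h']
    rfl
  smul_mem' := by
    rintro r s ⟨X, hX, a, b, h⟩
    refine ⟨X, hX, r • a, b, ?_⟩
    rw [LinearMap.comp_smul, h, smul_smul, smul_eq_mul]

theorem LCI.key [IsNoetherianRing S] (H : LCI S) {𝒵 : Set (ModuleCat.{u} S)} (hZ : IsResolving S 𝒵)
    (hZG : 𝒵 ⊆ GGcat S) (M P N : ModuleCat.{u} S) (f : M →ₗ[S] P) (g : P →ₗ[S] N) (hs : IsSES f g)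
    (hPf : Module.Finite S P) (hPp : Module.Projective S P) (hN : GG S N) (hM : M ∈ 𝒵) : N ∈ 𝒵 := by
  by_cases h1 : (1 : S) ∈ facIdeal hZ N
  · obtain ⟨X, hX, a, b, h⟩ := h1
    rw [one_smul] at h
    exact hZ.retract a b h hX
  exfalso
  obtain ⟨m, hm, hIm⟩ := Ideal.exists_le_maximal _ ((Ideal.ne_top_iff_one _).2 h1)
  have := hm.isPrime
  obtain ⟨p, hpI, -⟩ := Ideal.exists_minimalPrimes_le hIm
  have hp : p.IsPrime := hpI.1.1
  have hIp : facIdeal hZ N ≤ p := hpI.1.2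
  have hNf := hN.1
  let W := p.primeCompl
  let S' := Localization.AtPrime p
  have hnoeth : IsNoetherianRing S' := IsLocalization.isNoetherianRing W S' ‹_›
  have hflat : Module.Flat S S' := IsLocalization.flat S' W
  have hrad := IsLocalization.AtPrime.radical_map_of_mem_minimalPrimes S' p (facIdeal hZ N) hpI
  rw [Localization.AtPrime.map_eq_maximalIdeal] at hrad
  obtain ⟨k, hk⟩ := Ideal.exists_pow_le_of_le_radical_of_fg hrad.ge
    (IsNoetherian.noetherian (IsLocalRing.maximalIdeal S'))
  obtain ⟨n, hn⟩ := Red.exists S' (H p hp) ((facIdeal hZ N).map (algebraMap S S')) k hk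
    (by rw [← Localization.AtPrime.map_eq_maximalIdeal]; exact Ideal.map_mono hIp)
  have hR : IsResolving S' (LocC 𝒵 S') := LocC.resolving W hZ
  have hRG : LocC 𝒵 S' ⊆ GGcat S' := by
    rintro L ⟨X, hX, i, r, h⟩
    exact GG.retract i r h (GG.localize W S' (hZG hX))
  obtain ⟨X, hX, i, r, hir⟩ := hn.key (LocC 𝒵 S') hR hRG (ModuleCat.of S' (S' ⊗[S] M))
    (ModuleCat.of S' (S' ⊗[S] P)) (ModuleCat.of S' (S' ⊗[S] N)) (f.baseChange S') (g.baseChange S')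
    hs.baseChange_flat (inferInstanceAs (Module.Finite S' (S' ⊗[S] P)))
    (inferInstanceAs (Module.Projective S' (S' ⊗[S] P))) (GG.localize W S' hN) (LocC.of hM) (by
      intro y hy
      obtain ⟨⟨⟨x, X, hX, a, b, hab⟩, w⟩, hxw⟩ := (IsLocalization.mem_map_algebraMap_iff W S').1 hy
      obtain ⟨v, hv⟩ := (IsLocalization.map_units S' w).exists_left_inv
      refine ⟨ModuleCat.of S' (S' ⊗[S] X), LocC.of hX, v • a.baseChange S', b.baseChange S', ?_⟩
      have hy : y = v * algebraMap S S' x := by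
        change y * algebraMap S S' w = algebraMap S S' x at hxw
        rw [← hxw, mul_left_comm, hv, mul_one]
      change b.baseChange S' ∘ₗ (v • a.baseChange S') = y • (LinearMap.id : S' ⊗[S] N →ₗ[S'] S' ⊗[S] N)
      rw [LinearMap.comp_smul, ← LinearMap.baseChange_comp, hab, LinearMap.baseChange_smul,
        LinearMap.baseChange_id, hy, mul_smul, algebraMap_smul])
  change (S' ⊗[S] N) →ₗ[S'] (S' ⊗[S] X) at i
  change (S' ⊗[S] X) →ₗ[S'] (S' ⊗[S] N) at r
  have hXf : Module.Finite S X := hZ.fg _ hX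
  have := Module.finitePresentation_of_finite S N
  have := Module.finitePresentation_of_finite S X
  have hlN := mk_loc (K := N) W S'
  have hlX := mk_loc (K := X) W S'
  obtain ⟨i0, w1, hi0⟩ := Module.FinitePresentation.exists_lift_of_isLocalizedModule W
    (TensorProduct.mk S S' X 1) ((i.restrictScalars S) ∘ₗ TensorProduct.mk S S' N 1)
  obtain ⟨r0, w2, hr0⟩ := Module.FinitePresentation.exists_lift_of_isLocalizedModule W
    (TensorProduct.mk S S' N 1) ((r.restrictScalars S) ∘ₗ TensorProduct.mk S S' X 1)
  have hi0' : ∀ z, (1 : S') ⊗ₜ[S] i0 z = (w1 : S) • i ((1 : S') ⊗ₜ z) := LinearMap.congr_fun hi0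
  have hr0' : ∀ z, (1 : S') ⊗ₜ[S] r0 z = (w2 : S) • r ((1 : S') ⊗ₜ z) := LinearMap.congr_fun hr0
  have hir' : ∀ z, r (i z) = z := LinearMap.congr_fun hir
  obtain ⟨w3, h3⟩ := Module.Finite.exists_smul_of_comp_eq_of_isLocalizedModule W
    (TensorProduct.mk S S' N 1) (r0 ∘ₗ i0) (((w2 : S) * w1) • LinearMap.id) (by
      apply LinearMap.ext
      intro z
      change (1 : S') ⊗ₜ[S] r0 (i0 z) = (1 : S') ⊗ₜ[S] (((w2 : S) * w1) • z)
      rw [hr0', hi0', ← algebraMap_smul S' (w1 : S), map_smul, hir', algebraMap_smul,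
        TensorProduct.tmul_smul, mul_smul])
  have hmem : ((w3 * (w2 * w1) : W) : S) ∈ facIdeal hZ N := by
    refine ⟨X, hX, i0, (w3 : S) • r0, ?_⟩
    rw [LinearMap.smul_comp]
    refine (show (w3 : S) • (r0 ∘ₗ i0) = _ from h3).trans ?_
    change (w3 : S) • (((w2 : S) * w1) • (LinearMap.id : N →ₗ[S] N)) = _
    rw [smul_smul]
    rfl
  exact (w3 * (w2 * w1) : W).2 (hIp hmem)

end keyglobal
end ResolvPaper
namespace ResolvPaper

/-! ## Glueing -/
section glue
variable {S : Type u} [CommRing S]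
variable {A B C A' B' C' K P Q M N L X Y Y' Z Z' E : Type u} [AddCommGroup A] [Module S A]
  [AddCommGroup B] [Module S B]
  [AddCommGroup C] [Module S C] [AddCommGroup A'] [Module S A'] [AddCommGroup B'] [Module S B']
  [AddCommGroup C'] [Module S C'] [AddCommGroup M] [Module S M] [AddCommGroup N] [Module S N]
  [AddCommGroup L] [Module S L] [AddCommGroup X] [Module S X] [AddCommGroup Y] [Module S Y]
  [AddCommGroup K] [Module S K] [AddCommGroup P] [Module S P] [AddCommGroup Q] [Module S Q]
  [AddCommGroup Y'] [Module S Y'] [AddCommGroup Z] [Module S Z] [AddCommGroup Z'] [Module S Z']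
  [AddCommGroup E] [Module S E]

theorem FG.resolving (S : Type u) [CommRing S] [IsNoetherianRing S] :
    IsResolving S {M : ModuleCat.{u} S | Module.Finite S M} where
  fg M hM := hM
  iso_closed M N := fun ⟨e⟩ hM => by
    have : Module.Finite S M := hM
    exact Module.Finite.equiv e
  proj_mem M h _ := h
  summand_closed M N h := by
    have : Module.Finite S (M × N) := h
    exact Module.Finite.of_surjective (LinearMap.fst S M N) LinearMap.fst_surjective
  ext_closed A B C f g h hA hC := by
    have : Module.Finite S A := hA
    have : Module.Finite S C := hC
    exact h.finite_mid
  syzygy_closed K P M f g h h1 _ _ _ := h1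

theorem IsResolving.inter {𝒳 𝒴 : Set (ModuleCat.{u} S)} (hX : IsResolving S 𝒳) (hY : IsResolving S 𝒴) :
    IsResolving S (𝒳 ∩ 𝒴) where
  fg M hM := hX.fg M hM.1
  iso_closed M N e hM := ⟨hX.iso_closed M N e hM.1, hY.iso_closed M N e hM.2⟩
  proj_mem M h h' := ⟨hX.proj_mem M h h', hY.proj_mem M h h'⟩
  summand_closed M N h := ⟨hX.summand_closed M N h.1, hY.summand_closed M N h.2⟩
  ext_closed A B C f g h hA hC := ⟨hX.ext_closed A B C f g h hA.1 hC.1, hY.ext_closed A B C f g h hA.2 hC.2⟩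
  syzygy_closed K P M f g h h1 h2 h3 hM :=
    ⟨hX.syzygy_closed K P M f g h h1 h2 h3 hM.1, hY.syzygy_closed K P M f g h h1 h2 h3 hM.2⟩

theorem resClosure.resolving {𝒯 𝒮 : Set (ModuleCat.{u} S)} (hT : IsResolving S 𝒯) (hS : 𝒮 ⊆ 𝒯) :
    IsResolving S (resClosure S 𝒮) where
  fg M hM := hT.fg M (hM 𝒯 ⟨hT, hS⟩)
  iso_closed M N e hM := fun 𝒳 h𝒳 => h𝒳.1.iso_closed M N e (hM 𝒳 h𝒳)
  proj_mem M h h' := fun 𝒳 h𝒳 => h𝒳.1.proj_mem M h h'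
  summand_closed M N h := fun 𝒳 h𝒳 => h𝒳.1.summand_closed M N (h 𝒳 h𝒳)
  ext_closed A B C f g h hA hC := fun 𝒳 h𝒳 => h𝒳.1.ext_closed A B C f g h (hA 𝒳 h𝒳) (hC 𝒳 h𝒳)
  syzygy_closed K P M f g h h1 h2 h3 hM := fun 𝒳 h𝒳 =>
    h𝒳.1.syzygy_closed K P M f g h h1 h2 h3 (hM 𝒳 h𝒳)

/-- hulls of finite projective dimension -/
theorem LCI.hull_aux [IsNoetherianRing S] (H : LCI S) {𝒳 : Set (ModuleCat.{u} S)} (hX : IsResolving S 𝒳)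
    (n : ℕ) : ∀ M : ModuleCat.{u} S, M ∈ 𝒳 → (∀ i, n < i → EV S M S i) →
    ∃ (Y Z : ModuleCat.{u} S) (f : M →ₗ[S] Y) (g : Y →ₗ[S] Z), IsSES f g ∧ Y ∈ PDcat S ∧
      Z ∈ 𝒳 ∩ GGcat S := by
  have hXG := hX.inter (GGcat.resolving S)
  have hco : ∀ M : ModuleCat.{u} S, M ∈ 𝒳 ∩ GGcat S → ∃ (P M' : ModuleCat.{u} S) (f : M →ₗ[S] P)
      (g : P →ₗ[S] M'), IsSES f g ∧ Module.Finite S P ∧ Module.Projective S P ∧ M' ∈ 𝒳 ∩ GGcat S := by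
    intro M hM
    obtain ⟨P, M', f, g, hs, h1, h2, h3⟩ := GG.cosyz H.hloc (show GG S M from hM.2)
    exact ⟨P, M', f, g, hs, h1, h2, H.key hXG (fun _ h => h.2) M P M' f g hs h1 h2 h3 hM⟩
  induction n with
  | zero =>
    intro M hM hE
    obtain ⟨P, M', f, g, hs, h1, h2, h3⟩ := hco M ⟨hM, hX.fg _ hM, fun i hi => hE i hi⟩
    exact ⟨P, M', f, g, hs, (PDcat.resolving S).proj_mem _ h1 h2, h3⟩
  | succ n ih =>
    intro M hM hE
    have := hX.fg _ hM
    obtain ⟨K, P0, k, π, hs, _, _, _⟩ := exists_syz S M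
    obtain ⟨Y, Z, f, g, hfg, hY, hZ⟩ := ih (ModuleCat.of S K) (hX.syz hs hM)
      (fun i hi => (hs.ev_shift (by omega)).2 (hE _ (by omega)))
    obtain ⟨T, i, p, i', p', h1, h2, -⟩ := hs.pushout hfg
    have hT : T ∈ 𝒳 ∩ GGcat S := hXG.ext h1 hXG.proj hZ
    obtain ⟨P, Z', a, b, hab, hPf, hPp, hZ'⟩ := hco T hT
    obtain ⟨Y', p2, j, q, h3, h4, -⟩ := h2.lemZ' hab
    obtain ⟨hYf, m, hm⟩ := hY
    exact ⟨Y', Z', j, q, h4, ⟨h3.finite_right, m + 1, Y, P, _, p2, hPf, hPp, h3, hm⟩, hZ'⟩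

theorem LCI.hull [IsNoetherianRing S] (H : LCI S) {𝒳 : Set (ModuleCat.{u} S)} (hX : IsResolving S 𝒳)
    (M : ModuleCat.{u} S) (hM : M ∈ 𝒳) :
    ∃ (Y Z : ModuleCat.{u} S) (f : M →ₗ[S] Y) (g : Y →ₗ[S] Z), IsSES f g ∧ Y ∈ PDcat S ∧
      Z ∈ 𝒳 ∩ GGcat S := by
  obtain ⟨n, hn⟩ := H.bd M (hX.fg _ hM)
  exact H.hull_aux hX n M hM hn

theorem IsSES.lemZ2 {f : A →ₗ[S] B} {g : B →ₗ[S] C} (h : IsSES f g)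
    {i : K →ₗ[S] P} {p : P →ₗ[S] B} (h' : IsSES i p) :
    ∃ (K2 : ModuleCat.{u} S) (i2 : K2 →ₗ[S] P) (j : K →ₗ[S] K2) (q : K2 →ₗ[S] A),
      IsSES i2 (g ∘ₗ p) ∧ IsSES j q ∧ ∀ k, i2 (j k) = i k := by
  have hs : IsSES (LinearMap.ker (g ∘ₗ p)).subtype (g ∘ₗ p) :=
    IsSES.ker _ (h.2.1.comp h'.2.1)
  obtain ⟨q, hq⟩ := h.lift (p ∘ₗ (LinearMap.ker (g ∘ₗ p)).subtype) (fun m => m.2)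
  obtain ⟨j, hj⟩ := hs.lift i (fun k => by simp [h'.apply_zero])
  have hq' : ∀ x : LinearMap.ker (g ∘ₗ p), f (q x) = p x.1 := LinearMap.congr_fun hq
  have hj' : ∀ k, (j k).1 = i k := LinearMap.congr_fun hj
  refine ⟨ModuleCat.of S (LinearMap.ker (g ∘ₗ p)), (LinearMap.ker (g ∘ₗ p)).subtype, j, q, hs, ?_, hj'⟩
  refine IsSES.mk' ?_ ?_ ?_ ?_
  · intro a b hab
    apply h'.1
    rw [← hj', ← hj', hab]
  · intro a
    obtain ⟨x, hx⟩ := h'.2.1 (f a)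
    refine ⟨⟨x, ?_⟩, h.1 ?_⟩
    · simp [hx, h.apply_zero]
    · rw [hq', hx]
  · intro k
    apply h.1
    rw [hq', hj', h'.apply_zero, map_zero]
  · intro x hx
    obtain ⟨k, hk⟩ := h'.exists_of x.1 (by rw [← hq', hx, map_zero])
    exact ⟨k, Subtype.ext (by rw [hj', hk])⟩

/-- lifting an extension along `C → Y` when the obstruction in `Ext²(Z, X)` vanishes -/
theorem IsSES.extLift [IsNoetherianRing S] [Module.Finite S Y] {a : C →ₗ[S] Y} {b : Y →ₗ[S] Z} (h : IsSES a b)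
    {u : X →ₗ[S] E} {v : E →ₗ[S] C} (h' : IsSES u v) (hev : EV S Z X 2) :
    ∃ (T : ModuleCat.{u} S) (i : X →ₗ[S] T) (p : T →ₗ[S] Y) (i' : E →ₗ[S] T) (p' : T →ₗ[S] Z),
      IsSES i p ∧ IsSES i' p' := by
  obtain ⟨L, Q, l, π, hs, _, _, _⟩ := exists_syz S Y
  obtain ⟨K2, i2, j, q, h1, h2, h12⟩ := h.lemZ2 hs
  obtain ⟨F, c, d, c', d', h3, h4, -, h5, -⟩ := h'.pullback h2
  obtain ⟨r, hr⟩ := h3.retraction_of_ev ((h1.ev_shift le_rfl).2 hev)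
  have hr' : ∀ x, r (c x) = x := LinearMap.congr_fun hr
  have h5' : ∀ x, d (c' x) = j x := LinearMap.congr_fun h5
  have h6 : IsSES (r.prod (i2 ∘ₗ d)) ((b ∘ₗ π) ∘ₗ LinearMap.snd S X Q) := by
    refine IsSES.mk' ?_ (h1.2.1.comp LinearMap.snd_surjective) (fun x => h1.apply_zero (d x)) ?_
    · rw [injective_iff_map_eq_zero]
      intro x hx
      have hx1 : r x = 0 := congrArg Prod.fst hx
      have hx2 : i2 (d x) = 0 := congrArg Prod.snd hx
      obtain ⟨y, rfl⟩ := h3.exists_of x (h1.1 (hx2.trans (map_zero _).symm))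
      rw [hr'] at hx1
      rw [hx1, map_zero]
    · rintro ⟨y, z⟩ hyz
      obtain ⟨k, rfl⟩ := h1.exists_of z hyz
      obtain ⟨x, rfl⟩ := h3.2.1 k
      refine ⟨x + c (y - r x), Prod.ext ?_ ?_⟩
      · change r (x + c (y - r x)) = y
        rw [map_add, hr']
        abel
      · change i2 (d (x + c (y - r x))) = i2 (d x)
        rw [map_add, h3.apply_zero, add_zero]
  obtain ⟨T, p2, i', p', h7, h8, -⟩ := h4.lemZ' h6
  have hsnd : ∀ x, (((r.prod (i2 ∘ₗ d)) ∘ₗ c') x).2 = l x := by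
    intro x
    change i2 (d (c' x)) = l x
    rw [h5', h12]
  generalize (r.prod (i2 ∘ₗ d)) ∘ₗ c' = lam at h7 hsnd
  obtain ⟨p, hp⟩ := h7.desc (π ∘ₗ LinearMap.snd S X Q) (fun x => by
    change π (lam x).2 = 0
    rw [hsnd, hs.apply_zero])
  have hp' : ∀ z, p (p2 z) = π z.2 := LinearMap.congr_fun hp
  refine ⟨T, p2 ∘ₗ LinearMap.inl S X Q, p, i', p', IsSES.mk' ?_ ?_ ?_ ?_, h8⟩
  · rw [injective_iff_map_eq_zero]
    intro x hx
    obtain ⟨y, hy⟩ := h7.exists_of _ hx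
    have : l y = 0 := by rw [← hsnd, hy]; rfl
    have : y = 0 := hs.1 (this.trans (map_zero _).symm)
    rw [this, map_zero] at hy
    exact (congrArg Prod.fst hy).symm
  · intro y
    obtain ⟨z, rfl⟩ := hs.2.1 y
    exact ⟨p2 (0, z), hp' _⟩
  · intro x
    exact (hp' _).trans (map_zero _)
  · intro t ht
    obtain ⟨⟨x, z⟩, rfl⟩ := h7.2.1 t
    rw [hp'] at ht
    obtain ⟨y, hy⟩ := hs.exists_of z ht
    refine ⟨x - (lam y).1, ?_⟩
    have : ((x, z) : X × Q) = (x - (lam y).1, 0) + lam y := by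
      refine Prod.ext ?_ ?_
      · change x = x - (lam y).1 + (lam y).1
        abel
      · change z = 0 + (lam y).2
        rw [hsnd, hy, zero_add]
    rw [this, map_add, h7.apply_zero, add_zero]
    rfl

/-- comparison of hulls -/
theorem hull_compare [IsNoetherianRing S] (H : LCI S) {𝒴 𝒵 : Set (ModuleCat.{u} S)}
    (hY : IsResolving S 𝒴) (hZ : IsResolving S 𝒵) (hYP : 𝒴 ⊆ PDcat S) (hZG : 𝒵 ⊆ GGcat S)
    {f : A →ₗ[S] Y} {g : Y →ₗ[S] Z} (h : IsSES f g) (hYm : ModuleCat.of S Y ∈ 𝒴) (hZm : ModuleCat.of S Z ∈ 𝒵)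
    {f' : A →ₗ[S] Y'} {g' : Y' →ₗ[S] Z'} (h' : IsSES f' g') (hY' : ModuleCat.of S Y' ∈ PDcat S)
    (hZ' : GG S Z') : ModuleCat.of S Y' ∈ 𝒴 ∧ ModuleCat.of S Z' ∈ 𝒵 := by
  have hZgg : GG S Z := hZG hZm
  obtain ⟨φ, hφ⟩ := h.ev_ext (GG.ev_PD hZgg hY' le_rfl) f'
  obtain ⟨ψ, hψ⟩ := h'.ev_ext (GG.ev_PD hZ' (hYP hYm) le_rfl) f
  have hφ' : ∀ x, φ (f x) = f' x := LinearMap.congr_fun hφ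
  have hψ' : ∀ x, ψ (f' x) = f x := LinearMap.congr_fun hψ
  obtain ⟨φb, hφb⟩ := h.desc (g' ∘ₗ φ) (fun x => by rw [LinearMap.comp_apply, hφ', h'.apply_zero])
  obtain ⟨ψb, hψb⟩ := h'.desc (g ∘ₗ ψ) (fun x => by rw [LinearMap.comp_apply, hψ', h.apply_zero])
  have hφb' : ∀ x, φb (g x) = g' (φ x) := LinearMap.congr_fun hφb
  have hψb' : ∀ x, ψb (g' x) = g (ψ x) := LinearMap.congr_fun hψb
  obtain ⟨θ, hθ⟩ := h'.desc (φ ∘ₗ ψ - LinearMap.id) (fun x => by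
    change φ (ψ (f' x)) - f' x = 0
    rw [hψ', hφ', sub_self])
  have hθ' : ∀ x, θ (g' x) = φ (ψ x) - x := LinearMap.congr_fun hθ
  obtain ⟨P, Z2, κ, ρ, hκ, hPf, hPp, hZ2⟩ := hZ'.cosyz H.hloc
  obtain ⟨t, ht⟩ := hκ.ev_ext (GG.ev_PD hZ2 hY' le_rfl) θ
  have ht' : ∀ x, t (κ x) = θ x := LinearMap.congr_fun ht
  constructor
  · refine hY.retract (B := Y × P) (ψ.prod (κ ∘ₗ g')) (φ.coprod (-t)) ?_ (hY.prod hYm hY.proj)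
    apply LinearMap.ext
    intro x
    change φ (ψ x) + -(t (κ (g' x))) = x
    rw [ht', hθ']
    abel
  · refine hZ.retract (B := Z × P) (ψb.prod κ) (φb.coprod (-(g' ∘ₗ t))) ?_ (hZ.prod hZm hZ.proj)
    apply LinearMap.ext
    intro z
    obtain ⟨x, rfl⟩ := h'.2.1 z
    change φb (ψb (g' x)) + -(g' (t (κ (g' x)))) = g' x
    rw [ht', hθ', hψb', hφb', map_sub]
    abel

/-- modules having a hull in `𝒴` with cokernel in `𝒵` -/
def Glue (𝒴 𝒵 : Set (ModuleCat.{u} S)) : Set (ModuleCat.{u} S) :=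
  {M | ∃ (Y Z : ModuleCat.{u} S) (f : M →ₗ[S] Y) (g : Y →ₗ[S] Z), IsSES f g ∧ Y ∈ 𝒴 ∧ Z ∈ 𝒵}

theorem IsSES.id_zero : IsSES (LinearMap.id : A →ₗ[S] A) (0 : A →ₗ[S] PUnit.{u+1}) :=
  IsSES.mk' Function.injective_id (fun _ => ⟨0, rfl⟩) (fun _ => rfl) (fun b _ => ⟨b, rfl⟩)

theorem Glue.left {𝒴 𝒵 : Set (ModuleCat.{u} S)} (hZ : IsResolving S 𝒵) : 𝒴 ⊆ Glue 𝒴 𝒵 := fun Y hY =>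
  ⟨Y, ModuleCat.of S PUnit, LinearMap.id, 0, IsSES.id_zero, hY, hZ.proj⟩

theorem Glue.right [IsNoetherianRing S] (H : LCI S) {𝒴 𝒵 : Set (ModuleCat.{u} S)} (hY : IsResolving S 𝒴)
    (hZ : IsResolving S 𝒵) (hZG : 𝒵 ⊆ GGcat S) : 𝒵 ⊆ Glue 𝒴 𝒵 := by
  intro M hM
  obtain ⟨P, M', f, g, hs, h1, h2, h3⟩ := GG.cosyz H.hloc (show GG S M from hZG hM)
  exact ⟨P, M', f, g, hs, hY.proj_mem _ h1 h2, H.key hZ hZG M P M' f g hs h1 h2 h3 hM⟩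

theorem Glue.resolving [IsNoetherianRing S] (H : LCI S) {𝒴 𝒵 : Set (ModuleCat.{u} S)}
    (hY : IsResolving S 𝒴) (hZ : IsResolving S 𝒵) (hYP : 𝒴 ⊆ PDcat S) (hZG : 𝒵 ⊆ GGcat S) :
    IsResolving S (Glue 𝒴 𝒵) where
  fg := by
    rintro M ⟨Y, Z, f, g, h, hYm, hZm⟩
    have := hY.fg _ hYm
    exact h.finite_left
  iso_closed := by
    rintro M N ⟨e⟩ ⟨Y, Z, f, g, h, hYm, hZm⟩
    exact ⟨Y, Z, _, g, h.comp_equiv_left e.symm, hYm, hZm⟩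
  proj_mem M h1 h2 := Glue.left hZ (hY.proj_mem M h1 h2)
  summand_closed := by
    rintro M N ⟨Y, Z, f, g, h, hYm, hZm⟩
    have : Module.Finite S Y := hY.fg _ hYm
    have hfin : Module.Finite S (M × N) := h.finite_left
    have hMf : Module.Finite S M := Module.Finite.of_surjective (LinearMap.fst S M N) LinearMap.fst_surjective
    have hNf : Module.Finite S N := Module.Finite.of_surjective (LinearMap.snd S M N) LinearMap.snd_surjective
    obtain ⟨Y1, Z1, f1, g1, h1, hY1, hZ1⟩ := H.hull (FG.resolving S) M hMf
    obtain ⟨Y2, Z2, f2, g2, h2, hY2, hZ2⟩ := H.hull (FG.resolving S) N hNf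
    have hc := hull_compare H hY hZ hYP hZG h hYm hZm (h1.prodMap h2)
      ((PDcat.resolving S).prod hY1 hY2) ((GGcat.resolving S).prod hZ1.2 hZ2.2)
    exact ⟨Y1, Z1, f1, g1, h1, hY.fst hc.1, hZ.fst hc.2⟩
  ext_closed := by
    rintro A B C a b hab ⟨Y1, Z1, f1, g1, h1, hY1, hZ1⟩ ⟨Y2, Z2, f2, g2, h2, hY2, hZ2⟩
    obtain ⟨E, i, p, i', p', h3, h4, -⟩ := hab.pushout h1
    have : Module.Finite S Y2 := hY.fg _ hY2
    obtain ⟨Y, c, d, c', d', h5, h6⟩ := h2.extLift h4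
      (GG.ev_PD (show GG S Z2 from hZG hZ2) (hYP hY1) (by omega))
    obtain ⟨Z, p2, j, q, h7, h8, -⟩ := h3.lemZ' h6
    exact ⟨Y, Z, _, p2, h7, hY.ext h5 hY1 hY2, hZ.ext h8 hZ1 hZ2⟩
  syzygy_closed := by
    rintro K P M k π hs _ _ _ ⟨Y, Z, f, g, h, hYm, hZm⟩
    have := hZ.fg _ hZm
    obtain ⟨L, Q, l, ρ, hl, _, _, _⟩ := exists_syz S Z
    obtain ⟨E, c, d, a, b, h1, h2⟩ := h.horseshoe hs hl
    exact ⟨E, ModuleCat.of S L, a, b, h2, hY.syz h1 hYm, hZ.syz hl hZm⟩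

theorem glue_main [IsNoetherianRing S] (H : LCI S) :
    (∀ 𝒳, IsResolving S 𝒳 → IsResolving S (𝒳 ∩ PDcat S) ∧ IsResolving S (𝒳 ∩ MCMcat S) ∧
      resClosure S ((𝒳 ∩ PDcat S) ∪ (𝒳 ∩ MCMcat S)) = 𝒳) ∧
    (∀ 𝒴 𝒵, IsResolving S 𝒴 → 𝒴 ⊆ PDcat S → IsResolving S 𝒵 → 𝒵 ⊆ MCMcat S →
      IsResolving S (resClosure S (𝒴 ∪ 𝒵)) ∧ resClosure S (𝒴 ∪ 𝒵) ∩ PDcat S = 𝒴 ∧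
        resClosure S (𝒴 ∪ 𝒵) ∩ MCMcat S = 𝒵) := by
  rw [H.mcm]
  constructor
  · intro 𝒳 hX
    refine ⟨hX.inter (PDcat.resolving S), hX.inter (GGcat.resolving S), Set.Subset.antisymm ?_ ?_⟩
    · intro M hM
      exact hM 𝒳 ⟨hX, by rintro N (hN | hN) <;> exact hN.1⟩
    · rintro M hM 𝒲 ⟨hW, hsub⟩
      obtain ⟨Y, Z, f, g, h, hYm, hZm⟩ := H.hull hX M hM
      exact hW.ker h (hsub (Or.inl ⟨hX.ext h hM hZm.1, hYm⟩)) (hsub (Or.inr hZm))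
  · intro 𝒴 𝒵 hY hYP hZ hZG
    have hW := Glue.resolving H hY hZ hYP hZG
    have hsub : 𝒴 ∪ 𝒵 ⊆ Glue 𝒴 𝒵 := Set.union_subset (Glue.left hZ) (Glue.right H hY hZ hZG)
    refine ⟨resClosure.resolving hW hsub, Set.Subset.antisymm ?_ ?_, Set.Subset.antisymm ?_ ?_⟩
    · rintro M ⟨hM, hP⟩
      obtain ⟨Y, Z, f, g, h, hYm, hZm⟩ := hM _ ⟨hW, hsub⟩
      obtain ⟨r, hr⟩ := h.retraction_of_ev (GG.ev_PD (show GG S Z from hZG hZm) hP le_rfl)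
      exact hY.retract f r hr hYm
    · intro M hM
      exact ⟨fun 𝒲 h𝒲 => h𝒲.2 (Or.inl hM), hYP hM⟩
    · rintro M ⟨hM, hG⟩
      obtain ⟨Y, Z, f, g, h, hYm, hZm⟩ := hM _ ⟨hW, hsub⟩
      have hYG : GG S Y := GG.mid h hG (hZG hZm)
      obtain ⟨hYf, n, hn⟩ := hYP hYm
      have := hYG.proj_of_pdLE hn
      exact hZ.syz h hZm
    · intro M hM
      exact ⟨fun 𝒲 h𝒲 => h𝒲.2 (Or.inr hM), hZG hM⟩

end glue
end ResolvPaper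

namespace ResolvPaper
variable (R : Type u) [CommRing R]

/-- Theorem: over a locally complete intersection ring, a resolving subcategory is
determined by its finite-projective-dimension part and its maximal Cohen-Macaulay part:
`Φ(𝒳) = (𝒳 ∩ PD(R), 𝒳 ∩ MCM(R))` and `Ψ(𝒴, 𝒵) = res(𝒴 ∪ 𝒵)` are mutually inverse
bijections. -/
theorem lci_glueing [IsNoetherianRing R]
    (hci : ∀ p : PrimeSpectrum R,
      IsCompleteIntersectionLocalRing (Localization.AtPrime p.asIdeal)) :
    (∀ 𝒳 : Set (ModuleCat.{u} R), IsResolving R 𝒳 →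
      IsResolving R (𝒳 ∩ PDcat R) ∧ IsResolving R (𝒳 ∩ MCMcat R) ∧
      resClosure R ((𝒳 ∩ PDcat R) ∪ (𝒳 ∩ MCMcat R)) = 𝒳) ∧
    (∀ 𝒴 𝒵 : Set (ModuleCat.{u} R),
      IsResolving R 𝒴 → 𝒴 ⊆ PDcat R → IsResolving R 𝒵 → 𝒵 ⊆ MCMcat R →
      IsResolving R (resClosure R (𝒴 ∪ 𝒵)) ∧
      resClosure R (𝒴 ∪ 𝒵) ∩ PDcat R = 𝒴 ∧
      resClosure R (𝒴 ∪ 𝒵) ∩ MCMcat R = 𝒵) := by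
  
  refine glue_main (S := R) ?_
  intro p hp
  have := IsLocalization.isNoetherianRing p.primeCompl (Localization.AtPrime p) ‹_›
  exact CIF.of _ (hci ⟨p, hp⟩)

end ResolvPaper
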